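/- arXiv:1706.04628 — 5 statements merged into one kernel-verified Lean document; each statement's English description precedes it below -/
import Mathlib

section
/- Let {A_i, i ≥ 1} be i.i.d. nonnegative random variables with 0 < μ_A := 1/E[A_1] < ∞. Suppose that for some fixed constants C_3 > 0, s_3 > 1, and r_3 ≥ s_3, for all integers k ≥ 1, E[|k − ∑_{i=1}^k μ_A A_i|^{r_3}] ≤ C_3 k^{s_3}. Then for all nonnegative integers k and all λ > 0, P(max_{j ∈ {1,...,k}} |j − ∑_{i=1}^j μ_A A_i| ≥ λ) ≤ (6(r_3+1)/(s_3−1))^{r_3+1} C_3 k^{s_3} λ^{−r_3}. -/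
open MeasureTheory ProbabilityTheory
open scoped ENNReal

lemma convexOn_abs_rpow_aux {r : ℝ} (hr : 1 ≤ r) :
    ConvexOn ℝ Set.univ (fun x : ℝ => |x| ^ r) := by
  refine ⟨convex_univ, fun x _ y _ a b ha hb hab => ?_⟩
  have h1 := (convexOn_rpow hr).2 (Set.mem_Ici.2 (abs_nonneg x)) (Set.mem_Ici.2 (abs_nonneg y))
    ha hb hab
  refine le_trans ?_ h1
  refine Real.rpow_le_rpow (abs_nonneg _) ?_ (by linarith)
  refine (abs_add_le _ _).trans ?_
  simp [abs_mul, abs_of_nonneg ha, abs_of_nonneg hb]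

/-- Maximal inequality, over sets of consecutive integers, for the centered normalized
partial sums `|j - ∑_{i=1}^j μ_A A_i|` of an i.i.d. nonnegative sequence `A_i` with
`μ_A = 1 / E[A]`, given a central-moment bound on the partial sums. -/
theorem iid_partial_sum_maximal
    {Ω : Type*} [MeasurableSpace Ω] (μ : Measure Ω) [IsProbabilityMeasure μ]
    (A : ℕ → Ω → ℝ)
    (hAmeas : ∀ i, Measurable (A i))
    (hAnn : ∀ i, ∀ᵐ ω ∂μ, 0 ≤ A i ω)
    (hindep : iIndepFun A μ)
    (hlaw : ∀ i, μ.map (A i) = μ.map (A 0))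
    (hint : Integrable (A 0) μ) (hEA : 0 < ∫ ω, A 0 ω ∂μ)
    (μA : ℝ) (hμA : μA = (∫ ω, A 0 ω ∂μ)⁻¹)
    (C₃ s₃ r₃ : ℝ) (hC₃ : 0 < C₃) (hs₃ : 1 < s₃) (hr₃ : s₃ ≤ r₃)
    (hmom : ∀ k : ℕ, 1 ≤ k →
      ∫⁻ ω, ENNReal.ofReal (|(k : ℝ) - ∑ i ∈ Finset.range k, μA * A i ω| ^ r₃) ∂μ
        ≤ ENNReal.ofReal (C₃ * (k : ℝ) ^ s₃)) :
    ∀ k : ℕ, ∀ lam : ℝ, 0 < lam →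
      (μ {ω | ∃ j : ℕ, 1 ≤ j ∧ j ≤ k ∧
          lam ≤ |(j : ℝ) - ∑ i ∈ Finset.range j, μA * A i ω|}).toReal
        ≤ (6 * (r₃ + 1) / (s₃ - 1)) ^ (r₃ + 1) * C₃ * (k : ℝ) ^ s₃ * lam ^ (-r₃) := by
  intro k lam hlam
  have hr1 : 1 < r₃ := lt_of_lt_of_le hs₃ hr₃
  have hconst : (1 : ℝ) ≤ (6 * (r₃ + 1) / (s₃ - 1)) ^ (r₃ + 1) := by
    apply Real.one_le_rpow
    · rw [le_div_iff₀ (by linarith)]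
      linarith
    · linarith
  rcases k with _ | n
  · have hempty : {ω | ∃ j : ℕ, 1 ≤ j ∧ j ≤ 0 ∧
          lam ≤ |(j : ℝ) - ∑ i ∈ Finset.range j, μA * A i ω|} = ∅ := by
      ext ω
      simp only [Set.mem_ofPred_eq, Set.mem_empty_iff_false, iff_false]
      rintro ⟨j, h1, h2, -⟩
      omega
    rw [hempty]
    simp only [measure_empty, ENNReal.toReal_zero]
    positivity
  -- the martingale
  set T : ℕ → Ω → ℝ := fun n ω => ((n + 1 : ℕ) : ℝ) - ∑ i ∈ Finset.range (n + 1), μA * A i ω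
    with hT
  have hid : ∀ i, IdentDistrib (A i) (A 0) μ μ := fun i =>
    ⟨(hAmeas i).aemeasurable, (hAmeas 0).aemeasurable, hlaw i⟩
  have hAint : ∀ i, Integrable (A i) μ := fun i => (hid i).integrable_iff.2 hint
  have hAE : ∀ i, ∫ ω, A i ω ∂μ = ∫ ω, A 0 ω ∂μ := fun i => (hid i).integral_eq
  have hsm : ∀ i, StronglyMeasurable (A i) := fun i => (hAmeas i).stronglyMeasurable
  let F := Filtration.natural A hsm
  have hAF : ∀ i j, i ≤ j → StronglyMeasurable[F j] (A i) := fun i j hij =>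
    (Filtration.stronglyAdapted_natural hsm i).mono (F.mono hij)
  have hTad : StronglyAdapted F T := by
    intro n
    refine StronglyMeasurable.sub stronglyMeasurable_const ?_
    refine Finset.stronglyMeasurable_fun_sum _ fun i hi => ?_
    exact StronglyMeasurable.const_mul (hAF i n (by simp at hi; omega)) _
  have hTint : ∀ n, Integrable (T n) μ := fun n =>
    (integrable_const _).sub (integrable_finsetSum _ fun i _ => (hAint i).const_mul _)
  have hTsucc : ∀ n, T (n + 1) = T n + fun ω => 1 - μA * A (n + 1) ω := by
    intro n
    ext ω
    simp only [hT, Pi.add_apply, Finset.sum_range_succ _ (n + 1)]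
    push_cast
    ring
  have hcond : ∀ n, μ[T (n + 1) | F n] =ᵐ[μ] T n := by
    intro n
    have hD : Integrable (fun ω => 1 - μA * A (n + 1) ω) μ :=
      (integrable_const _).sub ((hAint _).const_mul _)
    have hDz : μ[fun ω => 1 - μA * A (n + 1) ω | F n] =ᵐ[μ] fun _ => (0 : ℝ) := by
      have h := condExp_indep_eq (μ := μ) (f := fun ω => 1 - μA * A (n + 1) ω)
        (hAmeas (n + 1)).comap_le (F.le n)
        (((comap_measurable (A (n + 1))).const_mul μA).const_sub 1).stronglyMeasurable
        (hindep.indep_comap_natural_of_lt hsm (Nat.lt_succ_self n))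
      refine h.trans (Filter.Eventually.of_forall fun _ => ?_)
      show ∫ ω, (1 - μA * A (n + 1) ω) ∂μ = 0
      rw [integral_sub (integrable_const _) ((hAint _).const_mul _), integral_const_mul, hAE, hμA,
        inv_mul_cancel₀ hEA.ne']
      simp
    rw [hTsucc]
    filter_upwards [condExp_add (hTint n) hD (F n), hDz] with ω h1 h2
    rw [h1, Pi.add_apply, h2, condExp_of_stronglyMeasurable (F.le n) (hTad n) (hTint n), add_zero]
  have hfmeas : ∀ n, StronglyMeasurable[F n] (fun ω => |T n ω| ^ r₃) := fun n =>
    (continuous_abs.rpow_const fun _ => Or.inr (by linarith)).comp_stronglyMeasurable (hTad n)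
  have hfint : ∀ n, Integrable (fun ω => |T n ω| ^ r₃) μ := by
    intro n
    refine ⟨((hfmeas n).mono (F.le n)).aestronglyMeasurable, ?_⟩
    rw [hasFiniteIntegral_iff_ofReal (Filter.Eventually.of_forall fun ω => by positivity)]
    exact lt_of_le_of_lt (hmom (n + 1) (by omega)) ENNReal.ofReal_lt_top
  have hsub : Submartingale (fun n ω => |T n ω| ^ r₃) F μ := by
    refine submartingale_nat hfmeas hfint fun n => ?_
    have hcont : Continuous (fun x : ℝ => |x| ^ r₃) :=
      continuous_abs.rpow_const fun x => Or.inr (by linarith)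
    have hJ := (convexOn_abs_rpow_aux hr1.le).map_condExp_le_univ (μ := μ) (F.le n)
      hcont.lowerSemicontinuous (hTint (n + 1)) (hfint (n + 1))
    filter_upwards [hJ, hcond n] with ω h1 h2
    rw [Function.comp_apply, h2] at h1
    exact h1
  have hmax := maximal_ineq hsub (fun n ω => by positivity) (ε := (lam ^ r₃).toNNReal) n
  have hlp : 0 < lam ^ r₃ := Real.rpow_pos_of_pos hlam _
  rw [Real.coe_toNNReal _ hlp.le] at hmax
  set B := {ω | lam ^ r₃ ≤ (Finset.range (n + 1)).sup' Finset.nonempty_range_add_one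
    fun k => |T k ω| ^ r₃} with hB
  have hsubset : {ω | ∃ j : ℕ, 1 ≤ j ∧ j ≤ n + 1 ∧
          lam ≤ |(j : ℝ) - ∑ i ∈ Finset.range j, μA * A i ω|} ⊆ B := by
    rintro ω ⟨j, h1, h2, h3⟩
    obtain ⟨m, rfl⟩ : ∃ m, j = m + 1 := ⟨j - 1, by omega⟩
    refine le_trans (Real.rpow_le_rpow hlam.le h3 (by linarith)) ?_
    exact Finset.le_sup' (fun k => |T k ω| ^ r₃) (Finset.mem_range.2 (by omega))
  have hle : ENNReal.ofReal (∫ ω in B, |T n ω| ^ r₃ ∂μ)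
      ≤ ENNReal.ofReal (C₃ * ((n + 1 : ℕ) : ℝ) ^ s₃) := by
    refine le_trans (ENNReal.ofReal_le_ofReal (setIntegral_le_integral (hfint n)
      (Filter.Eventually.of_forall fun ω => by positivity))) ?_
    rw [ofReal_integral_eq_lintegral_ofReal (hfint n)
      (Filter.Eventually.of_forall fun ω => by positivity)]
    exact hmom (n + 1) (by omega)
  have hfin := ENNReal.toReal_mono ENNReal.ofReal_ne_top (hmax.trans hle)
  rw [ENNReal.toReal_mul, ENNReal.toReal_ofReal (by positivity), ENNReal.coe_toReal,
    Real.coe_toNNReal _ hlp.le] at hfin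
  have hmono : (μ {ω | ∃ j : ℕ, 1 ≤ j ∧ j ≤ n + 1 ∧
          lam ≤ |(j : ℝ) - ∑ i ∈ Finset.range j, μA * A i ω|}).toReal ≤ (μ B).toReal :=
    ENNReal.toReal_mono (measure_ne_top _ _) (measure_mono hsubset)
  refine hmono.trans ?_
  have h1 : (μ B).toReal ≤ C₃ * ((n + 1 : ℕ) : ℝ) ^ s₃ * lam ^ (-r₃) := by
    rw [Real.rpow_neg hlam.le, ← div_eq_mul_inv, le_div_iff₀ hlp]
    linarith
  have h2 : 0 ≤ C₃ * ((n + 1 : ℕ) : ℝ) ^ s₃ * lam ^ (-r₃) := by positivity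
  calc (μ B).toReal ≤ 1 * (C₃ * ((n + 1 : ℕ) : ℝ) ^ s₃ * lam ^ (-r₃)) := by linarith
    _ ≤ (6 * (r₃ + 1) / (s₃ - 1)) ^ (r₃ + 1) * (C₃ * ((n + 1 : ℕ) : ℝ) ^ s₃ * lam ^ (-r₃)) :=
      mul_le_mul_of_nonneg_right hconst h2
    _ = _ := by ring
end

section
/- Let {A_i, i ≥ 1} be i.i.d. nonnegative random variables with 0 < μ := 1/E[A_1] < ∞, and let A_o(t) = max{n ≥ 0 : ∑_{i=1}^n A_i ≤ t} be the associated ordinary renewal counting process. Then for all ν > 0 and λ > 0, P(sup_{t ≥ 0}(A_o(t) − μ t − ν t) ≥ λ) = P(sup_{k ≥ 0}(k − μ ∑_{i=1}^k A_i − (ν/(μ+ν)) k) ≥ λ(1 + ν/μ)^{−1}). -/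
open MeasureTheory ProbabilityTheory
open scoped NNReal ENNReal

/-- The number of renewals in `[0, t]` of a renewal process whose successive renewal
intervals are `ξ 0, ξ 1, ξ 2, ...`. -/
noncomputable def renewalCount (ξ : ℕ → ℝ) (t : ℝ) : ℕ :=
  sSup {n : ℕ | ∑ i ∈ Finset.range n, ξ i ≤ t}

lemma coe_le_iSup_coe_iff {ι : Type*} (f : ι → ℝ) (a : ℝ) :
    (a : EReal) ≤ ⨆ i, (f i : EReal) ↔ ∀ x : ℝ, x < a → ∃ i, x < f i := by
  constructor
  · intro h x hx
    have h1 : (x : EReal) < ⨆ i, (f i : EReal) := lt_of_lt_of_le (by exact_mod_cast hx) h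
    obtain ⟨i, hi⟩ := lt_iSup_iff.1 h1
    exact ⟨i, by exact_mod_cast hi⟩
  · intro h
    by_contra hc
    obtain ⟨x, h1, h2⟩ := EReal.lt_iff_exists_real_btwn.1 (not_le.1 hc)
    obtain ⟨i, hi⟩ := h x (by exact_mod_cast h2)
    have h3 : (f i : EReal) ≤ ⨆ i, (f i : EReal) := le_iSup (fun i => (f i : EReal)) i
    have h4 : (x : EReal) < (f i : EReal) := by exact_mod_cast hi
    exact absurd (h4.trans_le h3) (not_lt.2 h1.le)

lemma path_equiv (ξ : ℕ → ℝ) (h0 : ∀ i, 0 ≤ ξ i)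
    (hS : Filter.Tendsto (fun n => ∑ i ∈ Finset.range n, ξ i) Filter.atTop Filter.atTop)
    (m ν lam : ℝ) (hm : 0 < m) (hν : 0 < ν) :
    ((lam : EReal) ≤ ⨆ t : ℝ≥0,
          (((renewalCount ξ (t : ℝ) : ℝ) - m * (t : ℝ) - ν * (t : ℝ) : ℝ) : EReal)) ↔
    (((lam * (1 + ν / m)⁻¹ : ℝ) : EReal) ≤ ⨆ k : ℕ,
            (((k : ℝ) - m * ∑ i ∈ Finset.range k, ξ i
              - (ν / (m + ν)) * (k : ℝ) : ℝ) : EReal)) := by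
  rw [coe_le_iSup_coe_iff, coe_le_iSup_coe_iff]
  have hbdd : ∀ t : ℝ, BddAbove {n : ℕ | ∑ i ∈ Finset.range n, ξ i ≤ t} := by
    intro t
    obtain ⟨N, hN⟩ := Filter.eventually_atTop.1 (hS.eventually_gt_atTop t)
    refine ⟨N, fun n hn => ?_⟩
    by_contra hc
    exact absurd (hN n (not_le.1 hc).le) (not_lt.2 hn)
  have hc : 0 < 1 + ν / m := by positivity
  have key : ∀ k : ℕ, ∀ s : ℝ, (k : ℝ) - m * s - ν / (m + ν) * k
      = (k - m * s - ν * s) * (1 + ν / m)⁻¹ := by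
    intro k s
    have : m + ν ≠ 0 := by positivity
    field_simp
    ring
  constructor
  · intro h x hx
    obtain ⟨t, ht⟩ := h (x * (1 + ν / m)) (by
      rwa [← lt_mul_inv_iff₀ hc])
    refine ⟨renewalCount ξ t, ?_⟩
    have hmem : ∑ i ∈ Finset.range (renewalCount ξ t), ξ i ≤ t :=
      Nat.sSup_mem (s := {n : ℕ | ∑ i ∈ Finset.range n, ξ i ≤ (t : ℝ)})
        ⟨0, by simp⟩ (hbdd t)
    rw [key, lt_mul_inv_iff₀ hc]
    nlinarith
  · intro h x hx
    obtain ⟨k, hk⟩ := h (x * (1 + ν / m)⁻¹) (by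
      exact mul_lt_mul_of_pos_right hx (inv_pos.2 hc))
    rw [key] at hk
    have hk2 := lt_of_mul_lt_mul_right hk (inv_pos.2 hc).le
    refine ⟨⟨∑ i ∈ Finset.range k, ξ i, Finset.sum_nonneg fun i _ => h0 i⟩, ?_⟩
    have : k ≤ renewalCount ξ (∑ i ∈ Finset.range k, ξ i) :=
      le_csSup (hbdd _) (by simp)
    have h2 : (k : ℝ) ≤ renewalCount ξ (∑ i ∈ Finset.range k, ξ i) := by exact_mod_cast this
    change x < (renewalCount ξ (∑ i ∈ Finset.range k, ξ i) : ℝ) - m * (∑ i ∈ Finset.range k, ξ i)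
      - ν * (∑ i ∈ Finset.range k, ξ i)
    linarith

/-- The probability that the supremum of the drift-adjusted ordinary renewal counting
process `A_o(t) - μ t - ν t` reaches level `λ` equals the probability that a corresponding
drift-adjusted discrete-time random walk reaches level `λ (1 + ν/μ)⁻¹`. -/
theorem renewal_sup_eq_discrete_sup
    {Ω : Type*} [MeasurableSpace Ω] (μ : Measure Ω) [IsProbabilityMeasure μ]
    (A : ℕ → Ω → ℝ)
    (hAmeas : ∀ i, Measurable (A i))
    (hAnn : ∀ i, ∀ᵐ ω ∂μ, 0 ≤ A i ω)
    (hindep : iIndepFun A μ)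
    (hlaw : ∀ i, μ.map (A i) = μ.map (A 0))
    (hint : Integrable (A 0) μ) (hEA : 0 < ∫ ω, A 0 ω ∂μ)
    (μA : ℝ) (hμA : μA = (∫ ω, A 0 ω ∂μ)⁻¹) :
    ∀ ν : ℝ, 0 < ν → ∀ lam : ℝ, 0 < lam →
      (μ {ω | (lam : EReal) ≤ ⨆ t : ℝ≥0,
          (((renewalCount (fun i => A i ω) (t : ℝ) : ℝ) - μA * (t : ℝ) - ν * (t : ℝ) : ℝ) : EReal)}).toReal
        = (μ {ω | ((lam * (1 + ν / μA)⁻¹ : ℝ) : EReal) ≤ ⨆ k : ℕ,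
            (((k : ℝ) - μA * ∑ i ∈ Finset.range k, A i ω
              - (ν / (μA + ν)) * (k : ℝ) : ℝ) : EReal)}).toReal := by
  intro ν hν lam hlam
  have hm : 0 < μA := by rw [hμA]; positivity
  have hslln := strong_law_ae_real A hint (fun i j hij => hindep.indepFun hij)
    (fun i => ⟨(hAmeas i).aemeasurable, (hAmeas 0).aemeasurable, hlaw i⟩)
  congr 1
  apply measure_congr
  filter_upwards [hslln, ae_all_iff.2 hAnn] with ω h1 h2
  have hS : Filter.Tendsto (fun n => ∑ i ∈ Finset.range n, A i ω) Filter.atTop Filter.atTop := by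
    have h3 := h1.pos_mul_atTop hEA (tendsto_natCast_atTop_atTop (R := ℝ))
    refine h3.congr' ?_
    filter_upwards [Filter.eventually_gt_atTop 0] with n hn
    have : (n : ℝ) ≠ 0 := by positivity
    field_simp
  exact propext (path_equiv (fun i => A i ω) h2 hS μA ν lam hm hν)
end

section
/- Suppose E[S] = 1 and that for some positive integer n' with 0 < μ_A < n' < ∞. Then for all x > 2, P(sup_{t ≥ 0}(A(t) − ∑_{i=1}^{n'} N_i(t)) ≥ x) is at most P(sup_{t ≥ 0}(A_{o,n'}(t) − μ_{A,n'} t − (1/2)(n' − μ_{A,n'}) t) ≥ x/2 − 1) + P(sup_{t ≥ 0}(n' t − ∑_{i=1}^{n'} N_i(t) − (1/2)(n' − μ_{A,n'}) t) ≥ x/2). -/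
open MeasureTheory ProbabilityTheory
open scoped NNReal ENNReal

theorem renewalCount_sum_le (ξ : ℕ → ℝ) (t : ℝ) (ht : 0 ≤ t) :
    ∑ i ∈ Finset.range (renewalCount ξ t), ξ i ≤ t := by
  unfold renewalCount
  by_cases hb : BddAbove {n : ℕ | ∑ i ∈ Finset.range n, ξ i ≤ t}
  · exact Nat.sSup_mem (s := {n : ℕ | ∑ i ∈ Finset.range n, ξ i ≤ t}) ⟨0, by simpa using ht⟩ hb
  · have : sSup {n : ℕ | ∑ i ∈ Finset.range n, ξ i ≤ t} = 0 := by
      rw [csSup_of_not_bddAbove hb]; simp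
    rw [this]; simpa using ht

theorem le_renewalCount (ξ : ℕ → ℝ) (t : ℝ) (n : ℕ)
    (h : Filter.Tendsto (fun n : ℕ => ∑ i ∈ Finset.range n, ξ i) Filter.atTop Filter.atTop)
    (hn : ∑ i ∈ Finset.range n, ξ i ≤ t) : n ≤ renewalCount ξ t := by
  unfold renewalCount
  refine le_csSup (s := {n : ℕ | ∑ i ∈ Finset.range n, ξ i ≤ t}) ?_ hn
  obtain ⟨N, hN⟩ := Filter.eventually_atTop.1 (h.eventually_gt_atTop t)
  refine ⟨N, fun m hm => ?_⟩
  by_contra hlt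
  exact absurd (hN m (by omega)) (not_lt.2 hm)

/-- Supremum of the embedded random walk. -/
noncomputable def walkSup (k : ℝ) (γ : ℕ → ℝ) : EReal :=
  ⨆ n : ℕ, (((n : ℝ) - k * ∑ j ∈ Finset.range n, γ j : ℝ) : EReal)

theorem measurable_walkSup (k : ℝ) : Measurable (walkSup k) := by
  unfold walkSup
  refine Measurable.iSup fun n => ?_
  apply measurable_coe_real_ereal.comp
  fun_prop

theorem count_le_walk (γ : ℕ → ℝ) (c k t : ℝ) (hγ : ∀ j, 0 ≤ γ j) (hc0 : 0 ≤ c) (hc1 : c ≤ 1)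
    (hk : 0 ≤ k) (ht : 0 ≤ t) : ∃ n : ℕ, (renewalCount γ t : ℝ) - k * t ≤
      1 + ((n : ℝ) - k * ∑ j ∈ Finset.range n, c * γ (j + 1)) := by
  have h := renewalCount_sum_le γ t ht
  rcases hm : renewalCount γ t with _ | n
  · refine ⟨0, ?_⟩
    have := mul_nonneg hk ht
    simp
    linarith
  · refine ⟨n, ?_⟩
    rw [hm, Finset.sum_range_succ'] at h
    have h0 := hγ 0
    have hs : 0 ≤ ∑ j ∈ Finset.range n, γ (j + 1) := Finset.sum_nonneg fun j _ => hγ _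
    rw [← Finset.mul_sum]
    have h1 : c * ∑ j ∈ Finset.range n, γ (j + 1) ≤ t := by nlinarith
    have := mul_le_mul_of_nonneg_left h1 hk
    push_cast
    linarith

theorem split_EReal {f : ℝ≥0 → ℝ} {h : ℝ≥0 → ℝ} {g : ℕ → ℝ} {a b x : ℝ}
    (hx : x = 1 + a + b)
    (hfg : ∀ t, ∃ n, f t ≤ 1 + g n + h t)
    (H : (x : EReal) ≤ ⨆ t, (f t : EReal)) :
    (a : EReal) ≤ ⨆ n, (g n : EReal) ∨ (b : EReal) ≤ ⨆ t, (h t : EReal) := by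
  by_contra! hcon
  obtain ⟨h1, h2⟩ := hcon
  obtain ⟨a', ha1, ha2⟩ := EReal.lt_iff_exists_real_btwn.1 h1
  obtain ⟨b', hb1, hb2⟩ := EReal.lt_iff_exists_real_btwn.1 h2
  have ha2 := EReal.coe_lt_coe_iff.1 ha2
  have hb2 := EReal.coe_lt_coe_iff.1 hb2
  have : (⨆ t, (f t : EReal)) ≤ ((1 + a' + b' : ℝ) : EReal) := by
    refine iSup_le fun t => ?_
    obtain ⟨n, hn⟩ := hfg t
    have e1 := EReal.coe_lt_coe_iff.1 ((le_iSup (fun n => (g n : EReal)) n).trans_lt ha1)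
    have e2 := EReal.coe_lt_coe_iff.1 ((le_iSup (fun t => (h t : EReal)) t).trans_lt hb1)
    exact EReal.coe_le_coe_iff.2 (by linarith)
  have := EReal.coe_le_coe_iff.1 (H.trans this)
  linarith

/-- Splitting bound: the tail of `sup_{t ≥ 0} (A(t) - ∑_{i=1}^{n'} N_i(t))` is bounded by
the sum of the tails of an arrival-side supremum (for the sped-up ordinary renewal process
`A_{o,n'}` with renewal distribution `min(2ρ_{n'},1)·A` and rate `μ_{A,n'} = max(n'/2, μ_A)`)
and of a service-side supremum.  Here `ξ 0` gives the interval sequence of the equilibrium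
arrival process `A(·)`, `ξ (i+1)` the interval sequence of the `i`-th equilibrium service
renewal process (renewal distribution `S`, `E[S] = 1`), all jointly independent of each
other and of the interval sequence `β` of `A_{o,n'}`. -/
theorem splitting_bound
    {Ω : Type*} [MeasurableSpace Ω] (μ : Measure Ω) [IsProbabilityMeasure μ]
    (S Arv : Ω → ℝ) (hSmeas : Measurable S) (hArvmeas : Measurable Arv)
    (hSnn : ∀ᵐ ω ∂μ, 0 ≤ S ω) (hArvnn : ∀ᵐ ω ∂μ, 0 ≤ Arv ω)
    (hES : ∫ ω, S ω ∂μ = 1)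
    (hArvint : Integrable Arv μ) (hEArv : 0 < ∫ ω, Arv ω ∂μ)
    (μA : ℝ) (hμA : μA = (∫ ω, Arv ω ∂μ)⁻¹)
    (ξ : ℕ → ℕ → Ω → ℝ) (β : ℕ → Ω → ℝ)
    (hξmeas : ∀ i j, Measurable (ξ i j)) (hβmeas : ∀ j, Measurable (β j))
    (hξnn : ∀ i j, ∀ᵐ ω ∂μ, 0 ≤ ξ i j ω)
    (hindep : iIndepFun
      (Sum.elim (fun q : ℕ × ℕ => ξ q.1 q.2) β) μ)
    (hlawA : ∀ j, μ.map (ξ 0 (j + 1)) = μ.map Arv)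
    (hlawS : ∀ i j, μ.map (ξ (i + 1) (j + 1)) = μ.map S)
    (heqA : ∀ y : ℝ, 0 ≤ y →
      (μ {ω | y < ξ 0 0 ω}).toReal = μA * ∫ z in Set.Ioi y, (μ {ω | z < Arv ω}).toReal)
    (heqS : ∀ i, ∀ y : ℝ, 0 ≤ y →
      (μ {ω | y < ξ (i + 1) 0 ω}).toReal = ∫ z in Set.Ioi y, (μ {ω | z < S ω}).toReal)
    (n' : ℕ) (hn' : 1 ≤ n') (hμAn' : μA < (n' : ℝ))
    (hβlaw : ∀ j, μ.map (β j) = μ.map (fun ω => min (2 * (μA / (n' : ℝ))) 1 * Arv ω))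
    (μAn : ℝ) (hμAn : μAn = max ((n' : ℝ) / 2) μA) :
    ∀ x : ℝ, 2 < x →
      (μ {ω | (x : EReal) ≤ ⨆ t : ℝ≥0,
          (((renewalCount (fun j => ξ 0 j ω) (t : ℝ) : ℝ)
            - ∑ i ∈ Finset.range n', (renewalCount (fun j => ξ (i + 1) j ω) (t : ℝ) : ℝ) : ℝ) : EReal)}).toReal
        ≤ (μ {ω | ((x / 2 - 1 : ℝ) : EReal) ≤ ⨆ t : ℝ≥0,
            (((renewalCount (fun j => β j ω) (t : ℝ) : ℝ) - μAn * (t : ℝ)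
              - (1 / 2) * ((n' : ℝ) - μAn) * (t : ℝ) : ℝ) : EReal)}).toReal
          + (μ {ω | ((x / 2 : ℝ) : EReal) ≤ ⨆ t : ℝ≥0,
              (((n' : ℝ) * (t : ℝ)
                - ∑ i ∈ Finset.range n', (renewalCount (fun j => ξ (i + 1) j ω) (t : ℝ) : ℝ)
                - (1 / 2) * ((n' : ℝ) - μAn) * (t : ℝ) : ℝ) : EReal)}).toReal := by
  intro x hx
  have hn'pos : (0 : ℝ) < n' := by exact_mod_cast hn'
  have hμApos : 0 < μA := by rw [hμA]; exact inv_pos.2 hEArv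
  set c : ℝ := min (2 * (μA / (n' : ℝ))) 1 with hc
  have hcpos : 0 < c := lt_min (by positivity) one_pos
  have hc1 : c ≤ 1 := min_le_right _ _
  have hμAnpos : 0 < μAn := by rw [hμAn]; exact lt_max_of_lt_left (by positivity)
  have hμAnle : μAn ≤ n' := by rw [hμAn]; exact max_le (by linarith) hμAn'.le
  obtain ⟨k, hk⟩ : ∃ k : ℝ, k = μAn + (1 / 2) * ((n' : ℝ) - μAn) := ⟨_, rfl⟩
  have hk0 : 0 ≤ k := by rw [hk]; linarith
  -- laws
  have hβind : iIndepFun β μ := hindep.precomp (g := Sum.inr) Sum.inr_injective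
  have hcmeas : Measurable fun y : ℝ => c * y := by fun_prop
  let α : ℕ → Ω → ℝ := fun j ω => c * ξ 0 (j + 1) ω
  have hαmeas : ∀ j, Measurable (α j) := fun j => (hξmeas 0 (j + 1)).const_mul c
  have hξind : iIndepFun (fun j => ξ 0 (j + 1)) μ :=
    hindep.precomp (g := fun j : ℕ => (Sum.inl (0, j + 1) : (ℕ × ℕ) ⊕ ℕ))
      (fun a b hab => by simpa using hab)
  have hαind : iIndepFun α μ := hξind.comp (fun _ y => c * y) (fun _ => hcmeas)
  have hαlaw : ∀ j, μ.map (α j) = μ.map (fun ω => c * Arv ω) := by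
    intro j
    have e1 := Measure.map_map (μ := μ) hcmeas (hξmeas 0 (j + 1))
    have e2 := Measure.map_map (μ := μ) hcmeas hArvmeas
    rw [hlawA j] at e1
    exact e1.symm.trans e2
  have hlaw : μ.map (fun ω j => α j ω) = μ.map (fun ω j => β j ω) := by
    rw [hαind.map_fun_eq_infinitePi_map hαmeas, hβind.map_fun_eq_infinitePi_map hβmeas]
    congr 1
    funext j
    rw [hαlaw, hβlaw]
  have hwalk : μ {ω | ((x / 2 - 1 : ℝ) : EReal) ≤ walkSup k (fun j => α j ω)}
      = μ {ω | ((x / 2 - 1 : ℝ) : EReal) ≤ walkSup k (fun j => β j ω)} := by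
    have hB : MeasurableSet {γ : ℕ → ℝ | ((x / 2 - 1 : ℝ) : EReal) ≤ walkSup k γ} :=
      measurableSet_le measurable_const (measurable_walkSup k)
    have e1 := Measure.map_apply (μ := μ) (measurable_pi_iff.2 hαmeas) hB
    have e2 := Measure.map_apply (μ := μ) (measurable_pi_iff.2 hβmeas) hB
    have e3 := congrArg
      (fun m => m {γ : ℕ → ℝ | ((x / 2 - 1 : ℝ) : EReal) ≤ walkSup k γ}) hlaw
    exact e1.symm.trans (e3.trans e2)
  -- the process `β`
  have hident : ∀ j, IdentDistrib (β j) (fun ω => c * Arv ω) μ μ := fun j =>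
    ⟨(hβmeas j).aemeasurable, (hArvmeas.const_mul c).aemeasurable, hβlaw j⟩
  have hβnn : ∀ᵐ ω ∂μ, ∀ j, 0 ≤ β j ω := by
    rw [ae_all_iff]
    intro j
    refine (hident j).symm.ae_snd (p := fun y => 0 ≤ y) measurableSet_Ici ?_
    filter_upwards [hArvnn] with ω hω
    exact mul_nonneg hcpos.le hω
  have hβlim : ∀ᵐ ω ∂μ, Filter.Tendsto (fun n : ℕ => ∑ i ∈ Finset.range n, β i ω)
      Filter.atTop Filter.atTop := by
    have hsl := strong_law_ae_real β ((hident 0).symm.integrable_snd (hArvint.const_mul c))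
      (fun i j hij => hβind.indepFun hij) (fun i => (hident i).trans (hident 0).symm)
    have hmean : 0 < ∫ ω, β 0 ω ∂μ := by
      rw [(hident 0).integral_eq, integral_const_mul]
      exact mul_pos hcpos hEArv
    filter_upwards [hsl] with ω hω
    have := hω.pos_mul_atTop hmean (tendsto_natCast_atTop_atTop (R := ℝ))
    refine this.congr fun n => ?_
    rcases n with _ | n
    · simp
    · field_simp
  have hξ0 : ∀ᵐ ω ∂μ, ∀ j, 0 ≤ ξ 0 j ω := ae_all_iff.2 (hξnn 0)
  have step1 : μ {ω | (x : EReal) ≤ ⨆ t : ℝ≥0,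
          (((renewalCount (fun j => ξ 0 j ω) (t : ℝ) : ℝ)
            - ∑ i ∈ Finset.range n',
              (renewalCount (fun j => ξ (i + 1) j ω) (t : ℝ) : ℝ) : ℝ) : EReal)}
      ≤ μ ({ω | ((x / 2 - 1 : ℝ) : EReal) ≤ walkSup k (fun j => α j ω)} ∪
        {ω | ((x / 2 : ℝ) : EReal) ≤ ⨆ t : ℝ≥0,
              (((n' : ℝ) * (t : ℝ)
                - ∑ i ∈ Finset.range n', (renewalCount (fun j => ξ (i + 1) j ω) (t : ℝ) : ℝ)
                - (1 / 2) * ((n' : ℝ) - μAn) * (t : ℝ) : ℝ) : EReal)}) := by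
    apply measure_mono_ae
    filter_upwards [hξ0] with ω hω H
    refine split_EReal (x := x) (by ring) ?_ H
    intro t
    obtain ⟨n, hn⟩ := count_le_walk (fun j => ξ 0 j ω) c k t hω hcpos.le hc1 hk0 t.2
    refine ⟨n, ?_⟩
    have hkt : k * (t : ℝ) = n' * t - (1 / 2) * ((n' : ℝ) - μAn) * t := by rw [hk]; ring
    simp only [α]
    linarith
  have step2 : μ {ω | ((x / 2 - 1 : ℝ) : EReal) ≤ walkSup k (fun j => β j ω)}
      ≤ μ {ω | ((x / 2 - 1 : ℝ) : EReal) ≤ ⨆ t : ℝ≥0,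
            (((renewalCount (fun j => β j ω) (t : ℝ) : ℝ) - μAn * (t : ℝ)
              - (1 / 2) * ((n' : ℝ) - μAn) * (t : ℝ) : ℝ) : EReal)} := by
    apply measure_mono_ae
    filter_upwards [hβnn, hβlim] with ω hnn hlim H
    refine le_trans (show ((x / 2 - 1 : ℝ) : EReal) ≤ walkSup k (fun j => β j ω) from H) ?_
    refine iSup_le fun n => ?_
    refine le_iSup_of_le
      (⟨∑ j ∈ Finset.range n, β j ω, Finset.sum_nonneg fun j _ => hnn j⟩ : ℝ≥0) ?_
    refine EReal.coe_le_coe_iff.2 ?_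
    have h1 : (n : ℝ) ≤ renewalCount (fun j => β j ω) (∑ j ∈ Finset.range n, β j ω) := by
      exact_mod_cast le_renewalCount (fun j => β j ω) _ n hlim le_rfl
    change (n : ℝ) - k * (∑ j ∈ Finset.range n, β j ω) ≤
      (renewalCount (fun j => β j ω) (∑ j ∈ Finset.range n, β j ω) : ℝ)
        - μAn * (∑ j ∈ Finset.range n, β j ω)
        - (1 / 2) * ((n' : ℝ) - μAn) * (∑ j ∈ Finset.range n, β j ω)
    rw [hk]
    linarith
  rw [← ENNReal.toReal_add (measure_ne_top _ _) (measure_ne_top _ _)]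
  refine ENNReal.toReal_mono
    (ENNReal.add_ne_top.2 ⟨measure_ne_top _ _, measure_ne_top _ _⟩) ?_
  refine step1.trans ((measure_union_le _ _).trans ?_)
  rw [hwalk]
  gcongr
end

section
/- Suppose E[S] = 1, and that for some positive integer n' and some fixed constants C_1, C_2, C_3 > 0, r_1 > s_1 > 1, r_3 > s_3 > 1, and r_2 > 2 the following hold: (i) 0 < μ_A < n' < ∞; (ii) for all t ≥ 1, E[|∑_{i=1}^{n'} N_i(t) − n' t|^{r_1}] ≤ C_1 n'^{r_1/2} t^{s_1}; (iii) for all t ∈ [0,1], E[|∑_{i=1}^{n'} N_i(t) − n' t|^{r_2}] ≤ C_2 max(n' t, (n' t)^{r_2/2}); (iv) for all k ≥ 1, E[|k − μ_A ∑_{i=1}^k A_i|^{r_3}] ≤ C_3 k^{s_3}. Then for all x ≥ 16, P(sup_{t ≥ 0}(A(t) − ∑_{i=1}^{n'} N_i(t)) ≥ x) is at most (10^6 (r_1+r_2+r_3)^5 / ((s_1−1)(s_3−1)(r_1−s_1)(r_3−s_3)(r_2−2)))^{r_1+r_2+r_3+1} (1+C_1)(1+C_2)(1+C_3) × [ n'^{r_1/2}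 (n' − μ_{A,n'})^{−s_1} x^{−(r_1−s_1)} + n'^{r_2/2} (n' − μ_{A,n'})^{−r_2/2} x^{−r_2/2} + (n' − μ_{A,n'})^{−s_3} (n')^{r_3} μ_{A,n'}^{−(r_3−s_3)} x^{−(r_3−s_3)} ]. -/
open MeasureTheory ProbabilityTheory
open scoped NNReal ENNReal

/-- Prepend an interval to a sequence of intervals. -/
def ncons (p : ℝ × (ℕ → ℝ)) : ℕ → ℝ
  | 0 => p.1
  | k + 1 => p.2 k

lemma measurable_ncons : Measurable ncons := by
  refine measurable_pi_lambda _ fun k => ?_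
  cases k with
  | zero => exact measurable_fst
  | succ k => exact (measurable_pi_apply k).comp measurable_snd

lemma map_ncons (ν : ℕ → Measure ℝ) [∀ i, IsProbabilityMeasure (ν i)] :
    ((ν 0).prod (Measure.infinitePi fun j => ν (j + 1))).map ncons = Measure.infinitePi ν := by
  classical
  refine Measure.eq_infinitePi (μ := ν) fun s t ht => ?_
  obtain ⟨N, hN⟩ : ∃ N, s ⊆ Finset.range (N + 1) :=
    ⟨s.sup id, fun i hi => by
      simpa [Nat.lt_succ_iff] using Finset.le_sup (f := id) hi⟩
  set t' : ℕ → Set ℝ := fun i => if i ∈ s then t i else Set.univ with ht'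
  have hmt' : ∀ i, MeasurableSet (t' i) := fun i => by
    by_cases h : i ∈ s <;> simp [ht', h, ht i]
  have hpi : ncons ⁻¹' (Set.pi (s : Set ℕ) t) =
      t' 0 ×ˢ Set.pi (Finset.range N : Set ℕ) (fun j => t' (j + 1)) := by
    ext p
    simp only [Set.mem_preimage, Set.mem_pi, Set.mem_prod, Finset.mem_coe, Finset.mem_range]
    constructor
    · intro h
      refine ⟨?_, fun j _ => ?_⟩
      · by_cases h0 : 0 ∈ s
        · simpa [ht', h0, ncons] using h 0 h0
        · simp [ht', h0]
      · by_cases h0 : j + 1 ∈ s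
        · simpa [ht', h0, ncons] using h (j + 1) h0
        · simp [ht', h0]
    · rintro ⟨h0, h1⟩ i hi
      cases i with
      | zero => simpa [ht', hi, ncons] using h0
      | succ j =>
        have := h1 j (by simpa using hN hi)
        simpa [ht', hi, ncons] using this
  rw [Measure.map_apply measurable_ncons
    (MeasurableSet.pi s.countable_toSet fun i _ => ht i), hpi, Measure.prod_prod,
    Measure.infinitePi_pi (μ := fun j => ν (j + 1)) (fun i _ => hmt' (i + 1))]
  have : ∏ i ∈ s, ν i (t i) = ∏ i ∈ Finset.range (N + 1), ν i (t' i) := by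
    rw [← Finset.prod_subset hN]
    · refine Finset.prod_congr rfl fun i hi => by simp [ht', hi]
    · intro i _ hi
      simp [ht', hi]
  rw [this, Finset.prod_range_succ', mul_comm]

/-- Number of renewal epochs in `(u, u+h]`. -/
noncomputable def cnt (h : ℝ) (x : ℕ → ℝ) (u : ℝ) : ℝ≥0∞ :=
  ∑' k : ℕ, (Set.Ioc u (u + h)).indicator (fun _ => 1) (∑ i ∈ Finset.range (k + 1), x i)

lemma measurable_cnt (h : ℝ) : Measurable (fun p : (ℕ → ℝ) × ℝ => cnt h p.1 p.2) := by
  unfold cnt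
  refine Measurable.tsum fun k => ?_
  have : (fun p : (ℕ → ℝ) × ℝ => (Set.Ioc p.2 (p.2 + h)).indicator (fun _ => (1:ℝ≥0∞))
      (∑ i ∈ Finset.range (k + 1), p.1 i)) =
      Set.indicator {p : (ℕ → ℝ) × ℝ | p.2 < (∑ i ∈ Finset.range (k + 1), p.1 i) ∧
        (∑ i ∈ Finset.range (k + 1), p.1 i) ≤ p.2 + h} (fun _ => 1) := by
    ext p; simp [Set.indicator]
  rw [this]
  refine measurable_const.indicator ?_
  rw [Set.ofPred_and]
  refine MeasurableSet.inter (measurableSet_lt ?_ ?_) (measurableSet_le ?_ ?_) <;> fun_prop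

lemma cnt_ncons (h : ℝ) (y x0 : ℝ) (x : ℕ → ℝ) (s : ℝ) :
    cnt h (ncons (x0 - y, x)) s = cnt h (ncons (x0, x)) (s + y) := by
  unfold cnt
  refine tsum_congr fun k => ?_
  have h1 : ∀ z, ∑ i ∈ Finset.range (k + 1), ncons (z, x) i = (∑ i ∈ Finset.range k, x i) + z := by
    intro z
    rw [Finset.sum_range_succ']; rfl
  simp only [h1, Set.indicator, Set.mem_Ioc]
  congr 1
  exact propext ⟨fun h => ⟨by linarith [h.1], by linarith [h.2]⟩,
    fun h => ⟨by linarith [h.1], by linarith [h.2]⟩⟩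

lemma cnt_shift (h : ℝ) (x : ℕ → ℝ) (v : ℝ) (hv : 0 ≤ v) :
    cnt h x (v + x 0) = cnt h (fun k => x (k + 1)) v := by
  unfold cnt
  conv_lhs => rw [tsum_eq_zero_add' ENNReal.summable]
  have h0 : (Set.Ioc (v + x 0) (v + x 0 + h)).indicator (fun _ => (1:ℝ≥0∞))
      (∑ i ∈ Finset.range (0 + 1), x i) = 0 := by
    simp [Set.indicator]; intro h; linarith
  rw [h0, zero_add]
  refine tsum_congr fun k => ?_
  rw [Finset.sum_range_succ']
  simp only [Set.indicator, Set.mem_Ioc]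
  congr 1
  exact propext ⟨fun h => ⟨by linarith [h.1], by linarith [h.2]⟩,
    fun h => ⟨by linarith [h.1], by linarith [h.2]⟩⟩

/-- The equilibrium (integrated tail) measure. -/
noncomputable def eqMeas (ν : Measure ℝ) : Measure ℝ :=
  (volume.restrict (Set.Ioi 0)).withDensity (fun y => ν (Set.Ioi y))

lemma measurable_tail (ν : Measure ℝ) : Measurable (fun y : ℝ => ν (Set.Ioi y)) :=
  Antitone.measurable fun _ _ h => measure_mono (Set.Ioi_subset_Ioi h)

lemma lintegral_eqMeas (ν : Measure ℝ) [IsProbabilityMeasure ν] (H : ℝ → ℝ≥0∞) (hH : Measurable H) :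
    ∫⁻ y, H y ∂(eqMeas ν) = ∫⁻ x0, (∫⁻ y in Set.Ioo 0 x0, H (x0 - y)) ∂ν := by
  unfold eqMeas
  rw [lintegral_withDensity_eq_lintegral_mul _ (measurable_tail ν) hH]
  have h1 : ∀ y : ℝ, ((fun y => ν (Set.Ioi y)) * H) y =
      ∫⁻ x0, (Set.Ioi y).indicator (fun _ => H y) x0 ∂ν := by
    intro y
    rw [lintegral_indicator_const measurableSet_Ioi, mul_comm]; rfl
  simp_rw [h1]
  rw [lintegral_lintegral_swap]
  · refine lintegral_congr fun x0 => ?_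
    have h2 : ∫⁻ y in Set.Ioo 0 x0, H (x0 - y) = ∫⁻ y in Set.Ioo 0 x0, H y := by
      rw [← lintegral_indicator measurableSet_Ioo, ← lintegral_indicator measurableSet_Ioo]
      rw [← lintegral_sub_left_eq_self _ x0]
      refine lintegral_congr fun y => ?_
      simp only [Set.indicator, Set.mem_Ioo, sub_sub_cancel]
      congr 1
      exact propext ⟨fun h => ⟨by linarith [h.2], by linarith [h.1]⟩,
        fun h => ⟨by linarith [h.2], by linarith [h.1]⟩⟩
    rw [h2, ← lintegral_indicator measurableSet_Ioo, ← lintegral_indicator measurableSet_Ioi]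
    refine lintegral_congr fun y => ?_
    by_cases h3 : 0 < y <;> by_cases h4 : y < x0 <;> simp [Set.indicator, h3, h4]
  · have : (Function.uncurry fun (y x0 : ℝ) => (Set.Ioi y).indicator (fun _ => H y) x0) =
      Set.indicator {p : ℝ × ℝ | p.1 < p.2} (fun p => H p.1) := by
      ext p; simp [Set.indicator, Function.uncurry]
    rw [this]
    exact ((hH.comp measurable_fst).indicator
      (measurableSet_lt measurable_fst measurable_snd)).aemeasurable

lemma map_shift (ν : Measure ℝ) [IsProbabilityMeasure ν] :
    (Measure.infinitePi fun _ : ℕ => ν).map (fun x k => x (k + 1)) =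
      Measure.infinitePi fun _ : ℕ => ν :=
  Measure.map_infinitePi_infinitePi_of_inj (P := fun _ : ℕ => ν) (f := fun k : ℕ => k + 1)
    (fun a b h => by simpa using h)

/-- one-dimensional stationarity of the equilibrium renewal process -/
lemma stationary_cnt (ν : Measure ℝ) [IsProbabilityMeasure ν] (hν : ∀ᵐ y ∂ν, 0 ≤ y)
    (h s : ℝ) (hs : 0 ≤ s) (B : Set ℝ≥0∞) (hB : MeasurableSet B) :
    ((eqMeas ν).prod (Measure.infinitePi fun _ : ℕ => ν)) {p | cnt h (ncons p) s ∈ B} =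
    ((eqMeas ν).prod (Measure.infinitePi fun _ : ℕ => ν)) {p | cnt h (ncons p) 0 ∈ B} := by
  set P := Measure.infinitePi fun _ : ℕ => ν with hP
  set g : (ℕ → ℝ) → ℝ → ℝ≥0∞ := fun x u => B.indicator 1 (cnt h x u) with hg
  have hgm : Measurable (fun p : (ℕ → ℝ) × ℝ => g p.1 p.2) :=
    (measurable_one.indicator hB).comp (measurable_cnt h)
  have hg1 : ∀ x u, g x u ≤ 1 := fun x u => Set.indicator_le (fun _ _ => le_rfl) _
  have hgx : ∀ x, Measurable (g x) := fun x => hgm.comp (measurable_const.prodMk measurable_id)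
  have : SFinite (eqMeas ν) := by unfold eqMeas; infer_instance
  have hP0 : ∀ᵐ x ∂P, 0 ≤ x 0 := by
    have := Measure.infinitePi_map_eval (fun _ : ℕ => ν) 0
    rw [← this] at hν
    exact ae_of_ae_map (measurable_pi_apply 0).aemeasurable hν
  -- formula
  have key : ∀ s : ℝ, 0 ≤ s → ((eqMeas ν).prod P) {p | cnt h (ncons p) s ∈ B} =
      ∫⁻ x, (∫⁻ u in Set.Ioc s (s + x 0), g x u) ∂P := by
    intro s hs
    have hgc : Measurable (fun p : ℝ × (ℕ → ℝ) => g (ncons p) s) :=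
      hgm.comp (measurable_ncons.prodMk measurable_const)
    have e1 : ((eqMeas ν).prod P) {p | cnt h (ncons p) s ∈ B} =
        ∫⁻ p, g (ncons p) s ∂((eqMeas ν).prod P) := by
      have hm : MeasurableSet {p : ℝ × (ℕ → ℝ) | cnt h (ncons p) s ∈ B} :=
        ((measurable_cnt h).comp (measurable_ncons.prodMk measurable_const)) hB
      rw [← lintegral_indicator_one hm]
      rfl
    rw [e1, lintegral_prod_symm _ hgc.aemeasurable]
    have e2 : ∀ x : ℕ → ℝ, ∫⁻ y, g (ncons (y, x)) s ∂(eqMeas ν) =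
        ∫⁻ x0, (∫⁻ u in Set.Ioc s (s + x0), g (ncons (x0, x)) u) ∂ν := by
      intro x
      rw [lintegral_eqMeas ν (fun y => g (ncons (y, x)) s)
        (hgc.comp (measurable_id.prodMk measurable_const))]
      refine lintegral_congr fun x0 => ?_
      simp only [hg, cnt_ncons]
      rw [restrict_Ioo_eq_restrict_Ioc, ← lintegral_indicator measurableSet_Ioc,
        ← lintegral_indicator measurableSet_Ioc]
      conv_rhs => rw [← lintegral_add_left_eq_self _ s]
      refine lintegral_congr fun y => ?_
      simp [Set.indicator]
    simp_rw [e2]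
    have hF : Measurable (fun x : ℕ → ℝ => ∫⁻ u in Set.Ioc s (s + x 0), g x u) := by
      simp_rw [← lintegral_indicator (measurableSet_Ioc (a := s))]
      refine Measurable.lintegral_prod_right' (f := fun p : (ℕ → ℝ) × ℝ =>
        (Set.Ioc s (s + p.1 0)).indicator (fun a => g p.1 a) p.2) ?_
      have : (fun p : (ℕ → ℝ) × ℝ => (Set.Ioc s (s + p.1 0)).indicator (fun a => g p.1 a) p.2) =
        Set.indicator {p : (ℕ → ℝ) × ℝ | s < p.2 ∧ p.2 ≤ s + p.1 0} (fun p => g p.1 p.2) := by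
        ext p; simp [Set.indicator]
      rw [this]
      refine hgm.indicator ?_
      rw [Set.ofPred_and]
      refine MeasurableSet.inter (measurableSet_lt ?_ ?_) (measurableSet_le ?_ ?_) <;> fun_prop
    have hF2 : Measurable (fun p : ℝ × (ℕ → ℝ) =>
        ∫⁻ u in Set.Ioc s (s + ncons p 0), g (ncons p) u) := hF.comp measurable_ncons
    conv_rhs => rw [hP, ← map_ncons (fun _ => ν), lintegral_map hF measurable_ncons,
      lintegral_prod_symm _ hF2.aemeasurable]
    rfl
  rw [key s hs, key 0 le_rfl]
  -- cancel
  have hfin : ∫⁻ x, (∫⁻ u in Set.Ioc 0 s, g x u) ∂P ≠ ∞ := by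
    have : ∫⁻ x, (∫⁻ u in Set.Ioc 0 s, g x u) ∂P ≤ ∫⁻ x, ENNReal.ofReal s ∂P := by
      refine lintegral_mono fun x => ?_
      calc ∫⁻ u in Set.Ioc 0 s, g x u ≤ ∫⁻ u in Set.Ioc 0 s, 1 := lintegral_mono (hg1 x)
        _ = ENNReal.ofReal s := by simp
    refine ne_top_of_le_ne_top ?_ this
    simp
  have hshift : ∫⁻ x, (∫⁻ u in Set.Ioc (x 0) (s + x 0), g x u) ∂P =
      ∫⁻ x, (∫⁻ u in Set.Ioc 0 s, g x u) ∂P := by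
    have hF : Measurable (fun x : ℕ → ℝ => ∫⁻ u in Set.Ioc 0 s, g x u) :=
      Measurable.lintegral_prod_right' hgm
    conv_rhs => rw [hP, ← map_shift ν, lintegral_map hF (by fun_prop)]
    refine lintegral_congr fun x => ?_
    rw [← lintegral_indicator measurableSet_Ioc, ← lintegral_indicator measurableSet_Ioc,
      ← lintegral_add_right_eq_self _ (x 0)]
    refine lintegral_congr fun v => ?_
    by_cases hv : v ∈ Set.Ioc 0 s
    · have hv' : v + x 0 ∈ Set.Ioc (x 0) (s + x 0) :=
        ⟨by linarith [hv.1], by linarith [hv.2]⟩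
      rw [Set.indicator_of_mem hv, Set.indicator_of_mem hv']
      simp only [hg]
      rw [cnt_shift h x v hv.1.le]
    · have hv' : v + x 0 ∉ Set.Ioc (x 0) (s + x 0) := fun h =>
        hv ⟨by linarith [h.1], by linarith [h.2]⟩
      rw [Set.indicator_of_notMem hv, Set.indicator_of_notMem hv']
  refine (ENNReal.add_right_inj hfin).1 ?_
  nth_rewrite 2 [← hshift]
  have hm0 : Measurable (fun x : ℕ → ℝ => ∫⁻ u in Set.Ioc 0 s, g x u) :=
      Measurable.lintegral_prod_right' hgm
  have hm1 : Measurable (fun x : ℕ → ℝ => ∫⁻ u in Set.Ioc (x 0) (s + x 0), g x u) := by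
    simp_rw [← lintegral_indicator (measurableSet_Ioc)]
    refine Measurable.lintegral_prod_right' (f := fun p : (ℕ → ℝ) × ℝ =>
        (Set.Ioc (p.1 0) (s + p.1 0)).indicator (fun a => g p.1 a) p.2) ?_
    have : (fun p : (ℕ → ℝ) × ℝ => (Set.Ioc (p.1 0) (s + p.1 0)).indicator
          (fun a => g p.1 a) p.2) =
        Set.indicator {p : (ℕ → ℝ) × ℝ | p.1 0 < p.2 ∧ p.2 ≤ s + p.1 0} (fun p => g p.1 p.2) := by
      ext p; simp [Set.indicator]
    rw [this]
    refine hgm.indicator ?_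
    rw [Set.ofPred_and]
    refine MeasurableSet.inter (measurableSet_lt ?_ ?_) (measurableSet_le ?_ ?_) <;> fun_prop
  rw [← lintegral_add_left hm0, ← lintegral_add_left hm1]
  refine lintegral_congr_ae ?_
  filter_upwards [hP0] with x hx
  have a1 := lintegral_union (μ := volume) (f := g x) (A := Set.Ioc 0 s) (B := Set.Ioc s (s + x 0))
    measurableSet_Ioc (Set.Ioc_disjoint_Ioc_of_le le_rfl)
  have a2 := lintegral_union (μ := volume) (f := g x) (A := Set.Ioc 0 (x 0))
    (B := Set.Ioc (x 0) (s + x 0)) measurableSet_Ioc (Set.Ioc_disjoint_Ioc_of_le le_rfl)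
  rw [Set.Ioc_union_Ioc_eq_Ioc hs (by linarith)] at a1
  rw [Set.Ioc_union_Ioc_eq_Ioc hx (by linarith)] at a2
  rw [zero_add, ← a1, a2, add_comm]


/-- A good interval sequence: nonnegative, with partial sums diverging. -/
def GoodSeq (x : ℕ → ℝ) : Prop :=
  (∀ j, 0 ≤ x j) ∧ Filter.Tendsto (fun n => ∑ i ∈ Finset.range n, x i) Filter.atTop Filter.atTop

lemma GoodSeq.bdd {x : ℕ → ℝ} (hx : GoodSeq x) (t : ℝ) :
    BddAbove {n : ℕ | ∑ i ∈ Finset.range n, x i ≤ t} := by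
  obtain ⟨N, hN⟩ := (hx.2.eventually_gt_atTop t).exists_forall_of_atTop
  refine ⟨N, fun n hn => ?_⟩
  by_contra hlt
  exact absurd (hN n (not_le.1 hlt).le) (not_lt.2 hn)

lemma psum_mono {x : ℕ → ℝ} (hx : ∀ j, 0 ≤ x j) : Monotone fun n => ∑ i ∈ Finset.range n, x i :=
  monotone_nat_of_le_succ fun n => by
    rw [Finset.sum_range_succ]; linarith [hx n]

lemma GoodSeq.le_count_iff {x : ℕ → ℝ} (hx : GoodSeq x) {t : ℝ} (ht : 0 ≤ t) (k : ℕ) :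
    k ≤ renewalCount x t ↔ ∑ i ∈ Finset.range k, x i ≤ t := by
  constructor
  · intro h
    have hmem : renewalCount x t ∈ {n : ℕ | ∑ i ∈ Finset.range n, x i ≤ t} :=
      Nat.sSup_mem ⟨0, by simpa using ht⟩ (hx.bdd t)
    exact (psum_mono hx.1 h).trans hmem
  · intro h
    exact le_csSup (hx.bdd t) h

lemma GoodSeq.count_mono {x : ℕ → ℝ} (hx : GoodSeq x) {s t : ℝ} (hs : 0 ≤ s) (hst : s ≤ t) :
    renewalCount x s ≤ renewalCount x t :=
  (hx.le_count_iff (hs.trans hst) _).2 (((hx.le_count_iff hs _).1 le_rfl).trans hst)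

lemma GoodSeq.cnt_eq {x : ℕ → ℝ} (hx : GoodSeq x) {s h : ℝ} (hs : 0 ≤ s) (hh : 0 ≤ h) :
    (cnt h x s).toReal = (renewalCount x (s + h) : ℝ) - renewalCount x s := by
  have hle := hx.count_mono hs (le_add_of_nonneg_right hh : s ≤ s + h)
  have hind : ∀ k : ℕ, (Set.Ioc s (s + h)).indicator (fun _ => (1:ℝ≥0∞))
      (∑ i ∈ Finset.range (k + 1), x i) =
      if k ∈ Finset.Ico (renewalCount x s) (renewalCount x (s + h)) then 1 else 0 := by
    intro k
    simp only [Set.indicator, Set.mem_Ioc, Finset.mem_Ico]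
    have a := hx.le_count_iff (add_nonneg hs hh) (k + 1)
    have b := hx.le_count_iff hs (k + 1)
    congr 1
    rw [← a, ← not_le, ← b]
    simp only [eq_iff_iff]
    omega
  have : cnt h x s = ((renewalCount x (s + h) - renewalCount x s : ℕ) : ℝ≥0∞) := by
    unfold cnt
    simp_rw [hind]
    rw [tsum_eq_sum (s := Finset.Ico (renewalCount x s) (renewalCount x (s + h)))
      (fun k hk => by simp [hk])]
    rw [Finset.sum_ite_mem, Finset.inter_self]
    simp
  rw [this, ENNReal.toReal_natCast, Nat.cast_sub hle]

lemma GoodSeq.count_zero {x : ℕ → ℝ} (hx : GoodSeq x) (h0 : 0 < x 0) : renewalCount x 0 = 0 := by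
  by_contra h
  have := (hx.le_count_iff le_rfl 1).1 (Nat.one_le_iff_ne_zero.2 h)
  simp at this
  linarith

section
variable {Ω : Type*} [MeasurableSpace Ω] {μ : Measure Ω} [IsProbabilityMeasure μ]

lemma good_ae (X : ℕ → Ω → ℝ) (hm : ∀ j, Measurable (X j)) (hnn : ∀ j, ∀ᵐ ω ∂μ, 0 ≤ X j ω)
    (hind : iIndepFun X μ) (S : Ω → ℝ) (hS : Measurable S) (hSint : Integrable S μ)
    (hES : 0 < ∫ ω, S ω ∂μ)
    (hlaw : ∀ j, μ.map (X (j + 1)) = μ.map S) : ∀ᵐ ω ∂μ, GoodSeq (fun j => X j ω) := by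
  have hid : ∀ j, IdentDistrib (X (j + 1)) S μ μ := fun j =>
    ⟨(hm _).aemeasurable, hS.aemeasurable, hlaw j⟩
  have h1 := strong_law_ae_real (fun j => X (j + 1)) ((hid 0).integrable_iff.2 hSint)
    (fun i j hij => hind.indepFun (by simpa using hij)) (fun i => (hid i).trans (hid 0).symm)
  have h0 : ∀ᵐ ω ∂μ, ∀ j, 0 ≤ X j ω := ae_all_iff.2 hnn
  have hE : ∫ ω, X (0 + 1) ω ∂μ = ∫ ω, S ω ∂μ := (hid 0).integral_eq
  filter_upwards [h1, h0] with ω h1 h0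
  refine ⟨h0, ?_⟩
  rw [hE] at h1
  have h2 : Filter.Tendsto (fun n : ℕ => ∑ i ∈ Finset.range n, X (i + 1) ω)
      Filter.atTop Filter.atTop := by
    have h3 := Filter.Tendsto.pos_mul_atTop hES h1 tendsto_natCast_atTop_atTop
    refine h3.congr' ?_
    filter_upwards [Filter.eventually_gt_atTop 0] with n hn
    have : (n : ℝ) ≠ 0 := by positivity
    field_simp
  have h4 : Filter.Tendsto (fun n : ℕ => ∑ i ∈ Finset.range (n + 1), X i ω)
      Filter.atTop Filter.atTop := by
    refine Filter.tendsto_atTop_mono (fun n => ?_) h2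
    rw [Finset.sum_range_succ']
    linarith [h0 0]
  exact (Filter.tendsto_add_atTop_iff_nat 1).1 h4

lemma lintegral_tail (S : Ω → ℝ) (hS : Measurable S) (hnn : ∀ᵐ ω ∂μ, 0 ≤ S ω)
    (hES : ∫ ω, S ω ∂μ = 1) :
    ∫⁻ z in Set.Ioi (0:ℝ), (μ.map S) (Set.Ioi z) = 1 := by
  have hSint : Integrable S μ := by
    by_contra h
    rw [integral_undef h] at hES; exact zero_ne_one hES
  have := lintegral_eq_lintegral_meas_lt μ hnn hS.aemeasurable
  rw [← ofReal_integral_eq_lintegral_ofReal hSint hnn, hES, ENNReal.ofReal_one] at this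
  rw [this]
  refine lintegral_congr fun z => ?_
  rw [Measure.map_apply hS measurableSet_Ioi]; rfl

lemma law_eq (S : Ω → ℝ) (hS : Measurable S) (hSnn : ∀ᵐ ω ∂μ, 0 ≤ S ω)
    (hES : ∫ ω, S ω ∂μ = 1) (X : Ω → ℝ) (hX : Measurable X) (hXnn : ∀ᵐ ω ∂μ, 0 ≤ X ω)
    (heq : ∀ y : ℝ, 0 ≤ y →
      (μ {ω | y < X ω}).toReal = ∫ z in Set.Ioi y, (μ {ω | z < S ω}).toReal) :
    μ.map X = eqMeas (μ.map S) := by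
  have htail := lintegral_tail S hS hSnn hES
  have hprobX : IsProbabilityMeasure (μ.map X) := Measure.isProbabilityMeasure_map hX.aemeasurable
  have hIoi : ∀ y : ℝ, 0 ≤ y → eqMeas (μ.map S) (Set.Ioi y) =
      ∫⁻ z in Set.Ioi y, (μ.map S) (Set.Ioi z) := by
    intro y hy
    unfold eqMeas
    rw [withDensity_apply _ measurableSet_Ioi, Measure.restrict_restrict measurableSet_Ioi,
      Set.Ioi_inter_Ioi, sup_of_le_left hy]
  have hneg : eqMeas (μ.map S) (Set.Iic 0) = 0 := by
    unfold eqMeas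
    rw [withDensity_apply _ measurableSet_Iic, Measure.restrict_restrict measurableSet_Iic,
      Set.Iic_inter_Ioi, Set.Ioc_self, Measure.restrict_empty, lintegral_zero_measure]
  have hprob : IsProbabilityMeasure (eqMeas (μ.map S)) := by
    constructor
    rw [← Set.Iic_union_Ioi (a := (0:ℝ)), measure_union (Set.Iic_disjoint_Ioi le_rfl)
      measurableSet_Ioi, hneg, hIoi 0 le_rfl, htail, zero_add]
  have hII : ∀ y : ℝ, 0 ≤ y → (μ.map X) (Set.Ioi y) = eqMeas (μ.map S) (Set.Ioi y) := by
    intro y hy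
    rw [hIoi y hy, Measure.map_apply hX measurableSet_Ioi]
    have h1 := heq y hy
    have h2 : ∫ z in Set.Ioi y, (μ {ω | z < S ω}).toReal =
        (∫⁻ z in Set.Ioi y, (μ.map S) (Set.Ioi z)).toReal := by
      rw [← integral_toReal]
      · refine integral_congr_ae (Filter.Eventually.of_forall fun z => ?_)
        simp only
        rw [Measure.map_apply hS measurableSet_Ioi]; rfl
      · exact (measurable_tail _).aemeasurable
      · have : IsProbabilityMeasure (μ.map S) := Measure.isProbabilityMeasure_map hS.aemeasurable
        exact Filter.Eventually.of_forall fun z => measure_lt_top _ _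
    rw [h2] at h1
    refine (ENNReal.toReal_eq_toReal_iff' (measure_ne_top _ _) ?_).1 h1
    refine ne_top_of_le_ne_top (by rw [htail]; simp)
      (lintegral_mono_set (Set.Ioi_subset_Ioi hy))
  refine Measure.ext_of_Iic _ _ fun a => ?_
  rcases lt_or_ge a 0 with ha | ha
  · have e1 : eqMeas (μ.map S) (Set.Iic a) = 0 :=
      measure_mono_null (Set.Iic_subset_Iic.2 ha.le) hneg
    rw [e1, Measure.map_apply hX measurableSet_Iic]
    rw [← nonpos_iff_eq_zero]
    refine (measure_mono_null (t := {ω | ¬ 0 ≤ X ω}) (fun ω hω => ?_) hXnn).le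
    simp only [Set.mem_preimage, Set.mem_Iic] at hω
    simp only [Set.mem_ofPred_eq, not_le]; linarith
  · rw [← compl_compl (Set.Iic a), Set.compl_Iic, prob_compl_eq_one_sub measurableSet_Ioi,
      prob_compl_eq_one_sub measurableSet_Ioi, hII a ha]

/-- stationarity of increments of the pooled equilibrium process -/
lemma pooled_stationary (S : Ω → ℝ) (hS : Measurable S) (hSnn : ∀ᵐ ω ∂μ, 0 ≤ S ω)
    (hES : ∫ ω, S ω ∂μ = 1) (X : ℕ → ℕ → Ω → ℝ) (hXm : ∀ i j, Measurable (X i j))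
    (hXnn : ∀ i j, ∀ᵐ ω ∂μ, 0 ≤ X i j ω)
    (hind : iIndepFun (fun p : ℕ × ℕ => X p.1 p.2) μ)
    (hlaw : ∀ i j, μ.map (X i (j + 1)) = μ.map S)
    (heq : ∀ i, ∀ y : ℝ, 0 ≤ y →
      (μ {ω | y < X i 0 ω}).toReal = ∫ z in Set.Ioi y, (μ {ω | z < S ω}).toReal) (n : ℕ) :
    (∀ i, ∀ᵐ ω ∂μ, GoodSeq (fun j => X i j ω)) ∧
    (∀ᵐ ω ∂μ, ∀ i, renewalCount (fun j => X i j ω) 0 = 0) ∧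
    (∀ t : ℝ, 0 ≤ t → AEMeasurable
      (fun ω => ∑ i ∈ Finset.range n, (renewalCount (fun j => X i j ω) t : ℝ)) μ) ∧
    ∀ s h : ℝ, 0 ≤ s → 0 ≤ h → IdentDistrib
      (fun ω => ∑ i ∈ Finset.range n, (renewalCount (fun j => X i j ω) (s + h) : ℝ) -
        ∑ i ∈ Finset.range n, (renewalCount (fun j => X i j ω) s : ℝ))
      (fun ω => ∑ i ∈ Finset.range n, (renewalCount (fun j => X i j ω) h : ℝ)) μ μ := by
  have hSint : Integrable S μ := by
    by_contra h
    rw [integral_undef h] at hES; exact zero_ne_one hES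
  have hindi : ∀ i, iIndepFun (X i) μ := fun i =>
    hind.precomp (g := fun j : ℕ => (i, j)) (fun a b h => by simpa using h)
  have hgood : ∀ i, ∀ᵐ ω ∂μ, GoodSeq (fun j => X i j ω) := fun i =>
    good_ae (X i) (hXm i) (hXnn i) (hindi i) S hS hSint (by rw [hES]; exact one_pos) (hlaw i)
  have hgood' : ∀ᵐ ω ∂μ, ∀ i, GoodSeq (fun j => X i j ω) := ae_all_iff.2 hgood
  have hpν : IsProbabilityMeasure (μ.map S) := Measure.isProbabilityMeasure_map hS.aemeasurable
  have hlaw0 : ∀ i, μ.map (X i 0) = eqMeas (μ.map S) := fun i =>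
    law_eq S hS hSnn hES (X i 0) (hXm i 0) (hXnn i 0) (heq i)
  have hpe : IsProbabilityMeasure (eqMeas (μ.map S)) := by
    rw [← hlaw0 0]; exact Measure.isProbabilityMeasure_map (hXm 0 0).aemeasurable
  have hpos : ∀ᵐ ω ∂μ, ∀ i, 0 < X i 0 ω := by
    refine ae_all_iff.2 fun i => ?_
    have : ∀ᵐ y ∂(μ.map (X i 0)), 0 < y := by
      rw [hlaw0 i]
      unfold eqMeas
      refine (withDensity_absolutelyContinuous _ _).ae_le ?_
      exact ae_restrict_mem measurableSet_Ioi
    exact ae_of_ae_map (hXm i 0).aemeasurable this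
  have hzero : ∀ᵐ ω ∂μ, ∀ i, renewalCount (fun j => X i j ω) 0 = 0 := by
    filter_upwards [hgood', hpos] with ω h1 h2 i
    exact (h1 i).count_zero (h2 i)
  have hXm' : ∀ i, Measurable (fun ω => fun j => X i j ω) := fun i =>
    measurable_pi_lambda _ fun j => hXm i j
  have hcm : ∀ h s i, Measurable (fun ω => cnt h (fun j => X i j ω) s) := fun h s i =>
    (measurable_cnt h).comp ((hXm' i).prodMk measurable_const)
  -- law of i-th sequence
  have hseq : ∀ i, μ.map (fun ω => fun j => X i j ω) =
      ((eqMeas (μ.map S)).prod (Measure.infinitePi fun _ : ℕ => μ.map S)).map ncons := by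
    intro i
    have hp : ∀ j, IsProbabilityMeasure (μ.map (X i j)) := fun j =>
      Measure.isProbabilityMeasure_map (hXm i j).aemeasurable
    rw [(iIndepFun_iff_map_fun_eq_infinitePi_map (hXm i)).1 (hindi i),
      ← map_ncons (fun j => μ.map (X i j))]
    simp_rw [hlaw0 i, hlaw i]
  have hν : ∀ᵐ y ∂(μ.map S), 0 ≤ y :=
    (ae_map_iff hS.aemeasurable measurableSet_Ici).2 hSnn
  have hid : ∀ s h, 0 ≤ s → ∀ i, IdentDistrib (fun ω => cnt h (fun j => X i j ω) s)
      (fun ω => cnt h (fun j => X i j ω) 0) μ μ := by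
    intro s h hs i
    refine ⟨(hcm h s i).aemeasurable, (hcm h 0 i).aemeasurable, ?_⟩
    ext B hB
    have e : ∀ s, (μ.map (fun ω => cnt h (fun j => X i j ω) s)) B =
        ((eqMeas (μ.map S)).prod (Measure.infinitePi fun _ : ℕ => μ.map S))
          {p | cnt h (ncons p) s ∈ B} := by
      intro s
      have hc : Measurable (fun x => cnt h x s) :=
        (measurable_cnt h).comp (measurable_id.prodMk measurable_const)
      have : (fun ω => cnt h (fun j => X i j ω) s) =
        (fun x => cnt h x s) ∘ (fun ω => fun j => X i j ω) := rfl
      rw [this, ← Measure.map_map hc (hXm' i), hseq i, Measure.map_map hc measurable_ncons,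
        Measure.map_apply (hc.comp measurable_ncons) hB]
      rfl
    rw [e s, e 0, stationary_cnt _ hν h s hs B hB]
  have hindS : iIndepFun (fun i ω => fun j => X i j ω) μ := by
    have hp : ∀ i j, IsProbabilityMeasure (μ.map (X i j)) := fun i j =>
      Measure.isProbabilityMeasure_map (hXm i j).aemeasurable
    rw [iIndepFun_iff_map_fun_eq_infinitePi_map hXm']
    have h1 := (iIndepFun_iff_map_fun_eq_infinitePi_map
      (X := fun p : ℕ × ℕ => X p.1 p.2) (fun p => hXm p.1 p.2)).1 hind
    have h2 := Measure.infinitePi_map_curry (fun i j => μ.map (X i j))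
    rw [← h1, Measure.map_map (by fun_prop) (by fun_prop)] at h2
    simp_rw [fun i => (iIndepFun_iff_map_fun_eq_infinitePi_map (hXm i)).1 (hindi i)]
    exact h2
  have hsum : ∀ s h, 0 ≤ s → 0 ≤ h → (fun ω => ∑ i ∈ Finset.range n,
      (cnt h (fun j => X i j ω) s).toReal) =ᵐ[μ]
      (fun ω => ∑ i ∈ Finset.range n, (renewalCount (fun j => X i j ω) (s + h) : ℝ) -
        ∑ i ∈ Finset.range n, (renewalCount (fun j => X i j ω) s : ℝ)) := by
    intro s h hs hh
    filter_upwards [hgood'] with ω hω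
    rw [← Finset.sum_sub_distrib]
    exact Finset.sum_congr rfl fun i _ => (hω i).cnt_eq hs hh
  have hsum0 : ∀ h, 0 ≤ h → (fun ω => ∑ i ∈ Finset.range n,
      (cnt h (fun j => X i j ω) 0).toReal) =ᵐ[μ]
      (fun ω => ∑ i ∈ Finset.range n, (renewalCount (fun j => X i j ω) h : ℝ)) := by
    intro h hh
    filter_upwards [hsum 0 h le_rfl hh, hzero] with ω h1 h2
    rw [h1]
    simp [h2]
  have hsm : ∀ s h, Measurable (fun ω => ∑ i ∈ Finset.range n,
      (cnt h (fun j => X i j ω) s).toReal) := fun s h =>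
    Finset.measurable_sum _ fun i _ => (hcm h s i).ennreal_toReal
  refine ⟨hgood, hzero, fun t ht => (hsm 0 t).aemeasurable.congr (hsum0 t ht), ?_⟩
  intro s h hs hh
  have hindc : ∀ s, iIndepFun (fun i ω => cnt h (fun j => X i j ω) s) μ := fun s =>
    hindS.comp (fun _ x => cnt h x s)
      (fun _ => (measurable_cnt h).comp (measurable_id.prodMk measurable_const))
  have hpi := IdentDistrib.pi (hid s h hs) (hindc s) (hindc 0)
  have hu : Measurable (fun c : ℕ → ℝ≥0∞ => ∑ i ∈ Finset.range n, (c i).toReal) :=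
    Finset.measurable_sum _ fun i _ => (measurable_pi_apply i).ennreal_toReal
  have h3 := hpi.comp hu
  have h4 := (IdentDistrib.of_ae_eq (hsm s h).aemeasurable (hsum s h hs hh)).symm
  have h5 := IdentDistrib.of_ae_eq (hsm 0 h).aemeasurable (hsum0 h hh)
  exact (h4.trans h3).trans h5

end


lemma two_rpow_neg_le {v : ℝ} (h0 : 0 ≤ v) (h1 : v ≤ 1) : (2:ℝ) ^ (-v) ≤ 1 - v / 2 := by
  have := _root_.rpow_one_add_le_one_add_mul_self (s := -1/2) (by norm_num) h0 h1
  have e : (2:ℝ) ^ (-v) = (1 + -1/2) ^ v := by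
    rw [Real.rpow_neg (by norm_num), ← Real.inv_rpow (by norm_num)]; norm_num
  rw [e]; linarith

lemma geom_const {v a : ℝ} (h0 : 0 < v) (h1 : v ≤ 1) (h2 : v ≤ a) :
    (1 - (2:ℝ) ^ (-a))⁻¹ ≤ 2 / v := by
  have h3 : (2:ℝ) ^ (-a) ≤ 2 ^ (-v) := Real.rpow_le_rpow_of_exponent_le (by norm_num) (by linarith)
  have h4 := two_rpow_neg_le h0.le h1
  have : v / 2 ≤ 1 - (2:ℝ) ^ (-a) := by linarith
  calc (1 - (2:ℝ) ^ (-a))⁻¹ ≤ (v / 2)⁻¹ := inv_anti₀ (by positivity) this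
    _ = 2 / v := by rw [inv_div]

lemma chain_det (L : ℕ) : ∀ (x b : ℕ → ℝ), (∀ l, 0 ≤ b l) → x 0 = 0 →
    (∀ l ≤ L, ∀ i < 2 ^ l, |x ((i + 1) * 2 ^ (L - l)) - x (i * 2 ^ (L - l))| ≤ b l) →
    ∀ k ≤ 2 ^ L, |x k| ≤ ∑ l ∈ Finset.range (L + 1), b l := by
  induction L with
  | zero =>
    intro x b hb hx0 h k hk
    have h0 := h 0 le_rfl 0 (by norm_num)
    interval_cases k
    · simpa [hx0] using hb 0
    · simpa [hx0] using h0
  | succ L ih =>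
    intro x b hb hx0 h k hk
    have h1 := ih (fun k => x (2 * k)) b hb (by simpa using hx0) (by
      intro l hl i hi
      have := h l (by omega) i hi
      have e : L + 1 - l = (L - l) + 1 := by omega
      rw [e, pow_succ] at this
      have e1 : ∀ m : ℕ, 2 * (m * 2 ^ (L - l)) = m * (2 ^ (L - l) * 2) := fun m => by ring
      simp only [e1]
      exact this)
    rw [Finset.sum_range_succ]
    rcases Nat.even_or_odd' k with ⟨j, hj | hj⟩
    · have := h1 j (by rw [pow_succ] at hk; omega)
      rw [hj]
      linarith [hb (L + 1)]
    · have hjL : j < 2 ^ L := by rw [pow_succ] at hk; omega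
      have a := h1 j hjL.le
      have b' := h (L + 1) le_rfl (2 * j) (by rw [pow_succ]; omega)
      simp only [Nat.sub_self, pow_zero, mul_one] at b'
      rw [hj]
      have := abs_sub_abs_le_abs_sub (x (2 * j + 1)) (x (2 * j))
      linarith

lemma chain_term {B s r η lam : ℝ} (hB : 0 ≤ B) (hr : 1 ≤ r) (hη : 0 < η) (hη1 : η ≤ 1)
    (hηr : η * r ≤ (s - 1) / 2) (hlam : 0 < lam) (l : ℕ) :
    (2:ℝ) ^ l * (B * ((2:ℝ) ^ l) ^ (-s) * (lam * ((1 - (2:ℝ) ^ (-η)) * ((2:ℝ) ^ (-η)) ^ l)) ^ (-r)) ≤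
      (2 / η) ^ r * B * lam ^ (-r) * ((2:ℝ) ^ (-((s - 1) / 2))) ^ l := by
  have h2 : (0:ℝ) < 2 := by norm_num
  have hq : η / 2 ≤ 1 - (2:ℝ) ^ (-η) := by linarith [two_rpow_neg_le hη.le hη1]
  have hq0 : 0 < 1 - (2:ℝ) ^ (-η) := by linarith
  have e1 : (lam * ((1 - (2:ℝ) ^ (-η)) * ((2:ℝ) ^ (-η)) ^ l)) ^ (-r) =
      lam ^ (-r) * (1 - (2:ℝ) ^ (-η)) ^ (-r) * 2 ^ (η * r * l) := by
    rw [Real.mul_rpow hlam.le (by positivity), Real.mul_rpow hq0.le (by positivity),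
      ← Real.rpow_natCast, ← Real.rpow_mul h2.le, ← Real.rpow_mul h2.le, ← mul_assoc]
    congr 2; ring
  have e2 : (1 - (2:ℝ) ^ (-η)) ^ (-r) ≤ (2 / η) ^ r := by
    rw [Real.rpow_neg hq0.le, ← Real.inv_rpow hq0.le]
    refine Real.rpow_le_rpow (by positivity) ?_ (by linarith)
    exact geom_const hη hη1 le_rfl
  have e3 : (2:ℝ) ^ l * ((2:ℝ) ^ l) ^ (-s) * 2 ^ (η * r * l) ≤ ((2:ℝ) ^ (-((s - 1) / 2))) ^ l := by
    rw [← Real.rpow_natCast, ← Real.rpow_natCast, ← Real.rpow_mul h2.le, ← Real.rpow_mul h2.le,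
      ← Real.rpow_add h2, ← Real.rpow_add h2]
    refine Real.rpow_le_rpow_of_exponent_le (by norm_num) ?_
    have : (0:ℝ) ≤ l := Nat.cast_nonneg l
    nlinarith
  rw [e1]
  calc (2:ℝ) ^ l * (B * ((2:ℝ) ^ l) ^ (-s) *
        (lam ^ (-r) * (1 - (2:ℝ) ^ (-η)) ^ (-r) * 2 ^ (η * r * l)))
      = (1 - (2:ℝ) ^ (-η)) ^ (-r) * B * lam ^ (-r) *
        ((2:ℝ) ^ l * ((2:ℝ) ^ l) ^ (-s) * 2 ^ (η * r * l)) := by ring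
    _ ≤ (2 / η) ^ r * B * lam ^ (-r) * ((2:ℝ) ^ (-((s - 1) / 2))) ^ l := by
      gcongr

lemma chain_sum {B s r η lam : ℝ} (hB : 0 ≤ B) (hr : 1 ≤ r) (hη : 0 < η) (hη1 : η ≤ 1)
    (hηr : η * r ≤ (s - 1) / 2) (hlam : 0 < lam) (L : ℕ) :
    ∑ l ∈ Finset.range (L + 1), (2:ℝ) ^ l * (B * ((2:ℝ) ^ l) ^ (-s) *
      (lam * ((1 - (2:ℝ) ^ (-η)) * ((2:ℝ) ^ (-η)) ^ l)) ^ (-r)) ≤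
      (2 / η) ^ (r + 1) * B * lam ^ (-r) := by
  have hηs : η ≤ (s - 1) / 2 := by nlinarith
  have hθ0 : 0 ≤ (2:ℝ) ^ (-((s - 1) / 2)) := by positivity
  have hθ1 : (2:ℝ) ^ (-((s - 1) / 2)) < 1 :=
    Real.rpow_lt_one_of_one_lt_of_neg (by norm_num) (by linarith)
  calc _ ≤ ∑ l ∈ Finset.range (L + 1), (2 / η) ^ r * B * lam ^ (-r) *
        ((2:ℝ) ^ (-((s - 1) / 2))) ^ l :=
        Finset.sum_le_sum fun l _ => chain_term hB hr hη hη1 hηr hlam l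
    _ = (2 / η) ^ r * B * lam ^ (-r) * ∑ l ∈ Finset.range (L + 1),
        ((2:ℝ) ^ (-((s - 1) / 2))) ^ l := by rw [Finset.mul_sum]
    _ ≤ (2 / η) ^ r * B * lam ^ (-r) * (2 / η) := by
        gcongr
        calc _ ≤ ∑' l : ℕ, ((2:ℝ) ^ (-((s - 1) / 2))) ^ l :=
              (summable_geometric_of_lt_one hθ0 hθ1).sum_le_tsum _ (fun _ _ => by positivity)
          _ = (1 - (2:ℝ) ^ (-((s - 1) / 2)))⁻¹ := tsum_geometric_of_lt_one hθ0 hθ1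
          _ ≤ 2 / η := geom_const hη hη1 hηs
    _ = (2 / η) ^ (r + 1) * B * lam ^ (-r) := by
        rw [Real.rpow_add_one (by positivity)]; ring

lemma chain_prob {Ω : Type*} [MeasurableSpace Ω] {μ : Measure Ω} (X : ℕ → Ω → ℝ) (L : ℕ)
    (hX0 : ∀ᵐ ω ∂μ, X 0 ω = 0) {B₁ s₁ r₁ B₂ s₂ r₂ η lam : ℝ}
    (hB₁ : 0 ≤ B₁) (hr₁ : 1 ≤ r₁) (hB₂ : 0 ≤ B₂) (hr₂ : 1 ≤ r₂) (hη : 0 < η) (hη1 : η ≤ 1)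
    (hηr₁ : η * r₁ ≤ (s₁ - 1) / 2) (hηr₂ : η * r₂ ≤ (s₂ - 1) / 2) (hlam : 0 < lam)
    (hinc : ∀ l ≤ L, ∀ i < 2 ^ l, ∀ u : ℝ, 0 < u →
      μ {ω | u ≤ |X ((i + 1) * 2 ^ (L - l)) ω - X (i * 2 ^ (L - l)) ω|} ≤
        ENNReal.ofReal (B₁ * ((2:ℝ) ^ l) ^ (-s₁) * u ^ (-r₁) + B₂ * ((2:ℝ) ^ l) ^ (-s₂) * u ^ (-r₂))) :
    μ {ω | ∃ k ≤ 2 ^ L, lam ≤ |X k ω|} ≤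
      ENNReal.ofReal ((2 / η) ^ (r₁ + 1) * B₁ * lam ^ (-r₁) +
        (2 / η) ^ (r₂ + 1) * B₂ * lam ^ (-r₂)) := by
  have hq : η / 2 ≤ 1 - (2:ℝ) ^ (-η) := by linarith [two_rpow_neg_le hη.le hη1]
  have hq0 : 0 < 1 - (2:ℝ) ^ (-η) := by linarith
  set b : ℕ → ℝ := fun l => lam * ((1 - (2:ℝ) ^ (-η)) * ((2:ℝ) ^ (-η)) ^ l) with hb
  have hbpos : ∀ l, 0 < b l := fun l => by positivity
  have hbsum : ∑ l ∈ Finset.range (L + 1), b l < lam := by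
    have e : ∑ l ∈ Finset.range (L + 1), b l = lam * (1 - ((2:ℝ) ^ (-η)) ^ (L + 1)) := by
      simp only [hb]
      rw [← Finset.mul_sum, ← Finset.mul_sum, mul_neg_geom_sum]
    rw [e]
    have : 0 < ((2:ℝ) ^ (-η)) ^ (L + 1) := by positivity
    nlinarith
  have hsub : {ω | ∃ k ≤ 2 ^ L, lam ≤ |X k ω|} ⊆ {ω | ¬ X 0 ω = 0} ∪
      ⋃ l ∈ Finset.range (L + 1), ⋃ i ∈ Finset.range (2 ^ l),
        {ω | b l ≤ |X ((i + 1) * 2 ^ (L - l)) ω - X (i * 2 ^ (L - l)) ω|} := by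
    rintro ω ⟨k, hk, hlk⟩
    by_contra hcon
    simp only [Set.mem_union, Set.mem_iUnion, Finset.mem_range, not_or, not_exists] at hcon
    obtain ⟨h0, hcon⟩ := hcon
    have h0' : X 0 ω = 0 := not_not.1 h0
    have := chain_det L (fun k => X k ω) b (fun l => (hbpos l).le) h0' (by
      intro l hl i hi
      exact (not_le.1 (hcon l (by omega) i hi)).le) k hk
    linarith
  refine (measure_mono hsub).trans ((measure_union_le _ _).trans ?_)
  have hz : μ {ω | ¬ X 0 ω = 0} = 0 := hX0
  rw [hz, zero_add]
  have hpos1 : ∀ l, 0 ≤ B₁ * ((2:ℝ) ^ l) ^ (-s₁) * b l ^ (-r₁) := fun l => by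
    have := (hbpos l).le; positivity
  have hpos2 : ∀ l, 0 ≤ B₂ * ((2:ℝ) ^ l) ^ (-s₂) * b l ^ (-r₂) := fun l => by
    have := (hbpos l).le; positivity
  calc _ ≤ ∑ l ∈ Finset.range (L + 1), ∑ i ∈ Finset.range (2 ^ l),
        μ {ω | b l ≤ |X ((i + 1) * 2 ^ (L - l)) ω - X (i * 2 ^ (L - l)) ω|} :=
        (measure_biUnion_finset_le _ _).trans
          (Finset.sum_le_sum fun l _ => measure_biUnion_finset_le _ _)
    _ ≤ ∑ l ∈ Finset.range (L + 1), ∑ i ∈ Finset.range (2 ^ l),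
        ENNReal.ofReal (B₁ * ((2:ℝ) ^ l) ^ (-s₁) * b l ^ (-r₁) +
          B₂ * ((2:ℝ) ^ l) ^ (-s₂) * b l ^ (-r₂)) :=
        Finset.sum_le_sum fun l hl => Finset.sum_le_sum fun i hi =>
          hinc l (by simpa [Nat.lt_succ_iff] using hl) i (by simpa using hi) (b l) (hbpos l)
    _ = ENNReal.ofReal (∑ l ∈ Finset.range (L + 1), (2:ℝ) ^ l *
        (B₁ * ((2:ℝ) ^ l) ^ (-s₁) * b l ^ (-r₁) + B₂ * ((2:ℝ) ^ l) ^ (-s₂) * b l ^ (-r₂))) := by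
        rw [ENNReal.ofReal_sum_of_nonneg]
        · refine Finset.sum_congr rfl fun l _ => ?_
          rw [Finset.sum_const, Finset.card_range, nsmul_eq_mul, ENNReal.ofReal_mul (by positivity),
            ENNReal.ofReal_pow (by norm_num)]
          norm_num
        · intro l _
          have := hpos1 l
          have := hpos2 l
          positivity
    _ ≤ _ := by
        refine ENNReal.ofReal_le_ofReal ?_
        simp only [mul_add, Finset.sum_add_distrib]
        exact add_le_add (chain_sum hB₁ hr₁ hη hη1 hηr₁ hlam L)
          (chain_sum hB₂ hr₂ hη hη1 hηr₂ hlam L)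

/-- summing over dyadic blocks -/
lemma block_sum {Ω : Type*} [MeasurableSpace Ω] {μ : Measure Ω} (E : ℕ → Set Ω)
    {β₁ β₂ a₁ a₂ v₁ v₂ : ℝ} (hβ₁ : 0 ≤ β₁) (hβ₂ : 0 ≤ β₂)
    (hv₁ : 0 < v₁) (hv₁1 : v₁ ≤ 1) (hva₁ : v₁ ≤ a₁) (hv₂ : 0 < v₂) (hv₂1 : v₂ ≤ 1) (hva₂ : v₂ ≤ a₂)
    (hE : ∀ j, μ (E j) ≤ ENNReal.ofReal (β₁ * ((2:ℝ) ^ j) ^ (-a₁) + β₂ * ((2:ℝ) ^ j) ^ (-a₂))) :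
    μ (⋃ j, E j) ≤ ENNReal.ofReal (β₁ * (2 / v₁) + β₂ * (2 / v₂)) := by
  have conv : ∀ (a : ℝ) (j : ℕ), ((2:ℝ) ^ j) ^ (-a) = ((2:ℝ) ^ (-a)) ^ j := by
    intro a j
    rw [← Real.rpow_natCast, ← Real.rpow_natCast, ← Real.rpow_mul (by norm_num),
      ← Real.rpow_mul (by norm_num), mul_comm]
  have sm : ∀ (β a v : ℝ), 0 ≤ β → 0 < v → v ≤ 1 → v ≤ a →
      HasSum (fun j : ℕ => β * ((2:ℝ) ^ j) ^ (-a)) (β * (1 - (2:ℝ) ^ (-a))⁻¹) := by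
    intro β a v _ h1 _ h3
    simp_rw [conv]
    exact (hasSum_geometric_of_lt_one (by positivity)
      (Real.rpow_lt_one_of_one_lt_of_neg (by norm_num) (by linarith))).mul_left β
  have hs := (sm β₁ a₁ v₁ hβ₁ hv₁ hv₁1 hva₁).add (sm β₂ a₂ v₂ hβ₂ hv₂ hv₂1 hva₂)
  calc μ (⋃ j, E j) ≤ ∑' j, μ (E j) := measure_iUnion_le _
    _ ≤ ∑' j : ℕ, ENNReal.ofReal (β₁ * ((2:ℝ) ^ j) ^ (-a₁) + β₂ * ((2:ℝ) ^ j) ^ (-a₂)) :=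
        ENNReal.tsum_le_tsum hE
    _ = ENNReal.ofReal (∑' j : ℕ, (β₁ * ((2:ℝ) ^ j) ^ (-a₁) + β₂ * ((2:ℝ) ^ j) ^ (-a₂))) :=
        (ENNReal.ofReal_tsum_of_nonneg (fun j => by positivity) hs.summable).symm
    _ ≤ _ := by
        refine ENNReal.ofReal_le_ofReal ?_
        rw [hs.tsum_eq]
        exact add_le_add (mul_le_mul_of_nonneg_left (geom_const hv₁ hv₁1 hva₁) hβ₁)
          (mul_le_mul_of_nonneg_left (geom_const hv₂ hv₂1 hva₂) hβ₂)

/-- Markov -/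
lemma markov_rpow {Ω : Type*} [MeasurableSpace Ω] {μ : Measure Ω} (Z : Ω → ℝ)
    (hZ : AEMeasurable Z μ) {r M u : ℝ} (hr : 0 < r) (hu : 0 < u)
    (hM : ∫⁻ ω, ENNReal.ofReal (|Z ω| ^ r) ∂μ ≤ ENNReal.ofReal M) :
    μ {ω | u ≤ |Z ω|} ≤ ENNReal.ofReal (M * u ^ (-r)) := by
  have hm : AEMeasurable (fun ω => ENNReal.ofReal (|Z ω| ^ r)) μ := by fun_prop
  have h1 := mul_meas_ge_le_lintegral₀ hm (ENNReal.ofReal (u ^ r))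
  have hsub : {ω | u ≤ |Z ω|} ⊆ {ω | ENNReal.ofReal (u ^ r) ≤ ENNReal.ofReal (|Z ω| ^ r)} :=
    fun ω hω => ENNReal.ofReal_le_ofReal (Real.rpow_le_rpow hu.le hω hr.le)
  have hpos : 0 < u ^ r := Real.rpow_pos_of_pos hu r
  rw [Real.rpow_neg hu.le, ← div_eq_mul_inv, ENNReal.ofReal_div_of_pos hpos,
    ENNReal.le_div_iff_mul_le (by simp [hpos]) (by simp), mul_comm]
  exact ((mul_le_mul_right (measure_mono hsub) _).trans h1).trans hM



/-- increment tail bound -/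
lemma inc_N {Ω : Type*} [MeasurableSpace Ω] {μ : Measure Ω} (N : ℝ → Ω → ℝ) {n : ℝ}
    {C₁ C₂ s₁ r₁ r₂ : ℝ} (hC₁ : 0 < C₁) (hC₂ : 0 < C₂) (hn : 1 ≤ n)
    (hs₁ : 1 < s₁) (hr₁ : s₁ < r₁) (hr₂ : 2 < r₂)
    (hmeas : ∀ t, 0 ≤ t → AEMeasurable (N t) μ)
    (hstat : ∀ s h, 0 ≤ s → 0 ≤ h → IdentDistrib (fun ω => N (s + h) ω - N s ω) (N h) μ μ)
    (hmom1 : ∀ t : ℝ, 1 ≤ t → ∫⁻ ω, ENNReal.ofReal (|N t ω - n * t| ^ r₁) ∂μ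
        ≤ ENNReal.ofReal (C₁ * n ^ (r₁ / 2) * t ^ s₁))
    (hmom2 : ∀ t : ℝ, 0 ≤ t → t ≤ 1 → ∫⁻ ω, ENNReal.ofReal (|N t ω - n * t| ^ r₂) ∂μ
        ≤ ENNReal.ofReal (C₂ * max (n * t) ((n * t) ^ (r₂ / 2))))
    (s h u : ℝ) (hs : 0 ≤ s) (hh : 1 ≤ n * h) (hu : 0 < u) :
    μ {ω | u ≤ |N (s + h) ω - N s ω - n * h|} ≤
      ENNReal.ofReal (C₁ * n ^ (r₁ / 2) * h ^ s₁ * u ^ (-r₁) +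
        C₂ * (n * h) ^ (r₂ / 2) * u ^ (-r₂)) := by
  have hh0 : 0 < h := by
    by_contra hc
    nlinarith
  have e : μ {ω | u ≤ |N (s + h) ω - N s ω - n * h|} = μ {ω | u ≤ |N h ω - n * h|} := by
    have hms : MeasurableSet {y : ℝ | u ≤ |y - n * h|} :=
      measurableSet_le measurable_const (by fun_prop)
    exact (hstat s h hs hh0.le).measure_mem_eq hms
  rw [e]
  have hm : AEMeasurable (fun ω => N h ω - n * h) μ := (hmeas h hh0.le).sub_const _
  have hp1 : 0 ≤ C₁ * n ^ (r₁ / 2) * h ^ s₁ * u ^ (-r₁) := by positivity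
  have hp2 : 0 ≤ C₂ * (n * h) ^ (r₂ / 2) * u ^ (-r₂) := by positivity
  rcases le_total 1 h with h1 | h1
  · refine (markov_rpow _ hm (by linarith) hu (hmom1 h h1)).trans ?_
    exact ENNReal.ofReal_le_ofReal (by linarith)
  · have := hmom2 h hh0.le h1
    rw [max_eq_right] at this
    · refine (markov_rpow _ hm (by linarith) hu this).trans ?_
      exact ENNReal.ofReal_le_ofReal (by linarith)
    · exact Real.self_le_rpow_of_one_le hh (by linarith)

lemma block_N {Ω : Type*} [MeasurableSpace Ω] {μ : Measure Ω} (N : ℝ → Ω → ℝ) {n : ℝ}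
    {C₁ C₂ s₁ r₁ r₂ : ℝ} (hC₁ : 0 < C₁) (hC₂ : 0 < C₂) (hn : 1 ≤ n)
    (hs₁ : 1 < s₁) (hr₁ : s₁ < r₁) (hr₂ : 2 < r₂)
    (hmeas : ∀ t, 0 ≤ t → AEMeasurable (N t) μ)
    (hmono : ∀ᵐ ω ∂μ, ∀ s t, 0 ≤ s → s ≤ t → N s ω ≤ N t ω)
    (hN0 : ∀ᵐ ω ∂μ, N 0 ω = 0)
    (hstat : ∀ s h, 0 ≤ s → 0 ≤ h → IdentDistrib (fun ω => N (s + h) ω - N s ω) (N h) μ μ)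
    (hmom1 : ∀ t : ℝ, 1 ≤ t → ∫⁻ ω, ENNReal.ofReal (|N t ω - n * t| ^ r₁) ∂μ
        ≤ ENNReal.ofReal (C₁ * n ^ (r₁ / 2) * t ^ s₁))
    (hmom2 : ∀ t : ℝ, 0 ≤ t → t ≤ 1 → ∫⁻ ω, ENNReal.ofReal (|N t ω - n * t| ^ r₂) ∂μ
        ≤ ENNReal.ofReal (C₂ * max (n * t) ((n * t) ^ (r₂ / 2))))
    {η : ℝ} (hη : 0 < η) (hη1 : η ≤ 1)
    (hηr₁ : η * r₁ ≤ (s₁ - 1) / 2) (hηr₂ : η * r₂ ≤ (r₂ / 2 - 1) / 2)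
    (T lam : ℝ) (hT : 1 ≤ n * T) (hlam : 4 ≤ lam) :
    μ {ω | ∃ t, 0 ≤ t ∧ t ≤ T ∧ lam ≤ n * t - N t ω} ≤
      ENNReal.ofReal ((2 / η) ^ (r₁ + 1) * (C₁ * n ^ (r₁ / 2) * T ^ s₁) * (lam / 2) ^ (-r₁) +
        (2 / η) ^ (r₂ + 1) * (C₂ * (n * T) ^ (r₂ / 2)) * (lam / 2) ^ (-r₂)) := by
  have hn0 : 0 < n := by linarith
  have hT0 : 0 < T := by
    by_contra hc
    nlinarith
  obtain ⟨L, hL1, hL2⟩ := exists_nat_pow_near hT (one_lt_two (α := ℝ))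
  have h2L : (0:ℝ) < 2 ^ L := by positivity
  set h : ℝ := T / 2 ^ L with hh
  have hh0 : 0 < h := by positivity
  have hnh : n * h < 2 := by
    rw [hh, mul_div_assoc', div_lt_iff₀ h2L]
    rw [pow_succ] at hL2; linarith
  let X : ℕ → Ω → ℝ := fun k ω => N (k * h) ω - n * (k * h)
  have key := chain_prob (μ := μ) X L (B₁ := C₁ * n ^ (r₁ / 2) * T ^ s₁) (s₁ := s₁) (r₁ := r₁)
    (B₂ := C₂ * (n * T) ^ (r₂ / 2)) (s₂ := r₂ / 2) (r₂ := r₂) (η := η) (lam := lam / 2)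
    (by filter_upwards [hN0] with ω hω; simp [X, hω])
    (by positivity) (by linarith) (by positivity) (by linarith) hη hη1 hηr₁ hηr₂ (by linarith)
    (by
      intro l hl i hi u hu
      have h2l : (0:ℝ) < 2 ^ l := by positivity
      have elen : ((2 ^ (L - l) : ℕ) : ℝ) * h = T / 2 ^ l := by
        rw [hh, Nat.cast_pow, Nat.cast_ofNat]
        have : (2:ℝ) ^ L = 2 ^ (L - l) * 2 ^ l := by rw [← pow_add]; congr 1; omega
        rw [this]; field_simp
      have hlen : 1 ≤ n * (T / 2 ^ l) := by
        rw [mul_div_assoc', le_div_iff₀ h2l, one_mul]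
        exact (pow_le_pow_right₀ (by norm_num) hl).trans hL1
      have := inc_N N hC₁ hC₂ hn hs₁ hr₁ hr₂ hmeas hstat hmom1 hmom2
        (i * (T / 2 ^ l)) (T / 2 ^ l) u (by positivity) hlen hu
      have eX : ∀ ω, X ((i + 1) * 2 ^ (L - l)) ω - X (i * 2 ^ (L - l)) ω =
          N (i * (T / 2 ^ l) + T / 2 ^ l) ω - N (i * (T / 2 ^ l)) ω - n * (T / 2 ^ l) := by
        intro ω
        have e1 : (((i + 1) * 2 ^ (L - l) : ℕ) : ℝ) * h = i * (T / 2 ^ l) + T / 2 ^ l := by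
          rw [Nat.cast_mul, mul_assoc, elen]; push_cast; ring
        have e2 : ((i * 2 ^ (L - l) : ℕ) : ℝ) * h = i * (T / 2 ^ l) := by
          rw [Nat.cast_mul, mul_assoc, elen]
        simp only [X]
        rw [e1, e2]; ring
      simp only [eX]
      refine this.trans (ENNReal.ofReal_le_ofReal (le_of_eq ?_))
      rw [← mul_div_assoc, Real.div_rpow hT0.le h2l.le, Real.div_rpow (by positivity) h2l.le,
        Real.rpow_neg h2l.le, Real.rpow_neg h2l.le]
      ring)
  refine (measure_mono_ae ?_).trans key
  filter_upwards [hmono] with ω hω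
  rintro ⟨t, ht0, htT, hlt⟩
  have hth : 0 ≤ t / h := by positivity
  refine ⟨⌊t / h⌋₊, ?_, ?_⟩
  · have : t / h ≤ ((2 ^ L : ℕ) : ℝ) := by
      rw [div_le_iff₀ hh0, hh]; push_cast
      rw [mul_div_cancel₀ _ h2L.ne']; exact htT
    exact Nat.floor_le_of_le this
  · have f1 : (⌊t / h⌋₊ : ℝ) * h ≤ t := by
      rw [← le_div_iff₀ hh0]; exact Nat.floor_le hth
    have f2 : t ≤ (⌊t / h⌋₊ : ℝ) * h + h := by
      have := (Nat.lt_floor_add_one (t / h)).le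
      rw [div_le_iff₀ hh0] at this; linarith
    have := hω _ t (by positivity) f1
    have f3 : n * t ≤ n * ((⌊t / h⌋₊ : ℝ) * h) + 2 := by nlinarith
    have f4 : lam / 2 ≤ -(X ⌊t / h⌋₊ ω) := by
      simp only [X]; linarith
    exact f4.trans (neg_le_abs _)

/-- all of time -/
lemma full_N {Ω : Type*} [MeasurableSpace Ω] {μ : Measure Ω} (N : ℝ → Ω → ℝ) {n : ℝ}
    {C₁ C₂ s₁ r₁ r₂ : ℝ} (hC₁ : 0 < C₁) (hC₂ : 0 < C₂) (hn : 1 ≤ n)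
    (hs₁ : 1 < s₁) (hr₁ : s₁ < r₁) (hr₂ : 2 < r₂)
    (hmeas : ∀ t, 0 ≤ t → AEMeasurable (N t) μ)
    (hmono : ∀ᵐ ω ∂μ, ∀ s t, 0 ≤ s → s ≤ t → N s ω ≤ N t ω)
    (hN0 : ∀ᵐ ω ∂μ, N 0 ω = 0)
    (hstat : ∀ s h, 0 ≤ s → 0 ≤ h → IdentDistrib (fun ω => N (s + h) ω - N s ω) (N h) μ μ)
    (hmom1 : ∀ t : ℝ, 1 ≤ t → ∫⁻ ω, ENNReal.ofReal (|N t ω - n * t| ^ r₁) ∂μ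
        ≤ ENNReal.ofReal (C₁ * n ^ (r₁ / 2) * t ^ s₁))
    (hmom2 : ∀ t : ℝ, 0 ≤ t → t ≤ 1 → ∫⁻ ω, ENNReal.ofReal (|N t ω - n * t| ^ r₂) ∂μ
        ≤ ENNReal.ofReal (C₂ * max (n * t) ((n * t) ^ (r₂ / 2))))
    {η : ℝ} (hη : 0 < η) (hη1 : η ≤ 1)
    (hηr₁ : η * r₁ ≤ (s₁ - 1) / 2) (hηr₂ : η * r₂ ≤ (r₂ / 2 - 1) / 2)
    {v₁ : ℝ} (hv₁ : 0 < v₁) (hv₁1 : v₁ ≤ 1) (hva₁ : v₁ ≤ r₁ - s₁)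
    {δ x : ℝ} (hδ : 0 < δ) (hδn : δ ≤ n) (hx : 16 ≤ x) :
    μ {ω | ∃ t, 0 ≤ t ∧ 3 * x / 8 + δ * t ≤ n * t - N t ω} ≤
      ENNReal.ofReal (
        (2 / η) ^ (r₁ + 1) * C₁ * n ^ (r₁ / 2) * δ ^ (-s₁) * x ^ (-(r₁ - s₁)) * 8 ^ r₁ * (2 / v₁) +
        (2 / η) ^ (r₂ + 1) * C₂ * n ^ (r₂ / 2) * δ ^ (-(r₂ / 2)) * x ^ (-(r₂ / 2)) * 8 ^ r₂ * 2) := by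
  have hx0 : 0 < x := by linarith
  have hn0 : 0 < n := by linarith
  have hsub : {ω | ∃ t, 0 ≤ t ∧ 3 * x / 8 + δ * t ≤ n * t - N t ω} ⊆
      ⋃ j : ℕ, {ω | ∃ t, 0 ≤ t ∧ t ≤ 2 ^ j * x / δ ∧ 2 ^ j * x / 4 ≤ n * t - N t ω} := by
    rintro ω ⟨t, ht0, ht⟩
    rw [Set.mem_iUnion]
    rcases le_total (δ * t) x with h | h
    · refine ⟨0, t, ht0, ?_, ?_⟩
      · rw [le_div_iff₀ hδ]; linarith
      · have : 0 ≤ δ * t := by positivity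
        norm_num; linarith
    · have h1 : 1 ≤ δ * t / x := by rwa [le_div_iff₀ hx0, one_mul]
      obtain ⟨j, hj1, hj2⟩ := exists_nat_pow_near h1 (one_lt_two (α := ℝ))
      rw [le_div_iff₀ hx0] at hj1
      rw [div_lt_iff₀ hx0] at hj2
      refine ⟨j + 1, t, ht0, ?_, ?_⟩
      · rw [le_div_iff₀ hδ]; linarith
      · rw [pow_succ]
        have : 0 < (2:ℝ) ^ j * x := by positivity
        linarith
  refine (measure_mono hsub).trans ?_
  refine (block_sum (a₁ := r₁ - s₁) (a₂ := r₂ / 2) (v₂ := 1)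
    (β₁ := (2 / η) ^ (r₁ + 1) * C₁ * n ^ (r₁ / 2) * δ ^ (-s₁) * x ^ (-(r₁ - s₁)) * 8 ^ r₁)
    (β₂ := (2 / η) ^ (r₂ + 1) * C₂ * n ^ (r₂ / 2) * δ ^ (-(r₂ / 2)) * x ^ (-(r₂ / 2)) * 8 ^ r₂)
    _ (by positivity) (by positivity) hv₁ hv₁1 hva₁ (by norm_num) le_rfl (by linarith) ?_).trans ?_
  · intro j
    have h2j : (0:ℝ) < 2 ^ j := by positivity
    have h2j1 : (1:ℝ) ≤ 2 ^ j := one_le_pow₀ (by norm_num)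
    refine (block_N N hC₁ hC₂ hn hs₁ hr₁ hr₂ hmeas hmono hN0 hstat hmom1 hmom2 hη hη1 hηr₁ hηr₂
      (2 ^ j * x / δ) (2 ^ j * x / 4) ?_ ?_).trans (ENNReal.ofReal_le_ofReal (le_of_eq ?_))
    · rw [mul_div_assoc', le_div_iff₀ hδ]
      have : 1 ≤ (2:ℝ) ^ j * x := by nlinarith
      nlinarith
    · nlinarith
    · have e0 : (2:ℝ) ^ j * x / 4 / 2 = 2 ^ j * x * 8⁻¹ := by ring
      have e1 : ∀ r : ℝ, ((2:ℝ) ^ j * x / 4 / 2) ^ (-r) = (2 ^ j) ^ (-r) * x ^ (-r) * 8 ^ r := by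
        intro r
        rw [e0, Real.mul_rpow (by positivity) (by norm_num), Real.mul_rpow (by positivity) hx0.le,
          Real.inv_rpow (by norm_num), Real.rpow_neg (show (0:ℝ) ≤ 8 by norm_num) r, inv_inv]
      have e2 : ∀ s : ℝ, ((2:ℝ) ^ j * x / δ) ^ s = (2 ^ j) ^ s * x ^ s * δ ^ (-s) := by
        intro s
        rw [Real.div_rpow (by positivity) hδ.le, Real.mul_rpow (by positivity) hx0.le,
          Real.rpow_neg hδ.le]; rfl
      have e3 : ∀ {y : ℝ}, 0 < y → ∀ r s : ℝ, y ^ (-(r - s)) = y ^ s * y ^ (-r) := by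
        intro y hy r s
        rw [← Real.rpow_add hy]; congr 1; ring
      have e4 : ∀ {y : ℝ}, 0 < y → y ^ (-(r₂ / 2)) = y ^ (r₂ / 2) * y ^ (-r₂) := by
        intro y hy
        rw [← Real.rpow_add hy]; congr 1; ring
      rw [Real.mul_rpow hn0.le (by positivity), e1, e1, e2, e2, e3 hx0, e3 h2j, e4 hx0, e4 h2j]
      ring
  · refine ENNReal.ofReal_le_ofReal (le_of_eq ?_)
    norm_num


/-- shift-stationarity of i.i.d. partial sums -/
lemma iid_stat {Ω : Type*} [MeasurableSpace Ω] {μ : Measure Ω} [IsProbabilityMeasure μ]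
    (Y : ℕ → Ω → ℝ) (hm : ∀ j, Measurable (Y j)) (hind : iIndepFun Y μ)
    (hlaw : ∀ j, μ.map (Y j) = μ.map (Y 0)) (i l : ℕ) :
    IdentDistrib (fun ω => ∑ j ∈ Finset.range l, Y (i + j) ω)
      (fun ω => ∑ j ∈ Finset.range l, Y j ω) μ μ := by
  have h1 : iIndepFun (fun j : ℕ => Y (i + j)) μ :=
    hind.precomp (g := fun j => i + j) (add_right_injective i)
  have h2 := IdentDistrib.pi (X := fun j => Y (i + j)) (Y := Y) (μ := μ) (ν := μ)
    (fun j => ⟨(hm _).aemeasurable, (hm _).aemeasurable, by rw [hlaw, hlaw j]⟩) h1 hind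
  exact h2.comp (u := fun y : ℕ → ℝ => ∑ j ∈ Finset.range l, y j) (by fun_prop)

lemma block_A {Ω : Type*} [MeasurableSpace Ω] {μ : Measure Ω} [IsProbabilityMeasure μ]
    (Y : ℕ → Ω → ℝ) (hm : ∀ j, Measurable (Y j)) (hind : iIndepFun Y μ)
    (hlaw : ∀ j, μ.map (Y j) = μ.map (Y 0)) {a C₃ s₃ r₃ : ℝ} (hC₃ : 0 < C₃)
    (hs₃ : 1 < s₃) (hr₃ : s₃ < r₃)
    (hmom3 : ∀ k : ℕ, 1 ≤ k →
      ∫⁻ ω, ENNReal.ofReal (|(k : ℝ) - a * ∑ i ∈ Finset.range k, Y i ω| ^ r₃) ∂μ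
        ≤ ENNReal.ofReal (C₃ * (k : ℝ) ^ s₃))
    {η : ℝ} (hη : 0 < η) (hη1 : η ≤ 1) (hηr₃ : η * r₃ ≤ (s₃ - 1) / 2) (L : ℕ) (lam : ℝ)
    (hlam : 0 < lam) :
    μ {ω | ∃ k : ℕ, k ≤ 2 ^ L ∧ lam ≤ |(k : ℝ) - a * ∑ i ∈ Finset.range k, Y i ω|} ≤
      ENNReal.ofReal ((2 / η) ^ (r₃ + 1) * (C₃ * ((2:ℝ) ^ L) ^ s₃) * lam ^ (-r₃)) := by
  have key := chain_prob (μ := μ) (fun (k : ℕ) ω => (k : ℝ) - a * ∑ i ∈ Finset.range k, Y i ω) L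
    (B₁ := C₃ * ((2:ℝ) ^ L) ^ s₃) (s₁ := s₃) (r₁ := r₃)
    (B₂ := 0) (s₂ := s₃) (r₂ := r₃) (η := η) (lam := lam)
    (Filter.Eventually.of_forall fun ω => by simp)
    (by positivity) (by linarith) le_rfl (by linarith) hη hη1 hηr₃ hηr₃ hlam
    (by
      intro l hl i hi u hu
      set q : ℕ := 2 ^ (L - l) with hq
      have hq1 : 1 ≤ q := Nat.one_le_two_pow
      have e1 : ∀ ω, (((i + 1) * q : ℕ) : ℝ) - a * ∑ j ∈ Finset.range ((i + 1) * q), Y j ω -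
          (((i * q : ℕ) : ℝ) - a * ∑ j ∈ Finset.range (i * q), Y j ω) =
          (q : ℝ) - a * ∑ j ∈ Finset.range q, Y (i * q + j) ω := by
        intro ω
        rw [add_mul, one_mul, Finset.sum_range_add]
        push_cast; ring
      simp only [e1]
      have hms : MeasurableSet {y : ℝ | u ≤ |(q : ℝ) - a * y|} :=
        measurableSet_le measurable_const (by fun_prop)
      have e2 : μ {ω | u ≤ |(q : ℝ) - a * ∑ j ∈ Finset.range q, Y (i * q + j) ω|} =
          μ {ω | u ≤ |(q : ℝ) - a * ∑ j ∈ Finset.range q, Y j ω|} :=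
        (iid_stat Y hm hind hlaw (i * q) q).measure_mem_eq hms
      rw [e2]
      refine (markov_rpow _ (by fun_prop) (by linarith) hu (hmom3 q hq1)).trans
        (ENNReal.ofReal_le_ofReal (le_of_eq ?_))
      have h2l : (0:ℝ) < 2 ^ l := by positivity
      have e3 : (q : ℝ) = 2 ^ L / 2 ^ l := by
        rw [eq_div_iff h2l.ne', hq]; push_cast
        rw [← pow_add]; congr 1; omega
      rw [e3, Real.div_rpow (by positivity) h2l.le, Real.rpow_neg h2l.le]
      ring)
  simpa using key

lemma full_A {Ω : Type*} [MeasurableSpace Ω] {μ : Measure Ω} [IsProbabilityMeasure μ]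
    (Y : ℕ → Ω → ℝ) (hm : ∀ j, Measurable (Y j)) (hind : iIndepFun Y μ)
    (hlaw : ∀ j, μ.map (Y j) = μ.map (Y 0)) (hnn : ∀ j, ∀ᵐ ω ∂μ, 0 ≤ Y j ω)
    {a C₃ s₃ r₃ : ℝ} (hC₃ : 0 < C₃)
    (hs₃ : 1 < s₃) (hr₃ : s₃ < r₃)
    (hmom3 : ∀ k : ℕ, 1 ≤ k →
      ∫⁻ ω, ENNReal.ofReal (|(k : ℝ) - a * ∑ i ∈ Finset.range k, Y i ω| ^ r₃) ∂μ
        ≤ ENNReal.ofReal (C₃ * (k : ℝ) ^ s₃))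
    {η : ℝ} (hη : 0 < η) (hη1 : η ≤ 1) (hηr₃ : η * r₃ ≤ (s₃ - 1) / 2)
    {v₁ : ℝ} (hv₁ : 0 < v₁) (hv₁1 : v₁ ≤ 1) (hva₁ : v₁ ≤ r₃ - s₃)
    {m c δ x : ℝ} (hm0 : 0 < m) (ham : a ≤ m) (hδ : 0 < δ) (hc : c = m + δ) (hδm : δ ≤ m)
    (hx : 16 ≤ x) :
    μ {ω | ∃ k : ℕ, 3 * x / 8 ≤ k - c * ∑ i ∈ Finset.range k, Y i ω} ≤
      ENNReal.ofReal ((2 / η) ^ (r₃ + 1) * C₃ * 2 ^ s₃ * δ ^ (-s₃) * m ^ (-(r₃ - s₃)) *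
        x ^ (-(r₃ - s₃)) * 4 ^ r₃ * c ^ r₃ * (2 / v₁)) := by
  have hx0 : 0 < x := by linarith
  have hc0 : 0 < c := by linarith
  have hk0 : 1 ≤ m * x / δ := by rw [le_div_iff₀ hδ]; nlinarith
  obtain ⟨L, hL1, hL2⟩ := exists_nat_pow_near hk0 (one_lt_two (α := ℝ))
  have hnn' : ∀ᵐ ω ∂μ, ∀ j, 0 ≤ Y j ω := ae_all_iff.2 hnn
  have hsub : {ω | ∃ k : ℕ, 3 * x / 8 ≤ k - c * ∑ i ∈ Finset.range k, Y i ω} ≤ᵐ[μ]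
      ⋃ j : ℕ, {ω | ∃ k : ℕ, k ≤ 2 ^ (L + 1 + j) ∧ 2 ^ j * (m * x) * (4 * c)⁻¹ ≤
        |(k : ℝ) - a * ∑ i ∈ Finset.range k, Y i ω|} := by
    filter_upwards [hnn'] with ω hω
    rintro ⟨k, hk⟩
    have hSg0 : 0 ≤ ∑ i ∈ Finset.range k, Y i ω := Finset.sum_nonneg fun i _ => hω i
    set Sg := ∑ i ∈ Finset.range k, Y i ω with hSg
    have hD : m * (3 * x / 8) + δ * k ≤ c * (k - a * Sg) := by
      have : c * (m * Sg) ≥ c * (a * Sg) := by gcongr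
      have h2 := mul_le_mul_of_nonneg_left hk hm0.le
      rw [hc] at h2 this ⊢
      nlinarith
    have red : ∀ j : ℕ, 2 ^ j * (m * x) ≤ 4 * (c * (k - a * Sg)) →
        2 ^ j * (m * x) * (4 * c)⁻¹ ≤ |(k : ℝ) - a * Sg| := by
      intro j hj
      refine le_trans ?_ (le_abs_self _)
      rw [← div_eq_mul_inv, div_le_iff₀ (by positivity)]
      linarith
    refine Set.mem_iUnion.2 ?_
    have hmx : 0 < m * x := by positivity
    have hδk : 0 ≤ δ * (k : ℝ) := by positivity
    rcases le_total k (2 ^ (L + 1)) with h | h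
    · refine ⟨0, k, by simpa using h, red 0 ?_⟩
      rw [pow_zero]; linarith
    · have h' : ((2:ℝ)) ^ (L + 1) ≤ k := by exact_mod_cast h
      have h1 : 1 ≤ (k : ℝ) / 2 ^ (L + 1) := by rwa [le_div_iff₀ (by positivity), one_mul]
      obtain ⟨j, hj1, hj2⟩ := exists_nat_pow_near h1 (one_lt_two (α := ℝ))
      rw [le_div_iff₀ (by positivity)] at hj1
      rw [div_lt_iff₀ (by positivity)] at hj2
      refine ⟨j + 1, k, ?_, red (j + 1) ?_⟩
      · have : (k : ℝ) ≤ ((2 ^ (L + 1 + (j + 1)) : ℕ) : ℝ) := by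
          push_cast
          rw [pow_add]; linarith
        exact_mod_cast this
      · rw [div_lt_iff₀ hδ] at hL2
        have h3 : (2:ℝ) ^ j * (m * x) ≤ 2 ^ j * (2 ^ (L + 1) * δ) := by gcongr
        have h4 : 2 ^ j * 2 ^ (L + 1) * δ ≤ k * δ := by gcongr
        rw [pow_succ]
        linarith
  refine (measure_mono_ae hsub).trans ?_
  refine (block_sum (a₁ := r₃ - s₃) (a₂ := 1) (v₂ := 1)
    (β₁ := (2 / η) ^ (r₃ + 1) * C₃ * 2 ^ s₃ * δ ^ (-s₃) * m ^ (-(r₃ - s₃)) *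
        x ^ (-(r₃ - s₃)) * 4 ^ r₃ * c ^ r₃)
    (β₂ := 0)
    _ (by positivity) le_rfl hv₁ hv₁1 hva₁ (by norm_num) le_rfl le_rfl ?_).trans
      (ENNReal.ofReal_le_ofReal (le_of_eq (by ring)))
  intro j
  have h2j : (0:ℝ) < 2 ^ j := by positivity
  refine (block_A Y hm hind hlaw hC₃ hs₃ hr₃ hmom3 hη hη1 hηr₃ (L + 1 + j)
    (2 ^ j * (m * x) * (4 * c)⁻¹) (by positivity)).trans (ENNReal.ofReal_le_ofReal ?_)
  have b1 : ((2:ℝ) ^ (L + 1 + j)) ^ s₃ ≤ (2 * (m * x / δ) * 2 ^ j) ^ s₃ := by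
    refine Real.rpow_le_rpow (by positivity) ?_ (by linarith)
    rw [pow_add, pow_succ, mul_comm ((2:ℝ) ^ L) 2]
    gcongr
  have e2 : (2 * (m * x / δ) * 2 ^ j) ^ s₃ =
      2 ^ s₃ * (m ^ s₃ * x ^ s₃ * δ ^ (-s₃)) * (2 ^ j) ^ s₃ := by
    rw [Real.mul_rpow (by positivity) (by positivity), Real.mul_rpow (by positivity) (by positivity),
      Real.div_rpow (by positivity) hδ.le, Real.mul_rpow hm0.le hx0.le, Real.rpow_neg hδ.le]
    rfl
  have e1 : (2 ^ j * (m * x) * (4 * c)⁻¹) ^ (-r₃) =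
      (2 ^ j) ^ (-r₃) * (m ^ (-r₃) * x ^ (-r₃)) * (4 ^ r₃ * c ^ r₃) := by
    rw [Real.mul_rpow (by positivity) (by positivity), Real.mul_rpow (by positivity) (by positivity),
      Real.mul_rpow hm0.le hx0.le, Real.inv_rpow (by positivity),
      Real.rpow_neg (show 0 ≤ 4 * c by positivity), inv_inv,
      Real.mul_rpow (by norm_num) hc0.le]
  have e3 : ∀ {y : ℝ}, 0 < y → ∀ r s : ℝ, y ^ (-(r - s)) = y ^ s * y ^ (-r) := by
    intro y hy r s
    rw [← Real.rpow_add hy]; congr 1; ring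
  calc _ ≤ (2 / η) ^ (r₃ + 1) * (C₃ * (2 * (m * x / δ) * 2 ^ j) ^ s₃) *
        (2 ^ j * (m * x) * (4 * c)⁻¹) ^ (-r₃) := by gcongr
    _ = _ := by
      rw [e1, e2, e3 hx0, e3 h2j, e3 hm0]
      ring


lemma const_bd {κ w K r s R : ℝ} (hκ : 0 < κ) (hw : 1 ≤ w) (hK : κ * 32 * w ≤ K) (hK1 : 1 ≤ K)
    (hs : s ≤ r) (hr0 : 0 ≤ r) (hrR : r ≤ R) :
    κ ^ (r + 1) * 8 ^ r * 2 ^ s * (2 * w) ≤ K ^ (R + 1) := by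
  have h8 : (8:ℝ) ^ r ≤ 8 ^ (r + 1) := Real.rpow_le_rpow_of_exponent_le (by norm_num) (by linarith)
  have h2 : (2:ℝ) ^ s ≤ 2 ^ (r + 1) := Real.rpow_le_rpow_of_exponent_le (by norm_num) (by linarith)
  have h3 : 2 * w ≤ (2 * w) ^ (r + 1) := Real.self_le_rpow_of_one_le (by linarith) (by linarith)
  calc κ ^ (r + 1) * 8 ^ r * 2 ^ s * (2 * w)
      ≤ κ ^ (r + 1) * 8 ^ (r + 1) * 2 ^ (r + 1) * (2 * w) ^ (r + 1) := by gcongr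
    _ = (κ * 32 * w) ^ (r + 1) := by
      rw [← Real.mul_rpow (by positivity) (by positivity),
        ← Real.mul_rpow (by positivity) (by positivity),
        ← Real.mul_rpow (by positivity) (by positivity)]
      congr 1; ring
    _ ≤ K ^ (r + 1) := Real.rpow_le_rpow (by positivity) hK (by linarith)
    _ ≤ K ^ (R + 1) := Real.rpow_le_rpow_of_exponent_le hK1 (by linarith)

/-- deterministic decomposition -/
lemma decomp {x n c δ t : ℝ} (hx : 16 ≤ x) (hc0 : 0 ≤ c) (hδ : c + δ = n) (ht : 0 ≤ t) (ξ : ℕ → ℝ)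
    (h0 : 0 ≤ ξ 0) (N : ℝ) (hN : 0 ≤ N) (h : x - 1 < (renewalCount ξ t : ℝ) - N) :
    (∃ k : ℕ, 3 * x / 8 ≤ k - c * ∑ i ∈ Finset.range k, ξ (i + 1)) ∨
      3 * x / 8 + δ * t ≤ n * t - N := by
  have hne : {n : ℕ | ∑ i ∈ Finset.range n, ξ i ≤ t}.Nonempty := ⟨0, by simpa using ht⟩
  have hpos : renewalCount ξ t ≠ 0 := by
    intro h00
    rw [h00] at h
    norm_num at h
    linarith
  have hb : BddAbove {n : ℕ | ∑ i ∈ Finset.range n, ξ i ≤ t} := by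
    by_contra hcon
    exact hpos (Nat.sSup_of_not_bddAbove hcon)
  have hmem : ∑ i ∈ Finset.range (renewalCount ξ t), ξ i ≤ t := Nat.sSup_mem hne hb
  obtain ⟨k, hk⟩ := Nat.exists_eq_succ_of_ne_zero hpos
  rw [hk, Nat.succ_eq_add_one, Finset.sum_range_succ'] at hmem
  rw [hk] at h
  push_cast at h
  by_contra hcon
  push Not at hcon
  obtain ⟨h1, h2⟩ := hcon
  have h3 := h1 k
  have h4 : c * ∑ i ∈ Finset.range k, ξ (i + 1) ≤ c * t :=
    mul_le_mul_of_nonneg_left (by linarith) hc0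
  rw [← hδ] at h2
  nlinarith

lemma one_add_bd {a b d : ℝ} (ha : 0 < a) (hb : 0 < b) (hd : 0 < d) :
    a ≤ (1 + a) * (1 + b) * (1 + d) := by
  calc a ≤ (1 + a) * 1 * 1 := by linarith
    _ ≤ (1 + a) * (1 + b) * (1 + d) := by gcongr <;> linarith

set_option maxHeartbeats 1000000


/-- Master conditional tail bound for `sup_{t ≥ 0} (A(t) - ∑_{i=1}^{n'} N_i(t))`, where
`A(·)` is the counting process of an equilibrium renewal process with renewal distribution
`Arv` (rate `μ_A`), the `N_i` are counting processes of i.i.d. equilibrium renewal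
processes with renewal distribution `S`, `E[S] = 1`, all jointly independent, and
`μ_{A,n'} = max(n'/2, μ_A)`.  Here `ξ 0` gives the interval sequence of the arrival
process and `ξ (i+1)` the interval sequence of the `i`-th service renewal process;
`A_i = ξ 0 (i+1)` are the i.i.d. inter-arrival times. -/
theorem master_conditional_bound
    {Ω : Type*} [MeasurableSpace Ω] (μ : Measure Ω) [IsProbabilityMeasure μ]
    (S Arv : Ω → ℝ) (hSmeas : Measurable S) (hArvmeas : Measurable Arv)
    (hSnn : ∀ᵐ ω ∂μ, 0 ≤ S ω) (hArvnn : ∀ᵐ ω ∂μ, 0 ≤ Arv ω)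
    (hES : ∫ ω, S ω ∂μ = 1)
    (hArvint : Integrable Arv μ) (hEArv : 0 < ∫ ω, Arv ω ∂μ)
    (μA : ℝ) (hμA : μA = (∫ ω, Arv ω ∂μ)⁻¹)
    (ξ : ℕ → ℕ → Ω → ℝ)
    (hξmeas : ∀ i j, Measurable (ξ i j))
    (hξnn : ∀ i j, ∀ᵐ ω ∂μ, 0 ≤ ξ i j ω)
    (hindep : iIndepFun (fun p : ℕ × ℕ => ξ p.1 p.2) μ)
    (hlawA : ∀ j, μ.map (ξ 0 (j + 1)) = μ.map Arv)
    (hlawS : ∀ i j, μ.map (ξ (i + 1) (j + 1)) = μ.map S)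
    (heqA : ∀ y : ℝ, 0 ≤ y →
      (μ {ω | y < ξ 0 0 ω}).toReal = μA * ∫ z in Set.Ioi y, (μ {ω | z < Arv ω}).toReal)
    (heqS : ∀ i, ∀ y : ℝ, 0 ≤ y →
      (μ {ω | y < ξ (i + 1) 0 ω}).toReal = ∫ z in Set.Ioi y, (μ {ω | z < S ω}).toReal)
    (n' : ℕ) (hn' : 1 ≤ n') (hμAn' : μA < (n' : ℝ))
    (μAn : ℝ) (hμAn : μAn = max ((n' : ℝ) / 2) μA)
    (C₁ C₂ C₃ s₁ r₁ r₂ s₃ r₃ : ℝ)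
    (hC₁ : 0 < C₁) (hC₂ : 0 < C₂) (hC₃ : 0 < C₃)
    (hs₁ : 1 < s₁) (hr₁ : s₁ < r₁) (hr₂ : 2 < r₂) (hs₃ : 1 < s₃) (hr₃ : s₃ < r₃)
    (hmom1 : ∀ t : ℝ, 1 ≤ t →
      ∫⁻ ω, ENNReal.ofReal
          (|(∑ i ∈ Finset.range n', (renewalCount (fun j => ξ (i + 1) j ω) t : ℝ)) - (n' : ℝ) * t| ^ r₁) ∂μ
        ≤ ENNReal.ofReal (C₁ * (n' : ℝ) ^ (r₁ / 2) * t ^ s₁))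
    (hmom2 : ∀ t : ℝ, 0 ≤ t → t ≤ 1 →
      ∫⁻ ω, ENNReal.ofReal
          (|(∑ i ∈ Finset.range n', (renewalCount (fun j => ξ (i + 1) j ω) t : ℝ)) - (n' : ℝ) * t| ^ r₂) ∂μ
        ≤ ENNReal.ofReal (C₂ * max ((n' : ℝ) * t) (((n' : ℝ) * t) ^ (r₂ / 2))))
    (hmom3 : ∀ k : ℕ, 1 ≤ k →
      ∫⁻ ω, ENNReal.ofReal (|(k : ℝ) - μA * ∑ i ∈ Finset.range k, ξ 0 (i + 1) ω| ^ r₃) ∂μ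
        ≤ ENNReal.ofReal (C₃ * (k : ℝ) ^ s₃)) :
    ∀ x : ℝ, 16 ≤ x →
      (μ {ω | (x : EReal) ≤ ⨆ t : ℝ≥0,
          (((renewalCount (fun j => ξ 0 j ω) (t : ℝ) : ℝ)
            - ∑ i ∈ Finset.range n', (renewalCount (fun j => ξ (i + 1) j ω) (t : ℝ) : ℝ) : ℝ) : EReal)}).toReal
        ≤ (10 ^ 6 * (r₁ + r₂ + r₃) ^ 5
              / ((s₁ - 1) * (s₃ - 1) * (r₁ - s₁) * (r₃ - s₃) * (r₂ - 2))) ^ (r₁ + r₂ + r₃ + 1)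
            * (1 + C₁) * (1 + C₂) * (1 + C₃)
            * ((n' : ℝ) ^ (r₁ / 2) * ((n' : ℝ) - μAn) ^ (-s₁) * x ^ (-(r₁ - s₁))
              + (n' : ℝ) ^ (r₂ / 2) * ((n' : ℝ) - μAn) ^ (-(r₂ / 2)) * x ^ (-(r₂ / 2))
              + ((n' : ℝ) - μAn) ^ (-s₃) * (n' : ℝ) ^ r₃ * μAn ^ (-(r₃ - s₃)) * x ^ (-(r₃ - s₃))) := by
  intro x hx
  have hx0 : 0 < x := by linarith
  have hn1 : (1:ℝ) ≤ n' := by exact_mod_cast hn'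
  have hm1 : (n' : ℝ) / 2 ≤ μAn := by rw [hμAn]; exact le_max_left _ _
  have hm2 : μA ≤ μAn := by rw [hμAn]; exact le_max_right _ _
  have hm3 : μAn < n' := by rw [hμAn]; exact max_lt (by linarith) hμAn'
  have hm0 : 0 < μAn := by linarith
  set R := r₁ + r₂ + r₃ with hR
  have hR1 : 1 ≤ R := by linarith
  have hR0 : 0 < R := by linarith
  set δ : ℝ := (n' - μAn) / 2 with hδdef
  have hδ : 0 < δ := by rw [hδdef]; linarith
  set c : ℝ := μAn + δ with hcdef
  have hcn : c + δ = n' := by rw [hcdef, hδdef]; ring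
  have hc0 : 0 < c := by linarith
  -- normalized gaps
  have hab : ∀ p : ℝ, 0 < p → p ≤ R → 0 < p / R ∧ p / R ≤ 1 ∧ p / R ≤ p := by
    intro p hp hpR
    refine ⟨by positivity, by rwa [div_le_one hR0], div_le_self hp.le hR1⟩
  obtain ⟨α0, α1, -⟩ := hab (s₁ - 1) (by linarith) (by linarith)
  obtain ⟨β0, β1, -⟩ := hab (r₂ - 2) (by linarith) (by linarith)
  obtain ⟨γ0, γ1, -⟩ := hab (s₃ - 1) (by linarith) (by linarith)
  obtain ⟨θ0, θ1, θ2⟩ := hab (r₁ - s₁) (by linarith) (by linarith)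
  obtain ⟨ζ0, ζ1, ζ2⟩ := hab (r₃ - s₃) (by linarith) (by linarith)
  have hαR : (s₁ - 1) / R * R = s₁ - 1 := by field_simp
  have hβR : (r₂ - 2) / R * R = r₂ - 2 := by field_simp
  have hγR : (s₃ - 1) / R * R = s₃ - 1 := by field_simp
  have hKeq : 10 ^ 6 * R ^ 5 / ((s₁ - 1) * (s₃ - 1) * (r₁ - s₁) * (r₃ - s₃) * (r₂ - 2)) =
      10 ^ 6 / ((s₁ - 1) / R * ((s₃ - 1) / R) * ((r₁ - s₁) / R) * ((r₃ - s₃) / R) *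
        ((r₂ - 2) / R)) := by
    field_simp
  rw [hKeq]
  set α := (s₁ - 1) / R
  set β := (r₂ - 2) / R
  set γ := (s₃ - 1) / R
  set θ := (r₁ - s₁) / R
  set ζ := (r₃ - s₃) / R
  set K : ℝ := 10 ^ 6 / (α * γ * θ * ζ * β) with hK
  -- constants
  have hden : 0 < α * γ * θ * ζ * β := by positivity
  have hKα : ∀ q p : ℝ, 0 < p → q ≤ 10 ^ 6 → α * γ * θ * ζ * β ≤ p → q / p ≤ K := by
    intro q p hp hq hpd
    rw [hK]; gcongr
  have d1 : α * γ * θ * ζ * β ≤ α * β * θ := by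
    have : γ * ζ ≤ 1 := mul_le_one₀ γ1 ζ0.le ζ1
    have h3 : 0 ≤ α * β * θ := by positivity
    nlinarith
  have d2 : α * γ * θ * ζ * β ≤ γ * ζ := by
    have : α * θ * β ≤ 1 := mul_le_one₀ (mul_le_one₀ α1 θ0.le θ1) β0.le β1
    have h3 : 0 ≤ γ * ζ := by positivity
    nlinarith
  have d3 : α * β * θ ≤ α * β := mul_le_of_le_one_right (by positivity) θ1
  have d4 : γ * ζ ≤ 1 := mul_le_one₀ γ1 ζ0.le ζ1
  have hK1 : 1 ≤ K := by
    have := hKα 1 1 one_pos (by norm_num) (d2.trans d4)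
    simpa using this
  have hK0 : 0 < K := by linarith
  -- the three pieces of numerical constants
  have k1 : (2 / (α * β / 4)) ^ (r₁ + 1) * 8 ^ r₁ * 2 ^ s₁ * (2 * θ⁻¹) ≤ K ^ (R + 1) := by
    refine const_bd (by positivity) ((one_le_inv₀ θ0).2 θ1) ?_ hK1 hr₁.le (by linarith)
      (by linarith)
    have := hKα 256 (α * β * θ) (by positivity) (by norm_num) d1
    calc _ = 256 / (α * β * θ) := by field_simp; norm_num
      _ ≤ K := this
  have k2 : (2 / (α * β / 4)) ^ (r₂ + 1) * 8 ^ r₂ * 2 ^ (r₂ / 2) * (2 * 1) ≤ K ^ (R + 1) := by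
    refine const_bd (by positivity) le_rfl ?_ hK1 (by linarith) (by linarith) (by linarith)
    have := hKα 256 (α * β) (by positivity) (by norm_num) (d1.trans d3)
    calc _ = 256 / (α * β) := by field_simp; norm_num
      _ ≤ K := this
  have k3 : (2 / (γ / 2)) ^ (r₃ + 1) * 8 ^ r₃ * 2 ^ s₃ * (2 * ζ⁻¹) ≤ K ^ (R + 1) := by
    refine const_bd (by positivity) ((one_le_inv₀ ζ0).2 ζ1) ?_ hK1 hr₃.le (by linarith)
      (by linarith)
    have := hKα 128 (γ * ζ) (by positivity) (by norm_num) d2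
    calc _ = 128 / (γ * ζ) := by field_simp; norm_num
      _ ≤ K := this
  -- service part
  obtain ⟨hgood, hzero, hNmeas, hNstat⟩ := pooled_stationary (μ := μ) S hSmeas hSnn hES
    (fun i j => ξ (i + 1) j) (fun i j => hξmeas _ _) (fun i j => hξnn _ _)
    (hindep.precomp (g := fun p : ℕ × ℕ => (p.1 + 1, p.2))
      (fun p q h => by
        simp only [Prod.mk.injEq, add_left_inj] at h
        exact Prod.ext h.1 h.2)) hlawS heqS n'
  have hNpart := full_N (μ := μ)
    (fun t ω => ∑ i ∈ Finset.range n', (renewalCount (fun j => ξ (i + 1) j ω) t : ℝ))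
    hC₁ hC₂ hn1 hs₁ hr₁ hr₂ hNmeas
    (by
      filter_upwards [ae_all_iff.2 hgood] with ω hω s t hs hst
      refine Finset.sum_le_sum fun i _ => ?_
      exact_mod_cast (hω i).count_mono hs hst)
    (by
      filter_upwards [hzero] with ω hω
      exact Finset.sum_eq_zero fun i _ => by exact_mod_cast hω i)
    hNstat hmom1 hmom2 (η := α * β / 4) (by positivity)
    (by nlinarith [mul_le_one₀ α1 β0.le β1])
    (by
      have h1 : α * β * r₁ ≤ α * 1 * R := by gcongr <;> linarith
      linarith)
    (by
      have h1 : α * β * r₂ ≤ 1 * β * R := by gcongr <;> linarith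
      linarith)
    θ0 θ1 θ2 hδ (by linarith) hx
  -- arrival part
  have hApart := full_A (μ := μ) (fun j => ξ 0 (j + 1)) (fun j => hξmeas _ _)
    (hindep.precomp (g := fun j : ℕ => (0, j + 1)) (fun p q h => by simpa using h))
    (fun j => by rw [hlawA, hlawA 0]) (fun j => hξnn _ _) hC₃ hs₃ hr₃ hmom3
    (η := γ / 2) (by positivity) (by linarith)
    (by
      have h1 : γ * r₃ ≤ γ * R := by gcongr <;> linarith
      linarith)
    ζ0 ζ1 ζ2 hm0 hm2 hδ hcdef (by linarith) hx
  have hincl : {ω | (x : EReal) ≤ ⨆ t : ℝ≥0,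
          (((renewalCount (fun j => ξ 0 j ω) (t : ℝ) : ℝ)
            - ∑ i ∈ Finset.range n', (renewalCount (fun j => ξ (i + 1) j ω) (t : ℝ) : ℝ) : ℝ) : EReal)}
      ≤ᵐ[μ] ({ω | ∃ k : ℕ, 3 * x / 8 ≤ k - c * ∑ i ∈ Finset.range k, ξ 0 (i + 1) ω} ∪
        {ω | ∃ t, 0 ≤ t ∧ 3 * x / 8 + δ * t ≤ n' * t -
          ∑ i ∈ Finset.range n', (renewalCount (fun j => ξ (i + 1) j ω) t : ℝ)} : Set Ω) := by
    filter_upwards [hξnn 0 0] with ω hω hle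
    have hlt : ((x - 1 : ℝ) : EReal) < ⨆ t : ℝ≥0,
          (((renewalCount (fun j => ξ 0 j ω) (t : ℝ) : ℝ)
            - ∑ i ∈ Finset.range n', (renewalCount (fun j => ξ (i + 1) j ω) (t : ℝ) : ℝ) : ℝ) : EReal) :=
      lt_of_lt_of_le (EReal.coe_lt_coe_iff.2 (by linarith)) hle
    obtain ⟨t, ht⟩ := lt_iSup_iff.1 hlt
    rw [EReal.coe_lt_coe_iff] at ht
    rcases decomp hx hc0.le hcn t.2 (fun j => ξ 0 j ω) hω _
      (Finset.sum_nonneg fun i _ => Nat.cast_nonneg _) ht with h | h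
    · exact Or.inl h
    · exact Or.inr ⟨t, t.2, h⟩
  have htot := (measure_mono_ae hincl).trans ((measure_union_le _ _).trans (add_le_add hApart hNpart))
  rw [← ENNReal.ofReal_add (by positivity) (by positivity)] at htot
  have hnm : 0 < (n' : ℝ) - μAn := by linarith
  have hδs : ∀ s : ℝ, δ ^ (-s) = 2 ^ s * ((n' : ℝ) - μAn) ^ (-s) := by
    intro s
    rw [hδdef, div_eq_mul_inv, Real.mul_rpow hnm.le (by norm_num), Real.inv_rpow (by norm_num),
      Real.rpow_neg (show (0:ℝ) ≤ 2 by norm_num), inv_inv, mul_comm]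
  refine ENNReal.toReal_le_of_le_ofReal (by positivity) (htot.trans (ENNReal.ofReal_le_ofReal ?_))
  rw [hδs, hδs, hδs]
  have c1 : C₁ ≤ (1 + C₁) * (1 + C₂) * (1 + C₃) := by
    exact one_add_bd hC₁ hC₂ hC₃
  have c2 : C₂ ≤ (1 + C₁) * (1 + C₂) * (1 + C₃) := by
    linarith [one_add_bd hC₂ hC₁ hC₃]
  have c3 : C₃ ≤ (1 + C₁) * (1 + C₂) * (1 + C₃) := by
    linarith [one_add_bd hC₃ hC₁ hC₂]
  have h42 : (4:ℝ) ^ r₃ * 2 ^ s₃ ≤ 8 ^ r₃ := by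
    calc (4:ℝ) ^ r₃ * 2 ^ s₃ ≤ 4 ^ r₃ * 2 ^ r₃ := by
          exact mul_le_mul_of_nonneg_left
            (Real.rpow_le_rpow_of_exponent_le (by norm_num) hr₃.le) (by positivity)
      _ = 8 ^ r₃ := by rw [← Real.mul_rpow (by norm_num) (by norm_num)]; norm_num
  have hcn' : c ^ r₃ ≤ (n' : ℝ) ^ r₃ := Real.rpow_le_rpow hc0.le (by linarith) (by linarith)
  have hg : ∀ (k C G : ℝ), 0 ≤ C → 0 ≤ G → k ≤ K ^ (R + 1) →
      C ≤ (1 + C₁) * (1 + C₂) * (1 + C₃) →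
      k * C * G ≤ K ^ (R + 1) * (1 + C₁) * (1 + C₂) * (1 + C₃) * G := by
    intro k C G hC hG hk hCC
    calc k * C * G ≤ K ^ (R + 1) * ((1 + C₁) * (1 + C₂) * (1 + C₃)) * G := by gcongr
      _ = _ := by ring
  have t1 := hg _ C₁ ((n' : ℝ) ^ (r₁ / 2) * ((n' : ℝ) - μAn) ^ (-s₁) * x ^ (-(r₁ - s₁)))
    hC₁.le (by positivity) k1 c1
  have t2 := hg _ C₂ ((n' : ℝ) ^ (r₂ / 2) * ((n' : ℝ) - μAn) ^ (-(r₂ / 2)) * x ^ (-(r₂ / 2)))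
    hC₂.le (by positivity) k2 c2
  have t3 := hg _ C₃ (((n' : ℝ) - μAn) ^ (-s₃) * (n' : ℝ) ^ r₃ * μAn ^ (-(r₃ - s₃)) *
    x ^ (-(r₃ - s₃))) hC₃.le (by positivity) k3 c3
  have u3 : (2 / (γ / 2)) ^ (r₃ + 1) * C₃ * 2 ^ s₃ * (2 ^ s₃ * ((n' : ℝ) - μAn) ^ (-s₃)) *
        μAn ^ (-(r₃ - s₃)) * x ^ (-(r₃ - s₃)) * 4 ^ r₃ * c ^ r₃ * (2 / ζ) ≤
      (2 / (γ / 2)) ^ (r₃ + 1) * 8 ^ r₃ * 2 ^ s₃ * (2 * ζ⁻¹) * C₃ *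
        (((n' : ℝ) - μAn) ^ (-s₃) * (n' : ℝ) ^ r₃ * μAn ^ (-(r₃ - s₃)) * x ^ (-(r₃ - s₃))) := by
    calc _ = (2 / (γ / 2)) ^ (r₃ + 1) * (4 ^ r₃ * 2 ^ s₃) * 2 ^ s₃ * (2 * ζ⁻¹) * C₃ *
        (((n' : ℝ) - μAn) ^ (-s₃) * c ^ r₃ * μAn ^ (-(r₃ - s₃)) * x ^ (-(r₃ - s₃))) := by ring
      _ ≤ _ := by gcongr
  refine (add_le_add u3 le_rfl).trans ?_
  rw [mul_add, mul_add]
  refine le_trans (le_of_eq ?_) (add_le_add (add_le_add t1 t2) t3)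
  ring
end

section
/- Suppose E[S] = 1 and E[S^r] < ∞ for some r ≥ 2. Then for all t ≥ 1 and all θ > 0, E[|N_o(t) − t|^r] ≤ exp(θ) E[S^r] (10^5 r^2 / (1 − E[exp(−θS)]))^{r+1} t^{r/2}. -/
open MeasureTheory ProbabilityTheory
open scoped ENNReal

lemma rn_pow_sub {p u v : ℝ} (hp : 0 ≤ p) (hv : 0 ≤ v) (huv : v ≤ u) :
    u ^ p * u - v ^ p * v ≤ (p + 1) * (u ^ p * (u - v)) := by
  rcases hv.eq_or_lt with rfl | hv
  · have := Real.rpow_nonneg huv p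
    nlinarith [mul_nonneg hp (mul_nonneg this huv)]
  have hu : 0 < u := hv.trans_le huv
  have h := one_add_mul_self_le_rpow_one_add (s := v / u - 1) (by
    have : 0 ≤ v / u := by positivity
    linarith) (p := p + 1) (by linarith)
  have e : (1 + (v / u - 1)) ^ (p + 1) * (u ^ p * u) = v ^ p * v := by
    rw [show 1 + (v / u - 1) = v / u by ring, ← Real.rpow_add_one hu.ne', ← Real.rpow_add_one hv.ne',
      ← Real.mul_rpow (by positivity) hu.le, div_mul_cancel₀ _ hu.ne']
  have e2 : (1 + (p + 1) * (v / u - 1)) * (u ^ p * u) = u ^ p * u - (p + 1) * (u ^ p * (u - v)) := by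
    field_simp
    ring
  have := mul_le_mul_of_nonneg_right h (by positivity : 0 ≤ u ^ p * u)
  rw [e, e2] at this
  linarith

lemma rn_g_lip {p u v M : ℝ} (hp : 0 ≤ p) (hu : |u| ≤ M) (hv : |v| ≤ M) :
    |(|u| ^ p * u - |v| ^ p * v)| ≤ (p + 1) * (M ^ p * |u - v|) := by
  wlog h : |v| ≤ |u| generalizing u v
  · have := this hv hu (le_of_not_ge h)
    rwa [abs_sub_comm, abs_sub_comm u v]
  have hM : |u| ^ p ≤ M ^ p := Real.rpow_le_rpow (abs_nonneg _) hu hp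
  have hvu : |v| ^ p ≤ |u| ^ p := Real.rpow_le_rpow (abs_nonneg _) h hp
  have h0 : 0 ≤ |v| ^ p := by positivity
  have key : |(|u| ^ p * u - |v| ^ p * v)| ≤ (p + 1) * (|u| ^ p * |u - v|) := by
    rcases le_total 0 u with hu0 | hu0 <;> rcases le_total 0 v with hv0 | hv0
    · rw [abs_of_nonneg hu0, abs_of_nonneg hv0] at *
      rw [abs_of_nonneg (by linarith : 0 ≤ u - v), abs_of_nonneg]
      · exact rn_pow_sub hp hv0 h
      · nlinarith
    · rw [abs_of_nonneg hu0, abs_of_nonpos hv0] at *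
      rw [abs_of_nonneg (by linarith : 0 ≤ u - v), abs_of_nonneg]
      · have : 0 ≤ p * (u ^ p * (u - v)) := mul_nonneg hp (mul_nonneg (by linarith) (by linarith))
        nlinarith
      · nlinarith
    · rw [abs_of_nonpos hu0, abs_of_nonneg hv0] at *
      rw [abs_of_nonpos (by linarith : u - v ≤ 0), abs_of_nonpos]
      · have : 0 ≤ p * ((-u) ^ p * (v - u)) := mul_nonneg hp (mul_nonneg (by linarith) (by linarith))
        nlinarith
      · nlinarith
    · rw [abs_of_nonpos hu0, abs_of_nonpos hv0] at *
      have := rn_pow_sub hp (by linarith : 0 ≤ -v) h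
      rw [abs_of_nonpos (by linarith : u - v ≤ 0), abs_of_nonpos]
      · linarith
      · nlinarith
  refine key.trans ?_
  gcongr

lemma rn_sum_rpow {r x y : ℝ} (hr : 2 ≤ r) (hx : 0 ≤ x) (hy : 0 ≤ y) :
    (x + y) ^ (r - 2) ≤ 3 * x ^ (r - 2) + (1 + r) ^ (r - 2) * y ^ (r - 2) := by
  have hp : 0 ≤ r - 2 := by linarith
  have h1 : 0 ≤ x ^ (r - 2) := by positivity
  have h2 : 0 ≤ (1 + r) ^ (r - 2) * y ^ (r - 2) := by positivity
  rcases le_total (r * y) x with h | h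
  · have : (x + y) ^ (r - 2) ≤ ((1 + 1 / r) * x) ^ (r - 2) := by
      apply Real.rpow_le_rpow (by positivity) _ hp
      have : y ≤ x / r := by rw [le_div_iff₀ (by linarith)]; linarith
      calc x + y ≤ x + x / r := by linarith
        _ = _ := by ring
    rw [Real.mul_rpow (by positivity) hx] at this
    have h3 : (1 + 1 / r) ^ (r - 2) ≤ 3 := by
      calc (1 + 1 / r) ^ (r - 2) ≤ (Real.exp (1 / r)) ^ (r - 2) := by
            apply Real.rpow_le_rpow (by positivity) _ hp
            linarith [Real.add_one_le_exp (1 / r)]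
        _ = Real.exp (1 / r * (r - 2)) := by rw [Real.exp_mul]
        _ ≤ Real.exp 1 := by
            apply Real.exp_le_exp.2
            rw [one_div_mul_eq_div, div_le_one (by linarith)]; linarith
        _ ≤ 3 := Real.exp_one_lt_three.le
    nlinarith
  · have : (x + y) ^ (r - 2) ≤ ((1 + r) * y) ^ (r - 2) := by
      apply Real.rpow_le_rpow (by positivity) _ hp
      linarith
    rw [Real.mul_rpow (by positivity) hy] at this
    linarith

lemma rn_taylor {r : ℝ} (hr : 2 ≤ r) (a b : ℝ) :
    |a + b| ^ r ≤ |a| ^ r + r * (|a| ^ (r - 2) * a * b)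
      + r ^ 2 * (3 * (|a| ^ (r - 2) * b ^ 2) + (1 + r) ^ (r - 2) * |b| ^ r) := by
  have hd : ∀ x : ℝ, HasDerivAt (fun x : ℝ => |a + x * b| ^ r)
      (r * |a + x * b| ^ (r - 2) * (a + x * b) * b) x := by
    intro x
    have h1 : HasDerivAt (fun x : ℝ => a + x * b) b x := by
      simpa using ((hasDerivAt_id x).mul_const b).const_add a
    exact (hasDerivAt_abs_rpow (a + x * b) (by linarith)).comp x h1
  obtain ⟨c, hc, hceq⟩ := exists_hasDerivAt_eq_slope (fun x : ℝ => |a + x * b| ^ r) _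
    (zero_lt_one) (fun x _ => (hd x).continuousAt.continuousWithinAt) (fun x _ => hd x)
  simp only [one_mul, zero_mul, add_zero, sub_zero, div_one] at hceq
  have hcb : |c * b| ≤ |b| := by
    rw [abs_mul, abs_of_pos hc.1]
    nlinarith [abs_nonneg b, hc.2]
  have hl := rn_g_lip (p := r - 2) (u := a + c * b) (v := a) (M := |a| + |b|) (by linarith)
    ((abs_add_le _ _).trans (by linarith)) (by linarith [abs_nonneg b])
  rw [show a + c * b - a = c * b by ring] at hl
  have hs := rn_sum_rpow hr (abs_nonneg a) (abs_nonneg b)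
  have hM : 0 ≤ (|a| + |b|) ^ (r - 2) := by positivity
  have e1 : |a + b| ^ r = |a| ^ r + r * (|a| ^ (r - 2) * a * b)
      + r * ((|a + c * b| ^ (r - 2) * (a + c * b) - |a| ^ (r - 2) * a) * b) := by
    linear_combination -hceq
  rw [e1]
  have h2 : (|a + c * b| ^ (r - 2) * (a + c * b) - |a| ^ (r - 2) * a) * b
      ≤ r * ((|a| + |b|) ^ (r - 2) * b ^ 2) := by
    calc _ ≤ |(|a + c * b| ^ (r - 2) * (a + c * b) - |a| ^ (r - 2) * a)| * |b| := by
          rw [← abs_mul]; exact le_abs_self _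
      _ ≤ ((r - 2 + 1) * ((|a| + |b|) ^ (r - 2) * |b|)) * |b| := by
          refine mul_le_mul_of_nonneg_right (hl.trans ?_) (abs_nonneg _)
          have : 0 ≤ r - 2 + 1 := by linarith
          gcongr
      _ = (r - 1) * ((|a| + |b|) ^ (r - 2) * b ^ 2) := by rw [← sq_abs b]; ring
      _ ≤ _ := by gcongr; linarith
  have h3 : |b| ^ (r - 2) * b ^ 2 = |b| ^ r := by
    rw [← sq_abs b, ← Real.rpow_two, ← Real.rpow_add_of_nonneg (abs_nonneg _) (by linarith) (by norm_num)]
    congr 1; ring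
  have h4 : (|a| + |b|) ^ (r - 2) * b ^ 2
      ≤ 3 * (|a| ^ (r - 2) * b ^ 2) + (1 + r) ^ (r - 2) * |b| ^ r := by
    rw [← h3]
    have := mul_le_mul_of_nonneg_right hs (sq_nonneg b)
    linarith
  have h5 := h2.trans (mul_le_mul_of_nonneg_left h4 (by linarith : 0 ≤ r))
  have h6 := mul_le_mul_of_nonneg_left h5 (by linarith : 0 ≤ r)
  linarith

lemma rn_jensen {Ω : Type*} [MeasurableSpace Ω] {μ : Measure Ω} [IsProbabilityMeasure μ]
    {Y : Ω → ℝ} (hY : ∀ᵐ ω ∂μ, 0 ≤ Y ω) (hi : Integrable Y μ) {s : ℝ} (hs0 : 0 ≤ s) (hs1 : s ≤ 1) :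
    Integrable (fun ω => Y ω ^ s) μ ∧ ∫ ω, Y ω ^ s ∂μ ≤ (∫ ω, Y ω ∂μ) ^ s := by
  have h1 : Integrable (fun ω => Y ω ^ s) μ := by
    refine Integrable.mono' ((integrable_const (1 : ℝ)).add hi)
      (hi.aemeasurable.pow_const s).aestronglyMeasurable ?_
    filter_upwards [hY] with ω h
    rw [Real.norm_of_nonneg (by positivity)]
    simp only [Pi.add_apply]
    rcases le_total (Y ω) 1 with h' | h'
    · have := Real.rpow_le_one h h' hs0
      linarith
    · have := Real.rpow_le_rpow_of_exponent_le h' hs1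
      rw [Real.rpow_one] at this
      linarith
  refine ⟨h1, ?_⟩
  exact (Real.concaveOn_rpow hs0 hs1).le_map_integral
    (Real.continuous_rpow_const hs0).continuousOn isClosed_Ici hY hi h1

lemma rn_lyap {Ω : Type*} [MeasurableSpace Ω] {μ : Measure Ω} [IsProbabilityMeasure μ]
    {Z : Ω → ℝ} {r p : ℝ} (hr : 2 ≤ r) (hp : 0 ≤ p) (hpr : p ≤ r)
    (hi : Integrable (fun ω => |Z ω| ^ r) μ) :
    Integrable (fun ω => |Z ω| ^ p) μ ∧ ∫ ω, |Z ω| ^ p ∂μ ≤ (∫ ω, |Z ω| ^ r ∂μ) ^ (p / r) := by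
  have := rn_jensen (μ := μ) (Filter.Eventually.of_forall fun ω => by positivity) hi
    (s := p / r) (by positivity) (by rw [div_le_one (by linarith)]; exact hpr)
  have e : ∀ ω, (|Z ω| ^ r) ^ (p / r) = |Z ω| ^ p := by
    intro ω
    rw [← Real.rpow_mul (abs_nonneg _), mul_div_cancel₀ _ (by linarith)]
  simpa only [e] using this

lemma rn_step {Ω : Type*} [MeasurableSpace Ω] {μ : Measure Ω} [IsProbabilityMeasure μ]
    {Z X H : Ω → ℝ} {r : ℝ} (hr : 2 ≤ r) (hZ : Measurable Z) (hX : Measurable X) (hH : Measurable H)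
    (hH1 : ∀ ω, |H ω| ≤ 1) (hiZ : Integrable (fun ω => |Z ω| ^ r) μ)
    (hiX : Integrable (fun ω => |X ω| ^ r) μ) (hX0 : ∫ ω, X ω ∂μ = 0)
    (hind : IndepFun (fun ω => (Z ω, H ω)) X μ) :
    Integrable (fun ω => |Z ω + H ω * X ω| ^ r) μ ∧
    ∫ ω, |Z ω + H ω * X ω| ^ r ∂μ ≤ ∫ ω, |Z ω| ^ r ∂μ
      + r ^ 2 * (3 * ((∫ ω, |Z ω| ^ r ∂μ) ^ ((r - 2) / r) * (∫ ω, |X ω| ^ r ∂μ) ^ (2 / r))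
        + (1 + r) ^ (r - 2) * ∫ ω, |X ω| ^ r ∂μ) := by
  have hgm : Measurable (fun z : ℝ × ℝ => |z.1| ^ (r - 2) * z.1 * z.2) := by fun_prop
  have hpm : Measurable (fun z : ℝ × ℝ => |z.1| ^ (r - 2)) := by fun_prop
  have hsm : Measurable (fun z : ℝ => z ^ 2) := by fun_prop
  have i1 : IndepFun (fun ω => |Z ω| ^ (r - 2) * Z ω * H ω) X μ := hind.comp hgm measurable_id
  have i2 : IndepFun (fun ω => |Z ω| ^ (r - 2)) (fun ω => X ω ^ 2) μ := hind.comp hpm hsm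
  have iX : Integrable X μ := by
    have := (rn_lyap (μ := μ) hr zero_le_one (by linarith) hiX).1
    simp only [Real.rpow_one] at this
    exact (integrable_norm_iff hX.aestronglyMeasurable).1 this
  have iX2 := rn_lyap (μ := μ) hr zero_le_two hr hiX
  simp only [Real.rpow_two, sq_abs] at iX2
  have iP := rn_lyap (μ := μ) hr (p := r - 2) (by linarith) (by linarith) hiZ
  have iG : Integrable (fun ω => |Z ω| ^ (r - 2) * Z ω * H ω) μ := by
    refine Integrable.mono' (rn_lyap (μ := μ) hr (p := r - 1) (by linarith) (by linarith) hiZ).1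
      (by fun_prop) (Filter.Eventually.of_forall fun ω => ?_)
    rw [norm_mul, norm_mul, Real.norm_of_nonneg (by positivity), Real.norm_eq_abs, Real.norm_eq_abs]
    have : |Z ω| ^ (r - 1) = |Z ω| ^ (r - 2) * |Z ω| := by
      rw [show r - 1 = (r - 2) + 1 by ring, Real.rpow_add_of_nonneg (abs_nonneg _) (by linarith) zero_le_one,
        Real.rpow_one]
    rw [this]
    exact mul_le_of_le_one_right (by positivity) (hH1 ω)
  have j1 : Integrable (fun ω => |Z ω| ^ (r - 2) * Z ω * H ω * X ω) μ := i1.integrable_mul iG iX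
  have j2 : Integrable (fun ω => |Z ω| ^ (r - 2) * X ω ^ 2) μ := i2.integrable_mul iP.1 iX2.1
  have j3 := (hiZ.add (j1.const_mul r)).add
    (((j2.const_mul 3).add (hiX.const_mul ((1 + r) ^ (r - 2)))).const_mul (r ^ 2))
  have hle : ∀ ω, |Z ω + H ω * X ω| ^ r ≤ |Z ω| ^ r + r * (|Z ω| ^ (r - 2) * Z ω * H ω * X ω)
      + r ^ 2 * (3 * (|Z ω| ^ (r - 2) * X ω ^ 2) + (1 + r) ^ (r - 2) * |X ω| ^ r) := by
    intro ω
    refine (rn_taylor hr (Z ω) (H ω * X ω)).trans ?_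
    have hb : |H ω * X ω| ≤ |X ω| := by
      rw [abs_mul]; exact mul_le_of_le_one_left (abs_nonneg _) (hH1 ω)
    have hb2 : (H ω * X ω) ^ 2 ≤ X ω ^ 2 := sq_le_sq.2 hb
    rw [← mul_assoc (|Z ω| ^ (r - 2) * Z ω)]
    gcongr
  have hIntg : Integrable (fun ω => |Z ω + H ω * X ω| ^ r) μ := by
    refine Integrable.mono' j3
      (Measurable.aestronglyMeasurable (by fun_prop)) (Filter.Eventually.of_forall fun ω => ?_)
    rw [Real.norm_of_nonneg (by positivity)]
    exact hle ω
  refine ⟨hIntg, (integral_mono hIntg j3 hle).trans ?_⟩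
  have e1 : ∫ ω, |Z ω| ^ (r - 2) * Z ω * H ω * X ω ∂μ = 0 := by
    rw [i1.integral_fun_mul_eq_mul_integral (by fun_prop) (by fun_prop), hX0, mul_zero]
  have e2 : ∫ ω, |Z ω| ^ (r - 2) * X ω ^ 2 ∂μ = (∫ ω, |Z ω| ^ (r - 2) ∂μ) * ∫ ω, X ω ^ 2 ∂μ :=
    i2.integral_fun_mul_eq_mul_integral (Measurable.aestronglyMeasurable (by fun_prop)) (by fun_prop)
  simp only [Pi.add_apply]
  rw [integral_add, integral_add, integral_const_mul, integral_const_mul, integral_add,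
    integral_const_mul, integral_const_mul, e1, e2, mul_zero, add_zero]
  · have h0 : 0 ≤ ∫ ω, X ω ^ 2 ∂μ := integral_nonneg fun _ => sq_nonneg _
    have h00 : 0 ≤ ∫ ω, |Z ω| ^ r ∂μ := integral_nonneg fun _ => by positivity
    have h3 := mul_le_mul iP.2 iX2.2 h0 (Real.rpow_nonneg h00 _)
    gcongr
  · exact j2.const_mul 3
  · exact hiX.const_mul _
  · exact hiZ
  · exact j1.const_mul r
  · exact hiZ.add (j1.const_mul r)
  · exact ((j2.const_mul 3).add (hiX.const_mul ((1 + r) ^ (r - 2)))).const_mul (r ^ 2)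

/-- a function of the sequence that looks at the first `n` coordinates only is independent
of the `n`-th variable -/
lemma rn_indep {Ω : Type*} [MeasurableSpace Ω] {μ : Measure Ω} {β : Type*} [MeasurableSpace β]
    {X : ℕ → Ω → ℝ} (hm : ∀ i, Measurable (X i)) (hi : iIndepFun X μ) (n : ℕ)
    (F : (ℕ → ℝ) → β) (hF : Measurable F)
    (hdep : ∀ ξ ξ' : ℕ → ℝ, (∀ j < n, ξ j = ξ' j) → F ξ = F ξ') :
    IndepFun (fun ω => F (fun i => X i ω)) (X n) μ := by
  have h := hi.indepFun_finset (Finset.range n) {n} (by simp) hm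
  have := h.comp (φ := fun v : Finset.range n → ℝ =>
      F (fun i => if h : i ∈ Finset.range n then v ⟨i, h⟩ else 0))
    (ψ := fun v : ({n} : Finset ℕ) → ℝ => v ⟨n, by simp⟩)
    (hF.comp (measurable_pi_lambda _ fun i => by
      by_cases h : i ∈ Finset.range n
      · simp only [h, dite_true]; exact measurable_pi_apply _
      · simp only [h, dite_false]; exact measurable_const)) (by fun_prop : Measurable fun v : ({n} : Finset ℕ) → ℝ => v ⟨n, by simp⟩)
  convert this using 1
  · funext ω
    apply hdep
    intro j hj
    simp [hj]
  · rfl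

lemma rn_arith {r A I : ℝ} (hr : 2 ≤ r) (hA : 0 ≤ A) (n : ℕ) (hI0 : 0 ≤ I)
    (hI : I ≤ (4 * r) ^ r * (n : ℝ) ^ (r / 2) * A) :
    I + r ^ 2 * (3 * (I ^ ((r - 2) / r) * A ^ (2 / r)) + (1 + r) ^ (r - 2) * A)
      ≤ (4 * r) ^ r * ((n + 1 : ℕ) : ℝ) ^ (r / 2) * A := by
  have hr0 : 0 < r := by linarith
  set a : ℝ := (4 * r) ^ (r - 2) with ha
  set N : ℝ := ((n + 1 : ℕ) : ℝ) with hN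
  have hN1 : 1 ≤ N := by rw [hN]; push_cast; linarith [Nat.cast_nonneg (α := ℝ) n]
  have hNn : (n : ℝ) + 1 = N := by rw [hN]; push_cast; rfl
  set b : ℝ := N ^ (r / 2 - 1) with hb
  have hn0 : (0:ℝ) ≤ n := Nat.cast_nonneg n
  have hb1 : 1 ≤ b := Real.one_le_rpow hN1 (by linarith)
  have ha0 : 0 ≤ a := by positivity
  have hI1 : I ^ ((r - 2) / r) * A ^ (2 / r) ≤ a * b * A := by
    calc I ^ ((r - 2) / r) * A ^ (2 / r)
        ≤ ((4 * r) ^ r * (n : ℝ) ^ (r / 2) * A) ^ ((r - 2) / r) * A ^ (2 / r) := by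
          gcongr
      _ = a * (n : ℝ) ^ (r / 2 - 1) * (A ^ ((r - 2) / r) * A ^ (2 / r)) := by
          rw [Real.mul_rpow (by positivity) hA, Real.mul_rpow (by positivity) (by positivity),
            ← Real.rpow_mul (by positivity), ← Real.rpow_mul hn0]
          rw [show r * ((r - 2) / r) = r - 2 by field_simp,
            show r / 2 * ((r - 2) / r) = r / 2 - 1 by field_simp]
          ring
      _ = a * (n : ℝ) ^ (r / 2 - 1) * A := by
          rw [← Real.rpow_add_of_nonneg hA (div_nonneg (by linarith) hr0.le) (by positivity),
            show (r - 2) / r + 2 / r = 1 by field_simp; ring, Real.rpow_one]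
      _ ≤ a * b * A := by
          have : (n : ℝ) ^ (r / 2 - 1) ≤ b := Real.rpow_le_rpow hn0 (by linarith) (by linarith)
          gcongr
  have hc : (1 + r) ^ (r - 2) ≤ a := Real.rpow_le_rpow (by linarith) (by linarith) (by linarith)
  have hK : (4 * r) ^ r = 16 * r ^ 2 * a := by
    rw [ha, show (4 * r) ^ r = (4 * r) ^ ((r - 2) + 2) by congr 1; ring,
      Real.rpow_add (by positivity), Real.rpow_two]
    ring
  have hnb : (n : ℝ) ^ (r / 2) ≤ n * b := by
    rw [show (n : ℝ) ^ (r / 2) = (n : ℝ) ^ ((r / 2 - 1) + 1) by congr 1; ring,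
      Real.rpow_add_of_nonneg hn0 (by linarith) zero_le_one, Real.rpow_one, mul_comm]
    have : (n : ℝ) ^ (r / 2 - 1) ≤ b := Real.rpow_le_rpow hn0 (by linarith) (by linarith)
    gcongr
  have hNb : N ^ (r / 2) = (n + 1) * b := by
    rw [hNn, show N ^ (r / 2) = N ^ ((r / 2 - 1) + 1) by congr 1; ring,
      Real.rpow_add (by linarith), Real.rpow_one, mul_comm]
  have hI2 : I ≤ 16 * r ^ 2 * a * (n * b) * A := by
    rw [hK] at hI
    refine hI.trans ?_
    gcongr
  have h5 : (1 + r) ^ (r - 2) * A ≤ a * b * A := by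
    have : (1 + r) ^ (r - 2) ≤ a * b := hc.trans (le_mul_of_one_le_right ha0 hb1)
    gcongr
  have h6 : r ^ 2 * (3 * (I ^ ((r - 2) / r) * A ^ (2 / r)) + (1 + r) ^ (r - 2) * A)
      ≤ r ^ 2 * (3 * (a * b * A) + a * b * A) := by gcongr
  rw [hK, hNb]
  have h7 : 0 ≤ r ^ 2 * (a * b * A) := by positivity
  nlinarith

/-- Marcinkiewicz–Zygmund type bound for predictable transforms -/
lemma rn_mz {Ω : Type*} [MeasurableSpace Ω] {μ : Measure Ω} [IsProbabilityMeasure μ]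
    {X : ℕ → Ω → ℝ} (hm : ∀ i, Measurable (X i)) (hi : iIndepFun X μ) {r A : ℝ} (hr : 2 ≤ r)
    (hX1 : ∀ i, ∫ ω, (X i ω - 1) ∂μ = 0) (hXi : ∀ i, Integrable (fun ω => |X i ω - 1| ^ r) μ)
    (hXA : ∀ i, ∫ ω, |X i ω - 1| ^ r ∂μ = A)
    (H : ℕ → (ℕ → ℝ) → ℝ) (hHm : ∀ i, Measurable (H i)) (hH1 : ∀ i ξ, |H i ξ| ≤ 1)
    (hHd : ∀ i, ∀ ξ ξ' : ℕ → ℝ, (∀ j < i, ξ j = ξ' j) → H i ξ = H i ξ') (n : ℕ) :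
    Integrable (fun ω => |∑ i ∈ Finset.range n, H i (fun j => X j ω) * (X i ω - 1)| ^ r) μ ∧
    ∫ ω, |∑ i ∈ Finset.range n, H i (fun j => X j ω) * (X i ω - 1)| ^ r ∂μ
      ≤ (4 * r) ^ r * (n : ℝ) ^ (r / 2) * A := by
  have hA : 0 ≤ A := by rw [← hXA 0]; exact integral_nonneg fun _ => by positivity
  have hXm : Measurable (fun ω => fun j => X j ω) := measurable_pi_lambda _ hm
  induction n with
  | zero =>
    have : (0:ℝ) ^ r = 0 := Real.zero_rpow (by linarith)
    simp only [Finset.range_zero, Finset.sum_empty, abs_zero, this, integral_zero]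
    exact ⟨integrable_const 0, by positivity⟩
  | succ n ih =>
    have hind : IndepFun (fun ω => (∑ i ∈ Finset.range n, H i (fun j => X j ω) * (X i ω - 1),
        H n (fun j => X j ω))) (X n) μ := by
      refine rn_indep hm hi n (fun ξ => (∑ i ∈ Finset.range n, H i ξ * (ξ i - 1), H n ξ)) ?_ ?_
      · refine Measurable.prodMk (Finset.measurable_sum _ fun i _ => ?_) (hHm n)
        exact (hHm i).mul ((measurable_pi_apply i).sub_const 1)
      · intro ξ ξ' h
        rw [Prod.mk.injEq]
        refine ⟨Finset.sum_congr rfl fun i hi => ?_, hHd n _ _ h⟩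
        have hi := Finset.mem_range.1 hi
        rw [h i hi, hHd i ξ ξ' fun j hj => h j (hj.trans hi)]
    have hind' := hind.comp (ψ := fun x : ℝ => x - 1) measurable_id (by fun_prop)
    have hs := rn_step (μ := μ) hr
      (Z := fun ω => ∑ i ∈ Finset.range n, H i (fun j => X j ω) * (X i ω - 1))
      (X := fun ω => X n ω - 1) (H := fun ω => H n (fun j => X j ω))
      (Finset.measurable_sum _ fun i _ => ((hHm i).comp hXm).mul ((hm i).sub_const 1))
      ((hm n).sub_const 1) ((hHm n).comp hXm) (fun ω => hH1 _ _) ih.1 (hXi n) (hX1 n) hind'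
    simp only [Finset.sum_range_succ]
    refine ⟨hs.1, hs.2.trans ?_⟩
    rw [hXA]
    exact rn_arith hr hA n (integral_nonneg fun _ => by positivity) ih.2

/-- indicator that the `i`-th step is taken before passing level `t` -/
noncomputable def rnH (t : ℝ) (i : ℕ) (ξ : ℕ → ℝ) : ℝ :=
  if ∑ j ∈ Finset.range i, ξ j ≤ t then 1 else 0

lemma rn_psum_mono {ξ : ℕ → ℝ} (h : ∀ i, 0 ≤ ξ i) : Monotone fun n => ∑ i ∈ Finset.range n, ξ i :=
  monotone_nat_of_le_succ fun n => by rw [Finset.sum_range_succ]; linarith [h n]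

lemma rn_three {r a b c x : ℝ} (hr : 2 ≤ r) (ha : 0 ≤ a) (hb : 0 ≤ b) (hc : 0 ≤ c) (hx : 0 ≤ x)
    (h : x ≤ a + b + c) : x ^ r ≤ 3 ^ r * (a ^ r + b ^ r + c ^ r) := by
  have ha' := Real.rpow_nonneg ha r
  have hb' := Real.rpow_nonneg hb r
  have hc' := Real.rpow_nonneg hc r
  have key : ∀ y, 0 ≤ y → x ≤ 3 * y → x ^ r ≤ 3 ^ r * y ^ r := fun y hy hxy => by
    rw [← Real.mul_rpow (by norm_num) hy]
    exact Real.rpow_le_rpow hx hxy (by linarith)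
  have h3 : (0:ℝ) ≤ 3 ^ r := by positivity
  rcases le_total a b with h1 | h1 <;> rcases le_total b c with h2 | h2 <;>
    rcases le_total a c with h4 | h4
  all_goals first
    | exact (key a ha (by linarith)).trans (mul_le_mul_of_nonneg_left (by linarith) h3)
    | exact (key b hb (by linarith)).trans (mul_le_mul_of_nonneg_left (by linarith) h3)
    | exact (key c hc (by linarith)).trans (mul_le_mul_of_nonneg_left (by linarith) h3)

lemma rn_small {ξ : ℕ → ℝ} (h : ∀ i, 0 ≤ ξ i) {t r : ℝ} (ht : 1 ≤ t) (hr : 2 ≤ r) {m : ℕ}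
    (hm : t < ∑ i ∈ Finset.range m, ξ i) :
    |(renewalCount ξ t : ℝ) - t| ^ r ≤
      3 ^ r * (|∑ i ∈ Finset.range m, rnH t i ξ * (ξ i - 1)| ^ r + 1
        + ∑ i ∈ Finset.range m, ξ i ^ r) := by
  have mono := rn_psum_mono h
  set s : Set ℕ := {n : ℕ | ∑ i ∈ Finset.range n, ξ i ≤ t} with hs
  have hlt : ∀ n ∈ s, n < m := fun n hn => by
    by_contra hc
    have := mono (not_lt.1 hc)
    have h2 : ∑ i ∈ Finset.range n, ξ i ≤ t := hn
    simp only at this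
    linarith
  have hbdd : BddAbove s := ⟨m, fun n hn => (hlt n hn).le⟩
  have hne : s.Nonempty := ⟨0, by simp [hs]; linarith⟩
  set N := renewalCount ξ t with hN
  have hNs : N ∈ s := Nat.sSup_mem hne hbdd
  have hNm : N < m := hlt N hNs
  have hN1 : N + 1 ∉ s := fun hc => by
    have : N + 1 ≤ N := le_csSup hbdd hc
    omega
  have hNs' : ∑ i ∈ Finset.range N, ξ i ≤ t := hNs
  have hN1' : t < ∑ i ∈ Finset.range (N + 1), ξ i := not_le.1 hN1
  have hZ : ∑ i ∈ Finset.range m, rnH t i ξ * (ξ i - 1)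
      = ∑ i ∈ Finset.range (N + 1), (ξ i - 1) := by
    symm
    rw [← Finset.sum_subset (Finset.range_mono (Nat.succ_le_of_lt hNm))]
    · refine Finset.sum_congr rfl fun i hi => ?_
      have hi' : i ≤ N := Nat.lt_succ_iff.1 (Finset.mem_range.1 hi)
      have := mono hi'
      simp only at this
      rw [rnH, if_pos (by linarith), one_mul]
    · intro i _ hi
      have hi' : N + 1 ≤ i := by simpa using hi
      have := mono hi'
      simp only at this
      rw [rnH, if_neg (by linarith), zero_mul]
  rw [hZ]
  have hZ2 : ∑ i ∈ Finset.range (N + 1), (ξ i - 1) = ∑ i ∈ Finset.range (N + 1), ξ i - (N + 1) := by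
    rw [Finset.sum_sub_distrib]; simp
  set Z := ∑ i ∈ Finset.range (N + 1), (ξ i - 1)
  have hle : |(N : ℝ) - t| ≤ |Z| + 1 + ξ N := by
    rw [Finset.sum_range_succ] at hN1' hZ2
    have h1 := neg_abs_le Z
    have h2 := le_abs_self Z
    have h3 := h N
    rw [abs_le]
    constructor <;> linarith
  refine (rn_three hr (abs_nonneg Z) zero_le_one (h N) (abs_nonneg _) hle).trans ?_
  rw [Real.one_rpow]
  have : ξ N ^ r ≤ ∑ i ∈ Finset.range m, ξ i ^ r :=
    Finset.single_le_sum (f := fun i => ξ i ^ r) (fun i _ => Real.rpow_nonneg (h i) r)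
      (Finset.mem_range.2 hNm)
  gcongr

lemma rn_large {ξ : ℕ → ℝ} (h : ∀ i, 0 ≤ ξ i) {t r : ℝ} (ht : 1 ≤ t) (hr : 2 ≤ r) {m : ℕ}
    (htm : t ≤ m) (hm : ∑ i ∈ Finset.range m, ξ i ≤ t) :
    ∃ j : ℕ, ∑ i ∈ Finset.range (m * 2 ^ j), ξ i ≤ t ∧
      |(renewalCount ξ t : ℝ) - t| ^ r ≤ (2 * (m * 2 ^ j : ℕ) : ℝ) ^ r := by
  have mono := rn_psum_mono h
  have hm1 : 1 ≤ m := by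
    have : (1:ℝ) ≤ m := ht.trans htm
    exact_mod_cast this
  set s : Set ℕ := {n : ℕ | ∑ i ∈ Finset.range n, ξ i ≤ t} with hs
  by_cases hbdd : BddAbove s
  · have hms : m ∈ s := hm
    set N := renewalCount ξ t with hN
    have hNs : N ∈ s := Nat.sSup_mem ⟨m, hms⟩ hbdd
    have hmN : m ≤ N := le_csSup hbdd hms
    have hq : N / m ≠ 0 := (Nat.div_pos hmN hm1).ne'
    refine ⟨Nat.log 2 (N / m), ?_, ?_⟩
    · have h1 : m * 2 ^ Nat.log 2 (N / m) ≤ N :=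
        (Nat.mul_le_mul_left m (Nat.pow_log_le_self 2 hq)).trans (Nat.mul_div_le N m)
      exact (mono h1).trans hNs
    · have h2 : N < 2 * (m * 2 ^ Nat.log 2 (N / m)) := by
        have := Nat.lt_pow_succ_log_self (b := 2) (by norm_num) (N / m)
        rw [Nat.div_lt_iff_lt_mul hm1, pow_succ] at this
        linarith
      have h2' : (N : ℝ) ≤ 2 * (m * 2 ^ Nat.log 2 (N / m) : ℕ) := by exact_mod_cast h2.le
      have hmN' : (m : ℝ) ≤ N := by exact_mod_cast hmN
      refine Real.rpow_le_rpow (abs_nonneg _) ?_ (by linarith)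
      rw [abs_le]
      constructor <;> linarith
  · refine ⟨0, by simpa using hm, ?_⟩
    have h0 : renewalCount ξ t = 0 := by
      rw [renewalCount]; exact Nat.sSup_of_not_bddAbove hbdd
    refine Real.rpow_le_rpow (abs_nonneg _) ?_ (by linarith)
    rw [h0]
    simp only [Nat.cast_zero, zero_sub, abs_neg, pow_zero, mul_one]
    rw [abs_of_nonneg (by linarith)]
    linarith

/-- pointwise bound -/
lemma rn_pointwise {ξ : ℕ → ℝ} (h : ∀ i, 0 ≤ ξ i) {t r : ℝ} (ht : 1 ≤ t) (hr : 2 ≤ r) {m : ℕ}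
    (htm : t ≤ m) :
    ENNReal.ofReal (|(renewalCount ξ t : ℝ) - t| ^ r) ≤
      ENNReal.ofReal (3 ^ r * (|∑ i ∈ Finset.range m, rnH t i ξ * (ξ i - 1)| ^ r + 1
        + ∑ i ∈ Finset.range m, ξ i ^ r))
      + ∑' j : ℕ, Set.indicator {ξ : ℕ → ℝ | ∑ i ∈ Finset.range (m * 2 ^ j), ξ i ≤ t}
          (fun _ => ENNReal.ofReal ((2 * (m * 2 ^ j : ℕ) : ℝ) ^ r)) ξ := by
  rcases lt_or_ge t (∑ i ∈ Finset.range m, ξ i) with hm | hm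
  · exact (ENNReal.ofReal_le_ofReal (rn_small h ht hr hm)).trans le_self_add
  · obtain ⟨j, hj, hle⟩ := rn_large h ht hr htm hm
    refine le_trans ?_ le_add_self
    refine le_trans ?_ (ENNReal.le_tsum j)
    rw [Set.indicator_of_mem
      (show ξ ∈ {ξ : ℕ → ℝ | ∑ i ∈ Finset.range (m * 2 ^ j), ξ i ≤ t} from hj)]
    exact ENNReal.ofReal_le_ofReal hle

lemma rn_chernoff {Ω : Type*} [MeasurableSpace Ω] {μ : Measure Ω} [IsProbabilityMeasure μ]
    {X : ℕ → Ω → ℝ} (hm : ∀ i, Measurable (X i)) (hi : iIndepFun X μ)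
    (h0 : ∀ i, ∀ᵐ ω ∂μ, 0 ≤ X i ω) {θ t φ : ℝ} (hθ : 0 < θ) (ht : 1 ≤ t)
    (hφ : ∀ i, ∫ ω, Real.exp (-θ * X i ω) ∂μ = φ) (n : ℕ) :
    μ.real {ω | ∑ i ∈ Finset.range n, X i ω ≤ t}
      ≤ Real.exp θ * Real.exp (-(n * (1 - φ) / t)) := by
  have ht0 : 0 < t := by linarith
  have hc : -(θ / t) ≤ 0 := by have : 0 < θ / t := by positivity
                               linarith
  have hIntg : ∀ c : ℝ, c ≤ 0 → ∀ f : Ω → ℝ, Measurable f → (∀ᵐ ω ∂μ, 0 ≤ f ω) →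
      Integrable (fun ω => Real.exp (c * f ω)) μ := by
    intro c hc f hf hf0
    refine Integrable.mono' (integrable_const (1:ℝ)) (Measurable.aestronglyMeasurable (by fun_prop)) ?_
    filter_upwards [hf0] with ω h
    rw [Real.norm_of_nonneg (Real.exp_pos _).le]
    exact Real.exp_le_one_iff.2 (mul_nonpos_of_nonpos_of_nonneg hc h)
  have hmgf : ∀ i, mgf (X i) μ (-(θ / t)) ≤ Real.exp (-((1 - φ) / t)) := by
    intro i
    have h1 : mgf (X i) μ (-(θ / t)) ≤ ∫ ω, ((1 / t) * Real.exp (-θ * X i ω) + (1 - 1 / t)) ∂μ := by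
      refine integral_mono (hIntg _ hc _ (hm i) (h0 i))
        (((hIntg (-θ) (by linarith) _ (hm i) (h0 i)).const_mul _).add (integrable_const _)) ?_
      intro ω
      have := convexOn_exp.2 (Set.mem_univ (-θ * X i ω)) (Set.mem_univ (0:ℝ))
        (by positivity : 0 ≤ 1 / t)
        (show 0 ≤ 1 - 1 / t by rw [sub_nonneg, div_le_one ht0]; exact ht) (by ring)
      simp only [smul_eq_mul, mul_zero, add_zero, Real.exp_zero, mul_one] at this
      refine le_trans (le_of_eq ?_) this
      congr 1
      field_simp
    rw [integral_add ((hIntg (-θ) (by linarith) _ (hm i) (h0 i)).const_mul _) (integrable_const _),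
      integral_const_mul, hφ] at h1
    simp only [integral_const, probReal_univ, one_smul] at h1
    refine h1.trans ?_
    have := Real.add_one_le_exp (-((1 - φ) / t))
    refine le_trans (le_of_eq ?_) this
    ring
  have hsum0 : ∀ᵐ ω ∂μ, 0 ≤ (∑ i ∈ Finset.range n, X i) ω := by
    filter_upwards [ae_all_iff.2 h0] with ω h
    rw [Finset.sum_apply]
    exact Finset.sum_nonneg fun i _ => h i
  have hch := measure_le_le_exp_mul_mgf (μ := μ) (X := ∑ i ∈ Finset.range n, X i) t hc
    (hIntg _ hc _ (by fun_prop) hsum0)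
  simp only [Finset.sum_apply] at hch
  refine hch.trans ?_
  rw [neg_neg, div_mul_cancel₀ _ ht0.ne', hi.mgf_sum hm]
  gcongr
  calc ∏ i ∈ Finset.range n, mgf (X i) μ (-(θ / t))
      ≤ ∏ i ∈ Finset.range n, Real.exp (-((1 - φ) / t)) :=
        Finset.prod_le_prod (fun i _ => mgf_nonneg) fun i _ => hmgf i
    _ = _ := by
        rw [Finset.prod_const, Finset.card_range, ← Real.exp_nat_mul]
        congr 1; ring

lemma rn_markov {Ω : Type*} [MeasurableSpace Ω] {μ : Measure Ω} [IsProbabilityMeasure μ]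
    {X : ℕ → Ω → ℝ} (hm : ∀ i, Measurable (X i)) (hi : iIndepFun X μ) {r A t : ℝ} (hr : 2 ≤ r)
    (hX1 : ∀ i, ∫ ω, (X i ω - 1) ∂μ = 0) (hXi : ∀ i, Integrable (fun ω => |X i ω - 1| ^ r) μ)
    (hXA : ∀ i, ∫ ω, |X i ω - 1| ^ r ∂μ = A) {n : ℕ} (ht : 1 ≤ t) (hn : 2 * t ≤ n) :
    μ.real {ω | ∑ i ∈ Finset.range n, X i ω ≤ t} * (n : ℝ) ^ (r / 2) ≤ (8 * r) ^ r * A := by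
  have hmz := rn_mz hm hi hr hX1 hXi hXA (fun _ _ => 1) (fun _ => measurable_const) (by simp)
    (by simp) n
  simp only [one_mul] at hmz
  have hmk := mul_meas_ge_le_integral_of_nonneg (μ := μ)
    (Filter.Eventually.of_forall fun ω => by positivity) hmz.1 (((n : ℝ) / 2) ^ r)
  have hn0 : (0:ℝ) < n := by linarith
  have hsub : μ.real {ω | ∑ i ∈ Finset.range n, X i ω ≤ t}
      ≤ μ.real {ω | ((n : ℝ) / 2) ^ r ≤ |∑ i ∈ Finset.range n, (X i ω - 1)| ^ r} := by
    refine measureReal_mono fun ω hω => ?_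
    have hω : ∑ i ∈ Finset.range n, X i ω ≤ t := hω
    refine Real.rpow_le_rpow (by positivity) ?_ (by linarith)
    rw [Finset.sum_sub_distrib]
    simp only [Finset.sum_const, Finset.card_range, nsmul_eq_mul, mul_one]
    rw [abs_of_nonpos (by linarith)]
    linarith
  have h1 := (mul_le_mul_of_nonneg_left hsub (by positivity : 0 ≤ ((n : ℝ) / 2) ^ r)).trans
    (hmk.trans hmz.2)
  set P := μ.real {ω | ∑ i ∈ Finset.range n, X i ω ≤ t}
  have e : ((n : ℝ) / 2) ^ r = (n : ℝ) ^ (r / 2) * (n : ℝ) ^ (r / 2) / 2 ^ r := by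
    rw [Real.div_rpow hn0.le (by norm_num), ← Real.rpow_add hn0]
    congr 2; ring
  have e2 : (8 * r) ^ r = 2 ^ r * (4 * r) ^ r := by
    rw [← Real.mul_rpow (by norm_num) (by linarith)]
    congr 1; ring
  rw [e, div_mul_eq_mul_div, div_le_iff₀ (by positivity)] at h1
  have hp : 0 < (n : ℝ) ^ (r / 2) := by positivity
  rw [e2]
  refine le_of_mul_le_mul_left ?_ hp
  calc _ = (n : ℝ) ^ (r / 2) * (n : ℝ) ^ (r / 2) * P := by ring
    _ ≤ _ := h1
    _ = _ := by ring

lemma rn_split {Ω : Type*} [MeasurableSpace Ω] {μ : Measure Ω} [IsProbabilityMeasure μ]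
    {X : ℕ → Ω → ℝ} (hm : ∀ i, Measurable (X i)) (hi : iIndepFun X μ)
    (h0 : ∀ i, ∀ᵐ ω ∂μ, 0 ≤ X i ω) (t : ℝ) (k : ℕ) :
    μ.real {ω | ∑ i ∈ Finset.range (2 * k), X i ω ≤ t}
      ≤ μ.real {ω | ∑ i ∈ Finset.range k, X i ω ≤ t}
        * μ.real {ω | ∑ i ∈ Finset.range k, X (k + i) ω ≤ t} := by
  have h := hi.indepFun_finset (Finset.range k) (Finset.Ico k (2 * k)) (by
    rw [Finset.disjoint_left]; intro i; simp; omega) hm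
  have h2 := h.comp (φ := fun v : Finset.range k → ℝ => ∑ i, v i)
    (ψ := fun v : Finset.Ico k (2 * k) → ℝ => ∑ i, v i) (by fun_prop) (by fun_prop)
  have e1 : ((fun v : Finset.range k → ℝ => ∑ i, v i) ∘ fun a i => X (↑i) a)
      = fun ω => ∑ i ∈ Finset.range k, X i ω := by
    funext ω
    exact Finset.sum_coe_sort (Finset.range k) (fun i => X i ω)
  have e2 : ((fun v : Finset.Ico k (2 * k) → ℝ => ∑ i, v i) ∘ fun a i => X (↑i) a)
      = fun ω => ∑ i ∈ Finset.range k, X (k + i) ω := by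
    funext ω
    refine (Finset.sum_coe_sort (Finset.Ico k (2 * k)) (fun i => X i ω)).trans ?_
    rw [Finset.sum_Ico_eq_sum_range]
    congr 2; omega
  rw [e1, e2] at h2
  have h3 := h2.measure_inter_preimage_eq_mul (Set.Iic t) (Set.Iic t) measurableSet_Iic measurableSet_Iic
  have h4 : μ {ω | ∑ i ∈ Finset.range (2 * k), X i ω ≤ t}
      ≤ μ ((fun ω => ∑ i ∈ Finset.range k, X i ω) ⁻¹' Set.Iic t ∩
        (fun ω => ∑ i ∈ Finset.range k, X (k + i) ω) ⁻¹' Set.Iic t) := by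
    refine measure_mono_ae ?_
    filter_upwards [ae_all_iff.2 h0] with ω hω hle
    have hle : ∑ i ∈ Finset.range (2 * k), X i ω ≤ t := hle
    rw [two_mul, Finset.sum_range_add] at hle
    have p1 : 0 ≤ ∑ i ∈ Finset.range k, X i ω := Finset.sum_nonneg fun i _ => hω i
    have p2 : 0 ≤ ∑ i ∈ Finset.range k, X (k + i) ω := Finset.sum_nonneg fun i _ => hω _
    constructor
    · show ∑ i ∈ Finset.range k, X i ω ≤ t
      linarith
    · show ∑ i ∈ Finset.range k, X (k + i) ω ≤ t
      linarith
  rw [h3] at h4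
  have := ENNReal.toReal_mono (ENNReal.mul_ne_top (measure_ne_top _ _) (measure_ne_top _ _)) h4
  rw [ENNReal.toReal_mul] at this
  exact this

lemma rn_exp_neg {y p : ℝ} (hy : 0 < y) (hp : 0 < p) : Real.exp (-y) ≤ (p / y) ^ p := by
  have h1 : y / p ≤ Real.exp (y / p) := by linarith [Real.add_one_le_exp (y / p)]
  have h2 : (y / p) ^ p ≤ Real.exp y := by
    calc (y / p) ^ p ≤ (Real.exp (y / p)) ^ p := Real.rpow_le_rpow (by positivity) h1 hp.le
      _ = Real.exp y := by rw [← Real.exp_mul, div_mul_cancel₀ _ hp.ne']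
  rw [Real.exp_neg, ← inv_div, Real.inv_rpow (by positivity)]
  exact inv_anti₀ (by positivity) h2

/-- bound of the term of index `j` in the dyadic sum; `K = k * 2 ^ j` -/
lemma rn_term {Ω : Type*} [MeasurableSpace Ω] {μ : Measure Ω} [IsProbabilityMeasure μ]
    {X : ℕ → Ω → ℝ} (hm : ∀ i, Measurable (X i)) (hi : iIndepFun X μ)
    (h0 : ∀ i, ∀ᵐ ω ∂μ, 0 ≤ X i ω) {θ t φ : ℝ} (hθ : 0 < θ) (ht : 1 ≤ t)
    (hφ : ∀ i, ∫ ω, Real.exp (-θ * X i ω) ∂μ = φ) (hφ1 : φ < 1) {r A : ℝ} (hr : 2 ≤ r)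
    (hX1 : ∀ i, ∫ ω, (X i ω - 1) ∂μ = 0) (hXi : ∀ i, Integrable (fun ω => |X i ω - 1| ^ r) μ)
    (hXA : ∀ i, ∫ ω, |X i ω - 1| ^ r ∂μ = A) (K j : ℕ) (hK : 2 * t * 2 ^ j ≤ K) :
    (2 * (2 * K : ℕ) : ℝ) ^ r * μ.real {ω | ∑ i ∈ Finset.range (2 * K), X i ω ≤ t}
      ≤ (Real.exp θ * ((32 * r) ^ r * A) * (r / (1 - φ)) ^ (r / 2 + 1) * t ^ (r / 2)) * (1 / 2) ^ j := by
  have hA : 0 ≤ A := by rw [← hXA 0]; exact integral_nonneg fun _ => by positivity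
  have hq : 0 < 1 - φ := by linarith
  have h2j : (1:ℝ) ≤ 2 ^ j := one_le_pow₀ (by norm_num)
  have hK2 : 2 * t ≤ K := le_trans (by nlinarith) hK
  have hK0 : (0:ℝ) < K := by linarith
  have ht0 : 0 < t := by linarith
  have hc := rn_chernoff hm hi h0 hθ ht hφ K
  have hinj : Function.Injective (fun i => K + i) := fun a b h => by simpa using h
  have hmk := rn_markov (X := fun i => X (K + i)) (fun i => hm _) (hi.precomp hinj) hr
    (fun i => hX1 _) (fun i => hXi _) (fun i => hXA _) ht hK2
  have hs := rn_split hm hi h0 t K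
  set P := μ.real {ω | ∑ i ∈ Finset.range K, X i ω ≤ t}
  set Q := μ.real {ω | ∑ i ∈ Finset.range K, X (K + i) ω ≤ t}
  have hQ0 : 0 ≤ Q := measureReal_nonneg
  have hP0 : 0 ≤ P := measureReal_nonneg
  have hE := rn_exp_neg (y := K * (1 - φ) / t) (p := r / 2 + 1) (by positivity) (by linarith)
  have hE2 : Real.exp (-(K * (1 - φ) / t)) ≤ (r / (1 - φ)) ^ (r / 2 + 1) * (t / K) ^ (r / 2 + 1) := by
    refine hE.trans ?_
    rw [← Real.mul_rpow (by positivity) (by positivity)]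
    refine Real.rpow_le_rpow (by positivity) ?_ (by linarith)
    calc (r / 2 + 1) / (K * (1 - φ) / t) ≤ r / (K * (1 - φ) / t) := by gcongr; linarith
      _ = _ := by field_simp
  have e3 : (K : ℝ) ^ (r / 2) * (t / K) ^ (r / 2 + 1) = t ^ (r / 2) * (t / K) := by
    rw [Real.rpow_add_one (by positivity), ← mul_assoc, ← Real.mul_rpow hK0.le (by positivity),
      mul_div_cancel₀ _ hK0.ne']
  have e4 : t / K ≤ (1 / 2) ^ j := by
    rw [div_le_iff₀ hK0, one_div, inv_pow, inv_mul_eq_div, le_div_iff₀ (by positivity)]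
    nlinarith
  have e5 : (2 * (2 * K : ℕ) : ℝ) ^ r = 4 ^ r * ((K : ℝ) ^ (r / 2) * (K : ℝ) ^ (r / 2)) := by
    rw [← Real.rpow_add hK0, add_halves, ← Real.mul_rpow (by norm_num) hK0.le]
    congr 1; push_cast; ring
  have e6 : (32 * r) ^ r = 4 ^ r * (8 * r) ^ r := by
    rw [← Real.mul_rpow (by norm_num) (by linarith)]
    congr 1; ring
  rw [e5, e6]
  calc _ ≤ 4 ^ r * ((K : ℝ) ^ (r / 2) * (K : ℝ) ^ (r / 2)) * (P * Q) := by gcongr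
    _ = 4 ^ r * (Q * (K : ℝ) ^ (r / 2)) * ((K : ℝ) ^ (r / 2) * P) := by ring
    _ ≤ 4 ^ r * ((8 * r) ^ r * A) * ((K : ℝ) ^ (r / 2) * (Real.exp θ *
          ((r / (1 - φ)) ^ (r / 2 + 1) * (t / K) ^ (r / 2 + 1)))) := by
        gcongr
        exact hc.trans (by gcongr)
    _ = 4 ^ r * ((8 * r) ^ r * A) * (Real.exp θ * (r / (1 - φ)) ^ (r / 2 + 1)) *
          ((K : ℝ) ^ (r / 2) * (t / K) ^ (r / 2 + 1)) := by ring
    _ = 4 ^ r * ((8 * r) ^ r * A) * (Real.exp θ * (r / (1 - φ)) ^ (r / 2 + 1)) *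
          (t ^ (r / 2) * (t / K)) := by rw [e3]
    _ ≤ 4 ^ r * ((8 * r) ^ r * A) * (Real.exp θ * (r / (1 - φ)) ^ (r / 2 + 1)) *
          (t ^ (r / 2) * (1 / 2) ^ j) := by gcongr
    _ = _ := by ring

lemma rn_final_arith {r q t θ A B : ℝ} (hr : 2 ≤ r) (hq : 0 < q) (hq1 : q ≤ 1) (ht : 1 ≤ t)
    (hθ : 0 < θ) (hB : 1 ≤ B) (hA0 : 0 ≤ A) (hA : A ≤ 2 * B) {m : ℝ} (hm1 : 1 ≤ m) (hm : m ≤ 9 * t) :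
    3 ^ r * ((4 * r) ^ r * m ^ (r / 2) * A + 1 + m * B)
      + (Real.exp θ * ((32 * r) ^ r * A) * (r / q) ^ (r / 2 + 1) * t ^ (r / 2)) * 2
    ≤ Real.exp θ * B * (10 ^ 5 * r ^ 2 / q) ^ (r + 1) * t ^ (r / 2) := by
  have hr0 : 0 < r := by linarith
  have ht0 : 0 < t := by linarith
  set T := t ^ (r / 2) with hT
  set D := (36 * r ^ 2 / q) ^ (r + 1) with hD
  have hT1 : 1 ≤ T := Real.one_le_rpow ht (by linarith)
  have hE1 : 1 ≤ Real.exp θ := Real.one_le_exp hθ.le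
  have hmr : m ^ (r / 2) ≤ 3 ^ r * T := by
    calc m ^ (r / 2) ≤ (9 * t) ^ (r / 2) := Real.rpow_le_rpow (by linarith) hm (by linarith)
      _ = 3 ^ r * T := by
        rw [Real.mul_rpow (by norm_num) ht0.le, show (9:ℝ) = 3 ^ (2:ℝ) by norm_num,
          ← Real.rpow_mul (by norm_num)]
        congr 2; ring
  have hmm : m ≤ m ^ (r / 2) := by
    simpa using Real.rpow_le_rpow_of_exponent_le hm1 (show 1 ≤ r / 2 by linarith)
  have hm1' : 1 ≤ m ^ (r / 2) := hm1.trans hmm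
  have h4r : 1 ≤ (4 * r) ^ r := Real.one_le_rpow (by linarith) (by linarith)
  have hrq : r ≤ r / q := by rw [le_div_iff₀ hq]; nlinarith
  have h1 : 3 ^ r * ((4 * r) ^ r * m ^ (r / 2) * A + 1 + m * B) ≤ 4 * (D * B * T) := by
    calc 3 ^ r * ((4 * r) ^ r * m ^ (r / 2) * A + 1 + m * B)
        ≤ 3 ^ r * ((4 * r) ^ r * m ^ (r / 2) * (2 * B) + (4 * r) ^ r * m ^ (r / 2) * B
            + (4 * r) ^ r * m ^ (r / 2) * B) := by
          have a1 : 1 ≤ (4 * r) ^ r * m ^ (r / 2) := one_le_mul_of_one_le_of_one_le h4r hm1'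
          have a2 : m ≤ (4 * r) ^ r * m ^ (r / 2) :=
            hmm.trans (le_mul_of_one_le_left (by linarith) h4r)
          have a3 : 1 ≤ (4 * r) ^ r * m ^ (r / 2) * B := one_le_mul_of_one_le_of_one_le a1 hB
          gcongr
      _ = 4 * (3 ^ r * (4 * r) ^ r * m ^ (r / 2) * B) := by ring
      _ ≤ 4 * (3 ^ r * (4 * r) ^ r * (3 ^ r * T) * B) := by gcongr
      _ = 4 * ((3 ^ r * (4 * r) ^ r * 3 ^ r) * B * T) := by ring
      _ ≤ 4 * (D * B * T) := by
          have : 3 ^ r * (4 * r) ^ r * 3 ^ r ≤ D := by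
            rw [← Real.mul_rpow (by norm_num) (by positivity), ← Real.mul_rpow (by positivity) (by norm_num)]
            have b1 : 3 * (4 * r) * 3 ≤ 36 * r ^ 2 / q := by
              rw [le_div_iff₀ hq]; nlinarith
            calc _ ≤ (36 * r ^ 2 / q) ^ r := Real.rpow_le_rpow (by positivity) b1 hr0.le
              _ ≤ D := Real.rpow_le_rpow_of_exponent_le (by linarith) (by linarith)
          gcongr
  have h2 : (32 * r) ^ r * (r / q) ^ (r / 2 + 1) ≤ D := by
    calc (32 * r) ^ r * (r / q) ^ (r / 2 + 1) ≤ (32 * r) ^ (r + 1) * (r / q) ^ (r + 1) := by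
          have c1 : (32 * r) ^ r ≤ (32 * r) ^ (r + 1) :=
            Real.rpow_le_rpow_of_exponent_le (by linarith) (by linarith)
          have c2 : (r / q) ^ (r / 2 + 1) ≤ (r / q) ^ (r + 1) :=
            Real.rpow_le_rpow_of_exponent_le (by linarith) (by linarith)
          gcongr
      _ = (32 * r * (r / q)) ^ (r + 1) := (Real.mul_rpow (by positivity) (by positivity)).symm
      _ ≤ D := by
          refine Real.rpow_le_rpow (by positivity) ?_ (by linarith)
          rw [show 32 * r * (r / q) = 32 * r ^ 2 / q by ring]
          gcongr
          norm_num
  have hD0 : 0 ≤ D := by positivity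
  have h3 : 8 * D ≤ (10 ^ 5 * r ^ 2 / q) ^ (r + 1) := by
    have : (8:ℝ) ≤ 8 ^ (r + 1) := by
      simpa using Real.rpow_le_rpow_of_exponent_le (show (1:ℝ) ≤ 8 by norm_num) (show 1 ≤ r + 1 by linarith)
    calc 8 * D ≤ 8 ^ (r + 1) * D := by gcongr
      _ = (8 * (36 * r ^ 2 / q)) ^ (r + 1) := by rw [Real.mul_rpow (by positivity) (by positivity)]
      _ ≤ _ := by
          refine Real.rpow_le_rpow (by positivity) ?_ (by linarith)
          rw [show 8 * (36 * r ^ 2 / q) = 288 * r ^ 2 / q by ring]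
          gcongr
          norm_num
  calc _ ≤ 4 * (D * B * T) + (Real.exp θ * ((32 * r) ^ r * (2 * B)) * (r / q) ^ (r / 2 + 1) * T) * 2 := by
        gcongr
    _ = 1 * (4 * (D * B * T)) + Real.exp θ * (4 * (((32 * r) ^ r * (r / q) ^ (r / 2 + 1)) * B * T)) := by
        ring
    _ ≤ Real.exp θ * (4 * (D * B * T)) + Real.exp θ * (4 * (D * B * T)) := by gcongr
    _ = Real.exp θ * B * (8 * D) * T := by ring
    _ ≤ _ := by gcongr

/-- Explicit bound on the `r`-th central moment of an ordinary renewal counting process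
`N_o(t)` with i.i.d. renewal intervals `Sseq i` distributed as `S`, where `E[S] = 1` and
`E[S^r] < ∞` for some `r ≥ 2`. -/
theorem ordinary_renewal_central_moment
    {Ω : Type*} [MeasurableSpace Ω] (μ : Measure Ω) [IsProbabilityMeasure μ]
    (S : Ω → ℝ) (hSmeas : Measurable S) (hSnn : ∀ᵐ ω ∂μ, 0 ≤ S ω)
    (hES : ∫ ω, S ω ∂μ = 1)
    (r : ℝ) (hr : 2 ≤ r)
    (hSr : Integrable (fun ω => S ω ^ r) μ)
    (Sseq : ℕ → Ω → ℝ)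
    (hmeas : ∀ i, Measurable (Sseq i))
    (hindep : iIndepFun Sseq μ)
    (hlaw : ∀ i, μ.map (Sseq i) = μ.map S) :
    ∀ t : ℝ, 1 ≤ t → ∀ θ : ℝ, 0 < θ →
      ∫⁻ ω, ENNReal.ofReal (|(renewalCount (fun i => Sseq i ω) t : ℝ) - t| ^ r) ∂μ
        ≤ ENNReal.ofReal (Real.exp θ * (∫ ω, S ω ^ r ∂μ)
            * (10 ^ 5 * r ^ 2 / (1 - ∫ ω, Real.exp (-θ * S ω) ∂μ)) ^ (r + 1) * t ^ (r / 2)) := by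
  intro t ht θ hθ
  have hr0 : 0 < r := by linarith
  have ht0 : 0 < t := by linarith
  have hid : ∀ i, IdentDistrib (Sseq i) S μ μ := fun i =>
    ⟨(hmeas i).aemeasurable, hSmeas.aemeasurable, hlaw i⟩
  have hnn : ∀ i, ∀ᵐ ω ∂μ, 0 ≤ Sseq i ω := fun i =>
    (hid i).symm.ae_snd (p := fun x => 0 ≤ x) measurableSet_Ici hSnn
  have hSint : Integrable S μ := by
    by_contra h
    rw [integral_undef h] at hES
    exact zero_ne_one hES
  -- `B ≥ 1`
  set B := ∫ ω, S ω ^ r ∂μ with hBdef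
  have hB : 1 ≤ B := by
    have hj := (rn_jensen (μ := μ) (Y := fun ω => S ω ^ r) (s := 1 / r)
      (by filter_upwards [hSnn] with ω h using Real.rpow_nonneg h r) hSr (by positivity)
      (by rw [div_le_one hr0]; linarith)).2
    have e : ∫ ω, (S ω ^ r) ^ (1 / r) ∂μ = 1 := by
      refine Eq.trans (integral_congr_ae ?_) hES
      filter_upwards [hSnn] with ω h
      rw [← Real.rpow_mul h, mul_one_div_cancel hr0.ne', Real.rpow_one]
    rw [e] at hj
    by_contra hlt
    have hB0 : 0 ≤ B := integral_nonneg_of_ae (by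
      filter_upwards [hSnn] with ω h using Real.rpow_nonneg h r)
    have := Real.rpow_lt_one hB0 (not_le.1 hlt) (show 0 < 1 / r by positivity)
    linarith
  -- centred moment
  have hpt : ∀ᵐ ω ∂μ, |S ω - 1| ^ r ≤ 1 + S ω ^ r := by
    filter_upwards [hSnn] with ω h
    have hp := Real.rpow_nonneg h r
    rcases le_total (S ω) 1 with h1 | h1
    · have : |S ω - 1| ≤ 1 := by rw [abs_le]; constructor <;> linarith
      have := Real.rpow_le_one (abs_nonneg _) this hr0.le
      linarith
    · have : |S ω - 1| ≤ S ω := by rw [abs_le]; constructor <;> linarith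
      have := Real.rpow_le_rpow (abs_nonneg _) this hr0.le
      linarith
  have hcm : Measurable fun x : ℝ => |x - 1| ^ r := by fun_prop
  have hSc : Integrable (fun ω => |S ω - 1| ^ r) μ := by
    refine Integrable.mono' ((integrable_const (1:ℝ)).add hSr)
      (hcm.comp hSmeas).aestronglyMeasurable ?_
    filter_upwards [hpt] with ω h
    rw [Real.norm_of_nonneg (by positivity)]
    exact h
  set A := ∫ ω, |S ω - 1| ^ r ∂μ with hAdef
  have hA0 : 0 ≤ A := integral_nonneg fun _ => by positivity
  have hA : A ≤ 2 * B := by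
    have := integral_mono_ae hSc ((integrable_const (1:ℝ)).add hSr) hpt
    simp only [Pi.add_apply] at this
    rw [integral_add (integrable_const _) hSr] at this
    simp only [integral_const, probReal_univ, one_smul] at this
    linarith
  -- `q`
  set φ := ∫ ω, Real.exp (-θ * S ω) ∂μ with hφdef
  have hexp1 : ∀ᵐ ω ∂μ, Real.exp (-θ * S ω) ≤ 1 := by
    filter_upwards [hSnn] with ω h
    exact Real.exp_le_one_iff.2 (by nlinarith)
  have hexpm : Measurable fun x : ℝ => Real.exp (-θ * x) := by fun_prop
  have hexpi : Integrable (fun ω => Real.exp (-θ * S ω)) μ := by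
    refine Integrable.mono' (integrable_const (1:ℝ)) (hexpm.comp hSmeas).aestronglyMeasurable ?_
    filter_upwards [hexp1] with ω h
    rwa [Real.norm_of_nonneg (Real.exp_pos _).le]
  have hφ0 : 0 ≤ φ := integral_nonneg fun _ => (Real.exp_pos _).le
  have hφ1 : φ < 1 := by
    by_contra hge
    have hi2 : Integrable (fun ω => 1 - Real.exp (-θ * S ω)) μ := (integrable_const _).sub hexpi
    have hn2 : 0 ≤ᵐ[μ] fun ω => 1 - Real.exp (-θ * S ω) := by
      filter_upwards [hexp1] with ω h
      simpa using h
    have e : ∫ ω, (1 - Real.exp (-θ * S ω)) ∂μ = 1 - φ := by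
      rw [integral_sub (integrable_const _) hexpi]; simp [hφdef]
    have z : ∫ ω, (1 - Real.exp (-θ * S ω)) ∂μ = 0 :=
      le_antisymm (by linarith) (integral_nonneg_of_ae hn2)
    rw [integral_eq_zero_iff_of_nonneg_ae hn2 hi2] at z
    have : ∫ ω, S ω ∂μ = 0 := by
      rw [← integral_zero Ω ℝ (μ := μ)]
      refine integral_congr_ae ?_
      filter_upwards [z] with ω h
      have h' : 1 - Real.exp (-θ * S ω) = 0 := h
      have : Real.exp (-θ * S ω) = 1 := by linarith
      rw [Real.exp_eq_one_iff] at this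
      rcases mul_eq_zero.1 this with h | h
      · linarith
      · exact h
    linarith
  -- transfer to the sequence
  have hφs : ∀ i, ∫ ω, Real.exp (-θ * Sseq i ω) ∂μ = φ := fun i => ((hid i).comp hexpm).integral_eq
  have hXA : ∀ i, ∫ ω, |Sseq i ω - 1| ^ r ∂μ = A := fun i => ((hid i).comp hcm).integral_eq
  have hXi : ∀ i, Integrable (fun ω => |Sseq i ω - 1| ^ r) μ := fun i =>
    ((hid i).comp hcm).integrable_iff.2 hSc
  have hX1 : ∀ i, ∫ ω, (Sseq i ω - 1) ∂μ = 0 := fun i => by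
    rw [integral_sub ((hid i).integrable_iff.2 hSint) (integrable_const _), (hid i).integral_eq, hES]
    simp
  have hrm : Measurable fun x : ℝ => x ^ r := by fun_prop
  have hBi : ∀ i, ∫ ω, Sseq i ω ^ r ∂μ = B := fun i => ((hid i).comp hrm).integral_eq
  have hri : ∀ i, Integrable (fun ω => Sseq i ω ^ r) μ := fun i =>
    ((hid i).comp hrm).integrable_iff.2 hSr
  -- choice of the cut
  set k := ⌈2 * t⌉₊ with hk
  have hk1 : 2 * t ≤ k := Nat.le_ceil _
  have hk2 : (k : ℝ) < 2 * t + 1 := Nat.ceil_lt_add_one (by linarith)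
  set m := 2 * k with hm
  have hmc : (m : ℝ) = 2 * k := by rw [hm]; push_cast; ring
  have hseq : Measurable fun ω => fun i => Sseq i ω := measurable_pi_lambda _ hmeas
  have hset : ∀ n, MeasurableSet {ξ : ℕ → ℝ | ∑ i ∈ Finset.range n, ξ i ≤ t} := fun n =>
    measurableSet_le (Finset.measurable_sum _ fun i _ => measurable_pi_apply i) measurable_const
  have hHm : ∀ i, Measurable (rnH t i) := fun i =>
    Measurable.ite (hset i) measurable_const measurable_const
  have hmz := rn_mz hmeas hindep hr hX1 hXi hXA (rnH t) hHm
    (fun i ξ => by unfold rnH; split_ifs <;> simp)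
    (fun i ξ ξ' h => by
      unfold rnH
      rw [Finset.sum_congr rfl fun j hj => h j (Finset.mem_range.1 hj)]) m
  have hsumi : Integrable (fun ω => ∑ i ∈ Finset.range m, Sseq i ω ^ r) μ :=
    integrable_finsetSum _ fun i _ => hri i
  have hI0 : Integrable (fun ω => |∑ i ∈ Finset.range m,
      rnH t i (fun j => Sseq j ω) * (Sseq i ω - 1)| ^ r + 1) μ := hmz.1.add (integrable_const (1:ℝ))
  have hI1 : Integrable (fun ω => 3 ^ r * (|∑ i ∈ Finset.range m,
      rnH t i (fun j => Sseq j ω) * (Sseq i ω - 1)| ^ r + 1 + ∑ i ∈ Finset.range m, Sseq i ω ^ r)) μ :=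
    (hI0.add hsumi).const_mul (3 ^ r)
  have hpart1 : ∫ ω, (3 ^ r * (|∑ i ∈ Finset.range m, rnH t i (fun j => Sseq j ω) * (Sseq i ω - 1)| ^ r
      + 1 + ∑ i ∈ Finset.range m, Sseq i ω ^ r)) ∂μ
      ≤ 3 ^ r * ((4 * r) ^ r * (m : ℝ) ^ (r / 2) * A + 1 + m * B) := by
    rw [integral_const_mul, integral_add hI0 hsumi,
      integral_add hmz.1 (integrable_const (1:ℝ)), integral_finset_sum _ fun i _ => hri i]
    simp only [hBi, Finset.sum_const, Finset.card_range, nsmul_eq_mul, integral_const,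
      probReal_univ, one_smul]
    gcongr
    exact hmz.2
  set C := Real.exp θ * ((32 * r) ^ r * A) * (r / (1 - φ)) ^ (r / 2 + 1) * t ^ (r / 2) with hC
  have hq0 : 0 < 1 - φ := by linarith
  have hC0 : 0 ≤ C := by positivity
  have hterm : ∀ j : ℕ, ∫⁻ ω, Set.indicator {ξ : ℕ → ℝ | ∑ i ∈ Finset.range (m * 2 ^ j), ξ i ≤ t}
      (fun _ => ENNReal.ofReal ((2 * (m * 2 ^ j : ℕ) : ℝ) ^ r)) (fun i => Sseq i ω) ∂μ
      ≤ ENNReal.ofReal (C * (1 / 2) ^ j) := by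
    intro j
    have e : (fun ω => Set.indicator {ξ : ℕ → ℝ | ∑ i ∈ Finset.range (m * 2 ^ j), ξ i ≤ t}
      (fun _ => ENNReal.ofReal ((2 * (m * 2 ^ j : ℕ) : ℝ) ^ r)) (fun i => Sseq i ω))
      = Set.indicator {ω | ∑ i ∈ Finset.range (m * 2 ^ j), Sseq i ω ≤ t}
        (fun _ => ENNReal.ofReal ((2 * (m * 2 ^ j : ℕ) : ℝ) ^ r)) := by
      funext ω
      simp only [Set.indicator, Set.mem_ofPred_eq]
    rw [e, lintegral_indicator_const
      (show MeasurableSet {ω | ∑ i ∈ Finset.range (m * 2 ^ j), Sseq i ω ≤ t} from hseq (hset _)), ← ofReal_measureReal,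
      ← ENNReal.ofReal_mul (by positivity)]
    apply ENNReal.ofReal_le_ofReal
    have := rn_term hmeas hindep hnn hθ ht hφs hφ1 hr hX1 hXi hXA (k * 2 ^ j) j (by
      push_cast; gcongr)
    rw [← mul_assoc, ← hm] at this
    exact this
  calc _ ≤ ∫⁻ ω, (ENNReal.ofReal (3 ^ r * (|∑ i ∈ Finset.range m,
            rnH t i (fun j => Sseq j ω) * (Sseq i ω - 1)| ^ r + 1 + ∑ i ∈ Finset.range m, Sseq i ω ^ r))
          + ∑' j : ℕ, Set.indicator {ξ : ℕ → ℝ | ∑ i ∈ Finset.range (m * 2 ^ j), ξ i ≤ t}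
            (fun _ => ENNReal.ofReal ((2 * (m * 2 ^ j : ℕ) : ℝ) ^ r)) (fun i => Sseq i ω)) ∂μ := by
        refine lintegral_mono_ae ?_
        filter_upwards [ae_all_iff.2 hnn] with ω h
        exact rn_pointwise h ht hr (by rw [hmc]; linarith)
    _ = ENNReal.ofReal (∫ ω, (3 ^ r * (|∑ i ∈ Finset.range m,
            rnH t i (fun j => Sseq j ω) * (Sseq i ω - 1)| ^ r + 1 + ∑ i ∈ Finset.range m, Sseq i ω ^ r)) ∂μ)
          + ∑' j : ℕ, ∫⁻ ω, Set.indicator {ξ : ℕ → ℝ | ∑ i ∈ Finset.range (m * 2 ^ j), ξ i ≤ t}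
            (fun _ => ENNReal.ofReal ((2 * (m * 2 ^ j : ℕ) : ℝ) ^ r)) (fun i => Sseq i ω) ∂μ := by
        rw [lintegral_add_left' hI1.aemeasurable.ennreal_ofReal, ← ofReal_integral_eq_lintegral_ofReal hI1,
          lintegral_tsum]
        · intro j
          exact ((measurable_const.indicator (hset _)).comp hseq).aemeasurable
        · filter_upwards [ae_all_iff.2 hnn] with ω h
          have : 0 ≤ ∑ i ∈ Finset.range m, Sseq i ω ^ r :=
            Finset.sum_nonneg fun i _ => Real.rpow_nonneg (h i) r
          simp only [Pi.add_apply, Pi.zero_apply]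
          positivity
    _ ≤ ENNReal.ofReal (3 ^ r * ((4 * r) ^ r * (m : ℝ) ^ (r / 2) * A + 1 + m * B))
          + ∑' j : ℕ, ENNReal.ofReal (C * (1 / 2) ^ j) :=
        add_le_add (ENNReal.ofReal_le_ofReal hpart1) (ENNReal.tsum_le_tsum hterm)
    _ = ENNReal.ofReal (3 ^ r * ((4 * r) ^ r * (m : ℝ) ^ (r / 2) * A + 1 + m * B) + C * 2) := by
        rw [← ENNReal.ofReal_tsum_of_nonneg (fun j => by positivity)
          (summable_geometric_two.mul_left C), tsum_mul_left, tsum_geometric_two,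
          ← ENNReal.ofReal_add (by positivity) (by positivity)]
    _ ≤ _ := by
        apply ENNReal.ofReal_le_ofReal
        refine rn_final_arith hr hq0 (by linarith) ht hθ hB hA0 hA ?_ ?_ <;> rw [hmc] <;> linarith
end
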